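/- For every integer n with 9 ≤ n ≤ 11: every 𝒫₄-free 3-graph H on n vertices that is not isomorphic to a sub-3-graph of the starplus Sₙ^{+1} satisfies |H| ≤ 5n − 18, and equality holds if and only if H is isomorphic to SPₙ. -/

import Mathlib

open Finset

/-- `H` is a 3-graph on the vertex set `V`: every edge is a 3-element subset of `V`. -/
def ThreeGraphOn (V : Finset ℕ) (H : Finset (Finset ℕ)) : Prop :=
  ∀ e ∈ H, e ⊆ V ∧ e.card = 3

/-- Four edges form a 3-uniform minimal 4-path: `aᵢ ∩ aⱼ ≠ ∅ ↔ |i - j| ≤ 1`. -/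
def IsMinPath4 (a₀ a₁ a₂ a₃ : Finset ℕ) : Prop :=
  (a₀ ∩ a₁).Nonempty ∧ (a₁ ∩ a₂).Nonempty ∧ (a₂ ∩ a₃).Nonempty ∧
    a₀ ∩ a₂ = ∅ ∧ a₀ ∩ a₃ = ∅ ∧ a₁ ∩ a₃ = ∅

/-- `H` contains no minimal 4-path. -/
def P4Free (H : Finset (Finset ℕ)) : Prop :=
  ¬∃ a₀ ∈ H, ∃ a₁ ∈ H, ∃ a₂ ∈ H, ∃ a₃ ∈ H, IsMinPath4 a₀ a₁ a₂ a₃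

/-- `H` is a starplus on `V`: a full star with center `v` together with one
extra 3-edge not containing `v`. -/
def IsStarPlusOn (V : Finset ℕ) (H : Finset (Finset ℕ)) : Prop :=
  ∃ v ∈ V, ∃ e : Finset ℕ, e ⊆ V ∧ e.card = 3 ∧ v ∉ e ∧
    H = (V.powersetCard 3).filter (fun t => v ∈ t) ∪ {e}

/-- `H` is (isomorphic to) a sub-3-graph of the starplus on `V`. -/
def SubStarPlus (V : Finset ℕ) (H : Finset (Finset ℕ)) : Prop :=
  ∃ H' : Finset (Finset ℕ), IsStarPlusOn V H' ∧ H ⊆ H'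

/-- `H` is the `P`-star `SPₙ` on `V`: a minimal 2-path `f₁, f₂` (two 3-edges
sharing exactly one vertex) together with all triples of `V` containing a
vertex `v` outside the path and at least one vertex of the path. -/
def IsSPOn (V : Finset ℕ) (H : Finset (Finset ℕ)) : Prop :=
  ∃ v ∈ V, ∃ f₁ f₂ : Finset ℕ, f₁ ⊆ V ∧ f₂ ⊆ V ∧ f₁.card = 3 ∧ f₂.card = 3 ∧
    (f₁ ∩ f₂).card = 1 ∧ v ∉ f₁ ∪ f₂ ∧
    H = {f₁, f₂} ∪
      (V.powersetCard 3).filter (fun t => v ∈ t ∧ (t ∩ (f₁ ∪ f₂)).Nonempty)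

/-- `H` is (isomorphic to) a sub-3-graph of `SPₙ` on `V`. -/
def SubSP (V : Finset ℕ) (H : Finset (Finset ℕ)) : Prop :=
  ∃ H' : Finset (Finset ℕ), IsSPOn V H' ∧ H ⊆ H'

/-! ### Kernel-friendly checker -/

/-- an edge: its code, the mask of codes meeting it, the mask of codes meeting it twice -/
structure Ed where
  c : ℕ
  N : ℕ
  M : ℕ

/-- evaluate a natural number before passing it on -/
noncomputable def frc {α : Type} (x : ℕ) (k : ℕ → α) : α :=
  @Nat.rec (fun _ => α) (k 0) (fun p _ => k (Nat.succ p)) x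

/-- branch on a Boolean -/
noncomputable def ite' {α : Type} (b : Bool) (x y : α) : α :=
  @Bool.rec (fun _ => α) y x b

/-- codes of the triples in colex order, eleven bits each -/
noncomputable def codeTab : ℕ := 0x700d0190310610c1181301601b0150290510a11412815019812824848890920a40c608a1122224428830c2144248450860c4148250460640a81301a02c03700d0190310610c1181301580a8148288508a0940a604a0921222424828c1142244448850c2144248450620a41281902a03380680c8188308608c09602a0520a21422824c0941242444848c1142244448610a212418829031c0340640c4184304580a8148288508981282484888c114224430851061c0340640c41842c0540a41442604a092118228430700d0190310580a81482604a08c0e01a0320580a81301c03405807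

/-- code of the `t`-th triple -/
noncomputable def tcode (t : ℕ) : ℕ := Nat.land (Nat.shiftRight codeTab (Nat.mul 11 t)) 2047

/-- incidence masks of the vertices, 165 bits each -/
noncomputable def starTab : ℕ := 0x7ffffffffffc000000000000000000000000000003fe000000001ffffffffe00000000000000000000100ff0000000ff0000000fffffff0000000000000040407f00000407f000007f000007ffffc000000001010207e00010207e000207e0003f0001fffc000004040820f80040820f800820f80107c00f801ff800101020843c01020843c020843c0421e043c0f03f00404082111c04082111c082111c1088e111c471c701010208449810208449820844984224c4499269b40404082112a04082112a082112a10895112a4aab60101020844b01020844b020844b04225844b12cb7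

/-- mask of all triples containing `v` -/
noncomputable def Sm (v : ℕ) : ℕ :=
  Nat.land (Nat.shiftRight starTab (Nat.mul 165 v)) (Nat.sub (Nat.pow 2 165) 1)

/-- mask of all codes below `2 ^ 11` having bit `v` -/
noncomputable def Sw (v : ℕ) : ℕ :=
  Nat.shiftLeft (Nat.div (Nat.sub (Nat.pow 2 2048) 1) (Nat.add (Nat.pow 2 (Nat.pow 2 v)) 1))
    (Nat.pow 2 v)

noncomputable def dif (a b : ℕ) : ℕ := Nat.xor a (Nat.land a b)

noncomputable def meets (a b : ℕ) : Bool := @Nat.rec (fun _ => Bool) false (fun _ _ => true) (Nat.land a b)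

noncomputable def tb (a i : ℕ) : Bool :=
  @Nat.rec (fun _ => Bool) false (fun _ _ => true) (Nat.land (Nat.shiftRight a i) 1)

/-- exactly one bit -/
noncomputable def isPow (c : ℕ) : Bool :=
  @Nat.rec (fun _ => Bool) false (fun p _ => Nat.beq (Nat.land (Nat.succ p) p) 0) c

noncomputable def mkEd {α : Type} (t : ℕ) (k : Ed → α) : α :=
  frc (tcode t) fun e =>
  @Nat.rec (fun _ => ℕ → ℕ → α) (fun N M => k ⟨e, N, M⟩)
    (fun v ih N M => ite' (tb e v)
      (frc (Sm v) fun s => frc (Nat.lor M (Nat.land N s)) fun M' => frc (Nat.lor N s) fun N' => ih N' M')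
      (ih N M)) 11 0 0

noncomputable def trip (e f g : Ed) : ℕ :=
  ite' (meets e.c f.c)
    (ite' (meets e.c g.c)
      (ite' (meets f.c g.c) 0 (dif (Nat.xor f.N g.N) e.N))
      (ite' (meets f.c g.c) (dif (Nat.xor e.N g.N) f.N) (Nat.land (Nat.xor e.N f.N) g.N)))
    (ite' (meets e.c g.c)
      (ite' (meets f.c g.c) (dif (Nat.xor e.N f.N) g.N) (Nat.land (Nat.xor e.N g.N) f.N))
      (ite' (meets f.c g.c) (Nat.land (Nat.xor f.N g.N) e.N) 0))

noncomputable def fbP (e : Ed) (L : List Ed) : ℕ :=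
  @List.rec Ed (fun _ => ℕ) 0 (fun f tl ih =>
    Nat.lor ih (@List.rec Ed (fun _ => ℕ) 0 (fun g _ ih2 => Nat.lor ih2 (trip e f g)) tl)) L

noncomputable def pairI (e f : Ed) : ℕ :=
  ite' (meets e.c f.c)
    (ite' (isPow (Nat.land e.c f.c)) (Nat.lor (dif e.M f.N) (dif f.M e.N)) (Nat.xor e.N f.N))
    (Nat.lor (Nat.land e.M f.N) (Nat.land f.M e.N))

noncomputable def pairT (e f : Ed) : ℕ :=
  ite' (meets e.c f.c) (Nat.xor e.N f.N) (Nat.land e.N f.N)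

noncomputable def fbT (e : Ed) (L : List Ed) : ℕ :=
  @List.rec Ed (fun _ => ℕ) 0 (fun f _ ih => Nat.lor ih (pairT e f)) L

noncomputable def fbI (e : Ed) (L : List Ed) : ℕ :=
  Nat.lor (fbP e L) (@List.rec Ed (fun _ => ℕ) 0 (fun f _ ih => Nat.lor ih (pairI e f)) L)

/-- number of bits of a number below `2 ^ 168` -/
noncomputable def pc (A : ℕ) : ℕ :=
  Nat.mod (@Nat.rec (fun _ => ℕ) 0 (fun j ih => Nat.add ih (Nat.land (Nat.shiftRight A j)
    0x010101010101010101010101010101010101010101)) 8) 255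

/-- fewer than `k` bits -/
noncomputable def popLt (k A : ℕ) : Bool := Nat.ble (Nat.succ (pc A)) k

noncomputable def spLeaf (A v f g : ℕ) : Bool :=
  frc (Sm v) fun s =>
  ite' (Nat.beq (dif (dif A s) (Nat.lor (Nat.pow 2 f) (Nat.pow 2 g))) 0)
    (mkEd f fun f => mkEd g fun g =>
      ite' (isPow (Nat.land f.c g.c)) (Nat.beq (dif (dif (Nat.land A s) f.N) g.N) 0) false) false

noncomputable def rm (A e : ℕ) : ℕ := dif A (Nat.pow 2 e)

noncomputable def run (n K : ℕ) (fb : Ed → List Ed → ℕ) (fuel : ℕ) : List Ed → ℕ → ℕ → ℕ :=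
  @Nat.rec (fun _ => List Ed → ℕ → ℕ → ℕ) (fun _ _ _ => 0)
    (fun _ ih L A h =>
      frc (Nat.mod h 256) fun t => frc (Nat.div h 256) fun h' =>
      ite' (Nat.ble t 199)
        (mkEd t fun E =>
          frc (dif A (fb E L)) fun A' =>
          frc (ih (E :: L) A' h') fun h'' =>
          ite' (Nat.beq h'' 0) 0 (frc (rm A t) fun A'' => ih L A'' h''))
        (ite' (Nat.beq t 200) (ite' (popLt K A) h' 0)
          (ite' (Nat.ble t 220)
            (ite' (Nat.ble n (Nat.sub t 201)) 0
              (ite' (popLt 2 (dif A (Sm (Nat.sub t 201)))) h' 0))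
            (ite' (Nat.ble n (Nat.sub t 221)) 0
              (ite' (spLeaf A (Nat.sub t 221) (Nat.mod h' 256) (Nat.mod (Nat.div h' 256) 256))
                (Nat.div h' 65536) 0))))) fuel

/-- close a mask of codes under the transposition `(x y)`, `x < y` -/
noncomputable def swM (x y M : ℕ) : ℕ :=
  frc (Sw x) fun sx => frc (Sw y) fun sy =>
  Nat.lor M (Nat.lor
    (Nat.shiftLeft (dif (Nat.land M sx) sy) (Nat.sub (Nat.pow 2 y) (Nat.pow 2 x)))
    (Nat.shiftRight (dif (Nat.land M sy) sx) (Nat.sub (Nat.pow 2 y) (Nat.pow 2 x))))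

noncomputable def sweep (gens : List (ℕ × ℕ)) : ℕ → ℕ :=
  @List.rec (ℕ × ℕ) (fun _ => ℕ → ℕ) (fun M => M)
    (fun g _ ih M => frc (swM g.1 g.2 M) ih) gens

noncomputable def orbit (gens : List (ℕ × ℕ)) (r M : ℕ) : ℕ :=
  @Nat.rec (fun _ => ℕ → ℕ) (fun M => M) (fun _ ih M => frc (sweep gens M) ih) r M

/-- remove all triples whose code is in `O` -/
noncomputable def rmO (O : ℕ) : ℕ → ℕ :=
  @Nat.rec (fun _ => ℕ → ℕ) (fun A => A)
    (fun t ih A => frc (ite' (tb O (tcode t)) (rm A t) A) ih) 165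

noncomputable def steps (n K : ℕ) (fb : Ed → List Ed → ℕ) (gens : List (ℕ × ℕ)) (L : List Ed)
    (S : List (ℕ × ℕ)) : ℕ → Bool :=
  @List.rec (ℕ × ℕ) (fun _ => ℕ → Bool) (fun A => popLt K A)
    (fun s _ ih A => mkEd s.1 fun E =>
      frc (dif A (fb E L)) fun A' =>
      ite' (Nat.beq (run n K fb 200 (E :: L) A' s.2) 1)
        (frc (orbit gens 10 (Nat.pow 2 E.c)) fun O => frc (rmO O A) ih) false) S

/-- add the root edges one after the other -/
noncomputable def root (n K : ℕ) (fb : Ed → List Ed → ℕ) (gens : List (ℕ × ℕ)) (S : List (ℕ × ℕ))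
    (R : List ℕ) : List Ed → ℕ → Bool :=
  @List.rec ℕ (fun _ => List Ed → ℕ → Bool) (fun L A => steps n K fb gens L S A)
    (fun e _ ih L A => mkEd e fun E => frc (dif A (fb E L)) fun A' => ih (E :: L) A') R

noncomputable def cert91 : List (ℕ × ℕ) := [
  (83, 0x1c8c808c809c80cc8c80c0ec8c80cc80e0fc801c8c80f07c8c80ec80102c8c80ec80fc80204c8c80ec80fc801c80405c8c82fc844c802c805c8070ac8c82ec843c801c804c807c80a0bc8c809c80ac80bc8c80b0cc804c807c8c804050dc8c80bc80cc80ec8c80e0fc801c807c8c80102c8c844c8070d10c8c80ec80fc810c801c802c807c8c80105c8c801c8070bc8c844c805c8070d11c8c80ec80fc810c8c80f11c801c807c8c80102c8c843c80204c8c844c802c8070ac8c83dc843c804c8070d12),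
  (53, 0x11a00e01b00e0c81a1bc8c8c81b261c00e0c81b3bc81a1ccc30cc45c8c8c81c3bc8301f00e045c81a1fc8c8c81f26c81c2000e0c81cc81f3bc81ac8c81ac826c83b1b201e00e0c81fc820c81bc8c81f1cc81a1ecc50c8c830c820c81ac8c820c83bc80d1cc8c83bc802c83d1f2a00e050c81e2ac8c8c8172ac81c2b00e0c81cc82a3bc81ac8c83cc83d1fc8c81ac81fc83bc80d1bc8c830c83bc801c83c20c81e2b2e00e0c81fc8c80f2ac8c83d1bc8c82a1ec8c809c802c83d1cc8c81ec81cc82ac83bc80720c8c850c81cc81fc81ec83bc8172bc81a2ec8c820c82bc8c82bc807c8172e2f00e0c820c82bc82e3bc8c817c83c1bc8c81bc82b1ec8c81ec81bc82bc83bc8071fc8c82ec82cc83bc801c83c1cc8c830c850c81bc820c81ec83bc8172ac81a2fc8c82cc830382900e0c82ac82bc81bc8c82a1cc8c82bc81c2ec8c81cc82ac81b2fc81ac838c81fc820c81e292d00e0c82ec82fc81fc8c82e20c8c82fc8202ac8c820c82ec81f2bc81ec838c8c838c81e29c81bc81cc81a2dc8c82cc830c8c81ac81c2dc8c82cc83c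c81a2fc83839c8c81dc821c8c8212cc8c821c82c30c838c8393a),
  (51, 0x1ca1713de171913dec817191a13dec817c8191ac8c8c8192a2013dec8193fc8c83f17c81a20c8c825c820c81ac8c811c8431926ca2613de264ec8c8c80a19c8c820c8192e1c13dec820c81943c8c82e26c8c826c843c82e17c81a1c1e13dec817c819c81cc8c81c26c820c81a1e2813dec819c8c80c26c8c84317c8c826c843c80a1cc8c817c826c83fc80420c81ac81e28c8c8c81f28c81c2b13dec81cc82843c8c80a17c8c817c843c80a19c81ac8c8c81943c817c81ac801c83c20c8c820c81ac817c81cc843c81f26c81e2bc8c8c82b3cc820c8c820c804c81b282f13dec82bc820c8283fc8c8c82b43c804c83f19c8c8c80a28c8c819c82843c801c83c1cc8c81bc83cc843c80417c8c828c82b1ec8c819c81cc81ec817c820c83fc81b26c81a2fc8c825c83ac848c838c84e15c8c823c825c83ac848c838c84e242913dec826c817c828c8c8172fc81cc82bc81ac815c8c81a24c8c84319c8c82420c81e29c8c824c825c848c83ac8c824c83ac81a2fc838c8c8484ec8c81fc820c838c81ac81e29342d13dec826c817c828c8c8172bc820c82fc81ec815c8c81e24c8c815c81e29c8c838c829c8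1e34c8c83cc829c83f19c8c83cc83f1cc81a2dc8c816c823c825c8c81ec82d3fc8c82dc81ac82943c834c8c83438c8c834c8383ac8c838c83ac83448c8c838c83ac834c8484e39c8c839c83ac848c8c81ac81e3fc8c848c81ec81a43c824c8c82438c8c848c8244e49c8c839c83ac84ec8c829c82d3fc8c84ec82dc82943c815c8c81538c8c84ec81548c8c848c84ec838494fc8c823c825c8c823c81a28c8c82bc843c81929c815c824c83441c8c823c825c8c823c81e28c8c82fc83fc8192dc815c824c834c84145),
  (26, 0x1c8c8c8c81f262bc8c8c8202bc8c82ac80a1c3bc8c8c81926c8c80dc8172bc8c82ac826c8203b3fc8c8c80b18c8c83fc80a19c8c83fc826c80120c8c817c82bc826c81f3b40c8c8c8c808203bc8c8c81720c8c826c8203b3fc8c8c8171fc8c826c80120c8c817c826c81f3b4010c8c8c8c804203bc8c8c81720c8c826c8203b3fc8c8c8171fc8c826c80120c8c817c826c81f3b40c8c8c8c8203b3fc8c8c8171fc8c826c81f3b40101dc8c8c8c8172b3fc8c8c80a17c8c83bc80a2640c8c8c8c8263b401d29c8c8c8c81b2b3bc8c8c81c26c8c80dc8172b3fc8c8c80d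3bc8c83bc80a17c8c801c83bc80a2640c8c8c8c8263b3fc8c8c80126c8c817c8263b401d3ec8c8c8c8c8262b3b3ec8c8c81726c8c817c8263b3fc8c8c80117c8c817c80126c8c80dc817c8263b40c8c8c8264018c8c8c80d2ac8c80dc8263f192cc8c8c8c8262b3bc8c8c8c8c80d1b2b2cc8c8c8262ac8c801c8262b3b3ec8c8c80d17c8c80dc81726c8c80dc817c8263b3fc8c8c80d3fc8c80dc80117c8c80dc817c80126c8c801c80dc817c8263b40c8c8c80d2bc8c80dc8264018c8c8c8113bc8c83bc80d2ac8c817c80dc8263f1941c8c8c8c8203b3fc81dc82cc841c8c80b29c8c80ac80b3e0ec8c8c8c81f3b40c81dc80ec829c8c80e2cc8c82cc80e3ec8c829c83ec80e410fc8c8c8c8203b3fc80ec810c829c8c8102cc8c82cc80e3ec8c80ec818c8194114c8c8c8c81f3b40c80fc810c829c8c8102cc8c82cc80f3ec8c80fc818c81941c8c82cc83ec8411415c8c8c8c80d3f40c80ec80fc829c8c80f3ec8c83e14c8c83ec814150cc8c8c8c8012040c8c8c83f4017c80ec80fc814c8c81415c8c814c8152cc8c80fc814c8154116c8c82bc81f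c80ec8c82b18c8c80ec8181dc8c814c80ec81841c8c84115c8c8150cc8c8151623c8c82ac820c80fc8c82a19c8c80fc8191dc8c815c80fc81941c8c84114c8c8140cc8c81dc80c23c8c814c8231624c8c82bc823c8c82341c8c84110c8c841c81014c8c82bc810c8142cc8c80ec823c80ac8c82c143ec8c83e0fc8c82cc80f16c8c83ec80f0cc8c80fc80cc8162427c8c82ac824c8c82441c8c84110c8c841c81015c8c82ac810c8152cc8c80fc824c80bc8c82c153ec8c83e0ec8c82cc80e16c8c810c824c81627c8c83ec80ec8270cc8c80ec815c80cc8162328c8c80ec810c8c81027c8c80ec8273ec8c810c83e1dc8c8c8c82a3b3fc80ec81d29c8c80ec827c8182cc8c81dc81fc82cc8c80b1840c8c829c8400cc8c818c82cc80c15c8c840c82cc81516c8c81dc827c80cc8162438c8c80fc810c8c81028c8c80fc8283ec8c810c83e1dc8c8c8c82b3b40c80fc81d29c8c80fc828c8192cc8c81dc820c82cc8c80a193fc8c829c83f0cc8c819c82cc80c14c8c83fc82cc81416c8c81dc828c80cc81623c8c840c81dc82cc80cc8163839c8c8c8c8263b3fc819c8c8191dc8c81d09c8c81dc80910c8c814c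838c8102cc8c8c8c82a3b3fc814c810c8c8102341c8c82cc8c82c41c809c8c8090a29c8c818c838c80ac8c83b1fc8c83fc80a1940c8c82cc841c84016c8c809c840c8290cc8c80ac829c816c80c0fc8c823c80fc80cc81639c8c810c823c816c839c80c283cc8c8c8c8263b40c818c8c8181dc8c81d08c8c81dc80810c8c815c839c8102cc8c8c8c82b3b40c815c810c8c8102441c8c82cc8c82c41c808c8c8080b29c8c819c839c80bc8c83b20c8c840c80b183fc8c82cc841c83f16c8c808c83fc8290cc8c80bc829c816c80c0ec8c829c810c839c816c80c3cc8c80ec815c824c80cc81638c8c83fc810c816c824c838c80c273dc8c81cc811c812c81dc8c81d1fc8c839c81d20c8c838c81d18c8c81dc824c83919c8c83916c8c824c81627c8c823c816c82728c8c829c839c816c8283cc8c829c838c816c83cc8273d1ec8c812c81bc81cc810c8c8101fc8c83dc81020c8c83cc8100ac8c810c828c83d0bc8c828c83cc83d1ec8c828c84123c8c827c841c82324c8c80bc82cc83dc82438c8c80ac82cc83cc838c82339c8c83dc823c824c838c8390c21c8c826c820c82bc812c83ec82cc80fc828c8c82c21c8c8383dc8c83dc821242ec8c826c81fc82ac811c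83ec82cc80ec827c8c82c21c8c83ec82c2ec8c840c8393cc8c839c83cc821232fc8c80bc83bc820c812c840c80fc821c828c8c80fc82141c8c841c80f29c8c840c841c8293dc8c828c82139c8c840c8392f43c8c80ac83bc81fc811c83fc829c80ec8c80e41c8c8413cc8c83cc84121c8c83fc829c84143c8c841c843c82427c8c83fc8242ec8c821c824c82ec8153844c8c811c812c82ac8c8112bc8c82b1fc8c82bc83920c82cc83cc8c82c21c8c82cc83c3d2d1303ddc811c812c81fc8c81120c8c81fc8203fc8c811c820c81f40c821c827c8c827c82141c8c841c8272842),
  (20, 0x1c8c8c8c820262ac8c8c80720c8c81fc81c262ec8c8c81c2ac8c805c8202ec8c82ac81cc8051f3bc8c8c80b2ac8c8c81b3bc8052ec8c826c83bc80b1cc8c826c83bc81cc805203cc8c8c80b19c8c819c80b26c8c819c802c81720c8c820c82ec826c80d1cc8c802c817c82ac826c8203b3fc8c8c80205c8c83bc80517c8c817c807c80519c8c807c83bc819c80526c8c83bc807c819c802c8171cc8c805c82ac83fc81cc826c8072043c8c8c8c8052e3bc8c8c8052ec8c82ac8050b3cc8c8c8020bc8c83bc80b17c8c81fc83bc80b2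63fc8c8c8023bc8c807c80205c8c807c83bc80517c8c817c807c83bc805264323c8c8c8c805172ec8c8c8051fc8c826c8052e3bc8c8c8051fc8c8c8263bc8052ec8c81bc82ac8050b3cc8c8c8023bc8c80dc8020bc8c80dc83bc80b17c8c802c81fc83bc80b263fc8c8c80207c8c807c8023bc8c80bc807c80205c8c802c807c83bc80517c8c802c817c807c83bc805264338c8c8c8c805203cc8c8c80b19c8c802c817203fc8c8c80517c8c817c80519c8c819c802c8171c43c8c8c8c805174323c8c8c8c80b173fc8c8c80205c8c802c80517433816c8c8c8c805203cc8c8c80b19c8c819c802203fc8c8c80205c8c802c80519c8c805c819c8021c43c8c8c80b1bc8c820c80543c8c81cc820c8051f26c8c8c8c8020543c8c8c805432623c8c8c8c8020b3fc8c8c8020bc8c80bc8020543c8c8c8051fc8c802c80543263825c8c8c8c8021c2ec8c8c80b1cc8c81cc805203cc8c8c8020bc8c802c80b19c8c80bc819c802203fc8c8c8020bc8c80bc80205c8c820c802c80519c8c820c805c819c8021c43c8c8c80b1bc8c820c8052ec8c81cc820c8051f3bc8c8c8c8020b3fc8c8c8020bc8c80bc8020543c8c8c8052e3b23c8c8c8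c8050b3cc8c8c80205c8c805c8020b3f1302de130bdec8020b1305dec80bc8020543c8c8c8051fc8c802c8052e3b383ac8c8c8c8262e3bc8c8c8c8c8021b2e38c8c8c8262ac8c807c8262e3b3cc8c8c80d17c8c80dc81726c8c802c817c8263b3fc8c8c80207c8c802c80717c8c802c817c80726c8c807c802c817c8263b43c8c8c8172ec8c817c8264305c8c8c81b3bc8c83bc8172ac8c802c817c8263f0bc8c8c8262ec818c8c802c817c83b431cc8c8c80743c818c8c802c817c8262ac8c80dc802c817c83b3f20c81910c8c8c80510c8c8101cc8c8c81c2ec81019c816c83a2cc8c8c80b10c8c81020c8c8c8202ac81019c816c83ac82c30c8c8c80510c82cc8c843c8101cc8c8c8263fc8c81c43c81019c816c825c83041c8c8c80b10c830c8c83fc81020c8c8c82643c8c8203fc81019c816c825c8c82541c82c45c8c838c816c825c83ac82cc830c841c8c82c4515c8c823c838c816c825c83ac841c84524c8c824c838c816c825c8c8383ac8c843c819c83c10c82cc83039),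
  (23, 0x1c8c8c81218c81dc8c810c81dc81119c8c826c83bc8070cc8c8c8123bc81d21c8c81dc821c8c83bc81c20c8c81cc82005c8c81bc820c81c0bc81227c8c81dc821c8c81dc821c81227c8c818c82710c8c81bc820c81f04c8c804c81fc81bc81c0ac81128c8c81dc821c8c826c83bc81c20c8c820c821c8c81b0ac81128c8c821c819c82810c8c81dc81cc81fc82005c8c821c805c820c81bc81c0bc8123cc8c8c81220c8c81f05c8c83bc81206c8c821c812c81b0bc8c807c826c83bc8120cc8c821c818c827c83c10c8c83b11c8c8c8123cc81dc81bc81fc82004c8c8c8123cc821c804c81fc81bc81c0a3dc8c8c81011c821c8c810c821c8111bc8c81bc81cc81106c8c810c805c81cc806c811122cc8c8c81011c81dc8c810c81dc8111fc8c81fc820c8110cc82cc8c810c81fc80bc820c80cc8111230c8c8c81011c8c8111cc8c81104c8c8c81c3cc81005c8c810c821c8c810c804c81c3bc8111bc8c8c80510c81bc81cc81106c8c804c810c81bc805c81cc806c81112411000e01100e0c81011c8c81120c8c8110ac8c8c8203cc8100bc8c810c81dc8c810c80ac8203bc8111f1200e0c80ac810c81fc80bc820c81112c8c8c80b10c81f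c820c811c8120c45c8c806c80bc812c818c8c8181cc8c812c81820c8c812c82030c8c81bc8123cc80cc811c80ac81f2bc8c806c80bc81cc8c80e20c8c82012c8c820c81218c8c80bc812c81826c8c812c82045c8c81bc81227c80cc8c84511c80ac81f40c8c8c81112c82cc841c8c818c80ec83cc8112bc8c801c818c80ec811c82740c8c8c81c3cc811c82bc8400ac8c8c80527c8c812c8053cc811c82bc8401fc8c82cc84130c8c840c82cc8414516c8c845c81fc830c82cc816c8c816c81fc84019c8c80ac804c8403bc8c820c816c8403dc8c81605c8c804c82cc83bc83dc84011c8c807c83bc816c8400cc8c84006c8c82cc84012c8c81f1cc82b2ec8c83dc830c821c845c8c82b12c83bc8c81241c8c816c82b09c8c811c816c841c82b02c8c80cc81bc841c82b07c8c81fc811c816c841c82b19c8c80ac804c811c80cc806c812c82b26c8c820c811c816c82b28c8c816c82e05c8c82ec81f1cc84043c8c806c80ac811c819c8c8191bc8c811c8191fc8c811c81f30c8c80fc83016c8c81cc811c8163dc8c819c83d2ec8c8300cc8c830c82e12c8c80cc816c82e2bc8c819c82b43c8c82ec84340c80bc8202ac8c806c80ac81bc8c80f1fc8c81f11c8c81f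c81119c8c80ac811c81926c8c81fc80f16c8c811c81fc81645c8c83bc84543c8c826c8450cc8c826c843c84512c8c80dc83bc845c84340c8c81cc811c816c84328c8c82a0bc8c812c819c8402ec8c80dc843c82e2bc8c81b203fc8c845c820c830c82cc816c8c816c820c83f18c8c80bc805c83f3bc8c81fc816c83f3cc8c81604c8c805c82cc83bc83cc83f12c8c807c83bc816c83f0cc8c83f06c8c82cc83f11c8c826c818c811c83cc83f2bc8c806c816c82bc83f2ec8c818c82ec83f40c8c826c8402ac8c83fc82ac840c80743c8c8201b2fc8c83cc830c821c845c8c82a11c83bc8c81141c8c816c82a08c8c812c816c841c82a01c8c80cc81cc841c82a07c8c820c812c816c841c82a18c8c80bc805c812c80cc806c811c82a26c8c841c818c83bc811c82a40c8c807c83bc841c840c82a43c8c811c818c82ac8432bc8c81fc812c816c840c82a27c8c816c82f04c8c82ac840c82bc8072ec8c841c845c826c83b3fc8c82fc8201b44),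
  (16, 0x1c8c8c8c8022a2ec8c8c8012bc8c81cc8072e2fc8c8c8021fc8c801c80d2bc8c81cc807c8022e3fc8c8c80120c8c802c80d2ac8c81bc807c8012fc8c8c8072fc801c8c82f02c80d3f40c8c8c8021bc8c801c80720c8c820c80dc8022ac8c8c80d2bc8c82a02c8c84001c8072fc8c8c80120c8c82ac8012fc8c82b07c8c82fc8400dc8023f43c8c8c8011cc8c802c8071fc8c81fc80dc8012bc8c8c80d2ac8c82b01c8c83f02c8072ec8c8c8021fc8c82bc8022ec8c82a07c8c82ec83f0dc80140c8c8c81c40c8c83fc80d2ac8c82ec840c80d2bc8c82ac84001c8c81cc82bc83f02c8074344c818c8c8181dc8c81dc81819c8c818c819c81d21c8c818c81dc821c81927c8c819c81dc821c818c82728c8c81dc827c828c818c819c8212cc8c821c827c828c818c819c81dc82c30c8c840c844c81dc821c82cc8c82c30c819c8c844283cc8c83fc843c81dc821c82cc8c82c30c818c8c84327c8c843c8443c3dc8c843c844c83cc83dc818c8c81819c8c83dc81927c8c83cc818c82728c8c843c84421c8c82bc843c8443041c8c83fc840c83cc83dc818c8c81819c8c83dc81927c8c83cc818c82728c8c83f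c8401dc8c82fc83fc8402cc8c83fc840c843c8444145),
  (7, 0x1c8c8c8c80d2b3cc8c8c80d1bc8c828c80d2a3dc8c8c82a3dc8c8c82a3dc80d1cc8c8c8273cc8c828c82a3dc80d2b3fc8c8c82b3cc8c8c82b3cc80d1bc8c8c82b3cc8c81bc8283dc80d2ac8c8c8272bc8c827c82b3cc8c81bc828c82a3dc80d3f40c8c8c8c8c80d2a2b2cc8c8c80d1cc8c827c80d2b3cc8c8c80411c8c819c80d1bc8c81bc828c80d2a3dc8c8c8282ac8c81bc82a3dc8c8c8282ac8c828c82a3dc80d1cc8c8c8282ac8c81cc8273cc8c81bc828c82a3dc80d2b3fc8c8c8272bc8c81cc82b3cc8c8c8272bc8c827c82b3cc80d1bc8c8c8272bc8c827c82b3cc8c81bc8c827c82b3cc8283dc80d2ac8c8c8282ac8c8c8282ac8272bc8c81cc827c82b3cc8c819c81bc828c8c8282a3dc80d3f4041c8c8c8272ac8c81bc82a3cc8c818c827c83c3f0bc8c805c828c83dc82bc8401fc8c8c81c28c8c819c8282bc8c82ac81cc82b3dc8c827c819c828c83d40c81f0ac8c8c8c80d2a2bc8c8c80b1cc8c80dc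80b2b3cc8c8c80b2ac8c80dc80a1cc8c8c80b3cc80dc80a2b3dc8c8c80b19c8c80dc80b28c8c80ac80bc80d1cc8c8c82a3dc80bc8c83d0ac80d2b3fc8c8c80a18c8c80dc80a27c8c80ac80bc80d1bc8c8c8283dc80ac8c83c0bc80d2ac8c8c82b3cc8c828c82a3dc8c83d0ac8c828c83c0bc80d3f40c81f0cc8c81dc82cc84121c8c821c81dc82cc84130c8c83fc81dc82cc841c8c82cc841c81f4045c8c81dc821c801c830c845c827c8c8403cc804c82ac8c8453fc81f20c8c81fc82cc830c802c821c8c82c45c8c83f3dc8c81b19c8c81905c8c84540c8c8211cc8202ec8c820c82cc830c801c821c8c82c45c8c8403cc8c81c18c8c81804c8c8453fc8c8211bc82ec81f2fc8c83dc840c845c821c830c8c84002c8c821c83041c8c84019c8c81fc82a28c8c819c82805c8c8211cc8c81fc8302bc820c82f43c8c83cc83fc845c821c830c8c83f01c8c821c83041c8c83f18c8c820c82b27c8c818c82704c8c8211bc8c820c8302ac843c81fc82e44),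
  (29, 0x1c8c8c8c8c801202b3ac8c8c80520c8c81fc8202b3cc8c8c80420c8c81fc8202ac8c8c80120c8c827c8203cc81f2b3dc8c8c80220c8c8c8051fc82027c8c83dc81fc82028c8c8c8051fc8c83dc81f28c8c81cc827c81f2bc8203c3fc8c8c80120c8c805c82b3cc8c83cc81fc82027c8c8c80420c8c83cc82027c8c81bc82ac8203fc81f28c8c8c80420c8c81bc8043fc8c82bc83cc82027c8c81bc828c83fc8202ac81f3d40c8c8c8c8282a3dc8c8c8282ac8c828c82a3d3fc8c8c81c27c8c8c8181cc8272bc8c81cc827c82b3c402cc8c8c8c8282a3dc8c8c8282ac8c828c82a3d3fc8c8c81c27c8c8c8181cc8272bc8c81cc827c82b3c40c8c8c8c8282a3dc8c8c8282ac8c828c82a3d3fc8c8c8181cc8c8c8181cc8272bc8c81cc827c82b3c402c41c8c84121c8c84130c8c82cc83045),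
  (1, 0x1c8c8c8c8050b3cc8c8c80b2ac8c82ac8051f3dc8c8c8020bc8c83dc80b19c8c81fc83dc80b283fc8c8c8c8282a3dc8c8c80f28c8c819c8283d3fc805c8c8c8283f0b12c8c8c8c8283d3fc80bc8c80b12c8c81805c80a1cc8c8c80205c8c8c80b28c8021bc8c8c80b0fc8c80fc80b28c8023fc8c80fc809c828c8053dc8c828c802c809c83fc80519c81c2ec8c8c81c3dc8c80b12c8c80fc83d02c8c8c80b12c83dc80209c8c80bc812c809c80205c8c80fc802c809c83dc80519c8c80fc802c819c809c83dc8052843c8c8c8c8283d43c805c8c80512c804c82ac8c83d3fc8c818c8040bc81c20c8c8c8c8193d3fc80bc8c80b12c8c82705c8c80ec83c1cc8c81c0ac81fc8c83dc81c43c8202bc8c8c8c8193d43c805c8c80512c8c8270bc8c808c83c20c8c82004c81bc8c83dc8203fc8c8202bc81c2fc8c8c8c82a3d3fc80ec8c80e43c8c84318c8c812c81c27c8c8c8c8192a43c80bc8053cc8c81cc82b0ac8c82b1fc8c828c81c2ec820c8c8182f40c8c8c8c82e3d43c808c8c8083fc8c83f18c8c812c82027c8c8c8c80f3f43c805c80b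3cc8c820c82f04c8c827c83c40c8c82f1bc8c828c8202ac8c8271cc8c83fc8182b44),
  (24, 0x1c8c8c80b1bc8c8c8043dc8051fc8c8c8203cc8c828c8203dc80b2ac8c8c8192ac8c83cc8191cc8c82ac828c81c3dc8052ec8c8c82027c8c81cc8203cc8c8c81c3dc805c8192ec8c819c81fc83dc82028c80b3fc8c8c80919c8c819c80b20c8c80bc809c8193dc8c83dc827c83cc8191cc8c83fc819c809c83dc81c28c80543c8c80ec827c8c8273cc81fc843c80ac80b2bc8c808c827c8c8273cc81bc83fc804c82bc8052fc8c80ec843c827c8c8273cc8c82b1fc82ec80ac80bc82f40c8c808c83fc827c8c8273cc8c82f1bc82ac804c840c805c82b44),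
  (4, 0x1c8c8c80b2ac8c81bc82a2fc8c8c80f20c8c820c82a2fc80b3fc8c820c8c8202fc80bc8c80b3f44)]

noncomputable def cert92 : List (ℕ × ℕ) := [
  (79, 0x1c8c821),
  (38, 0x1c8c839),
  (1, 0x1c8c80f),
  (36, 0x1c8),
  (15, 0x1c8),
  (33, 0x1c8),
  (43, 0x1c8),
  (48, 0x1c8),
  (7, 0x1c8),
  (13, 0x1c8)]

noncomputable def cert9T : List (ℕ × ℕ) := [
  (19, 0x1c8c816c815c814c84fc84ec84dc849c848c847c834c833c832c853),
  (7, 0x1c9c83fc83dc83cc809c808c806c803c82bc8c83c2ac8c83cc82a28c8c83fc83dc82b27c91ec8c82ac828c81e1cc8c803c83cc827c81e1bc8c806c83cc827c81bc81e19c8c83dc832c82ac828c81cc81e18c8c819c80dc80ac842c82dc81e12c8c83cc82bc82dc827c81cc81ec81811c8c83cc82bc82dc827c81cc81ec818c8110fc8c83fc83dc82dc82ac828c81ec81bc819c8120e)]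

noncomputable def cert101 : List (ℕ × ℕ) := [
  (83, 0x1c8c856c801c802c804c805c80ac8c80a0bc8c805c80b11c8c802c804c80a12c8c805c80bc811c81258c8c804c80ac811c812c85859c8c859c80ac80bc811c81207c8c859c804c805c807c811c8120dc8c83bc801c802c807c80dc858c85910c8c840c802c805c80bc859c80d5bc8c83fc801c804c80ac858c85bc80d5cc8c82fc844c802c80bc859c85cc8c85805c8c80b075fc8c81fc82ec843c801c819c828c8c8013dc8c843c81058c8c80ac85f0760c8c859c80dc810c811c812c85bc8c80d5cc85fc8605dc8c859c807c810c811c812c85fc8c80760c85bc85cc8c8605d61c8c819c827c828c83cc83dc810c817c826c83b57c8c82bc83fc840c810c80dc857c817c826c83bc8615ac8c802c805c80bc856c857c85ac8c81059c85cc86054c8c810c81fc82ec843c820c82fc844c817c826c8c8443bc85dc85a5ec8c801c804c80ac856c857c85ac8c85a5ec8c83bc81058c85bc8c8445fc85455c8c828c82ac82bc82ec8c82a2f6fc8c83dc83fc840c843c8c83f44c86f76c8c83dc83fc840c843c8c83f44c86fc87677),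
  (53, 0x11a00e01b00e0c81a1bcc30cc45cc611f00e0c81bc81a1f1e00e0c81fc81bc81a1ecc6cc8c86c38cc502a00e0c81bc81fc81ac838c81e2a2900e0c82ac81bc81ac838c81fc81e292d00e0c81fc82ac838c81ec829c81ac81b2d2e00e0c81fc82ac82dc81bc81ec838c8c81ec81f29c81a2ec8c8c81b3b1c00e0c81b57c81fc81ac8c83bc8572ac81ec8c81f29c8c83dc8592ec82d1cc8c8c81f3b2000e0c81f57c81cc81ec8c83bc8571bc8c83bc857c8072ec8c8592ac8c82ac82e1ac8c81ac81bc81c2dc82920c8c8c82a3b2b00e0c82a57c81cc81fc820c8c83bc857c80d1bc8c81fc83bc857c8172ec8c81fc82e1ac8c81bc81cc81a2dc8c81ac81bc82ec82dc82029c81e2bc8c8c82e3b2f00e0c82e57c820c8c80e2bc81bc8c8581cc8c82bc83bc857c8071fc8c81bc820c83bc857c8172ac8c81bc82ac82b1ec8c82ec81fc82ac81ec81c2dc8c82dc81bc81fc820c81e29c81a2fc8c85dc866c861c86cc8c86cc81a2fc83839c8c830c85dc861c866c8c8666cc838c8393ac8c830c841c84ac845c850c8c850c859c81a2ec839c83a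54c8c830c841c84ac845c850c8c850c858c81a2fc854c838c83a55c8c82cc830c841c845c84ac8c84a50c854c855c838c83956cc73c871c872),
  (51, 0x1ca1713de171913dec817191a13dec817c8191aca4eca6a2613dec817c819c81a26c8c8c819431c13dec8195fc817c826c81a1c1e13dec817c819c81cc826c81a1ec8c8c8192ac8c81cc8193f2013dec81cc8195bc8c85b17c826c81ac81e202813dec819c826c8c80a1cc817c8c83fc85bc80420c81ac81e28c8c8c828432b13dec8285fc81cc8c85f19c817c8c801c83cc85820c8c81cc843c85fc81f26c81ac81e2bc8c8c81b28c8c82bc8283f2f13dec82bc8285bc8c82a20c8c83fc85b19c8c801c83cc8581cc8c85fc80417c8c817c820c83fc85bc81b26c81ec81a2fca71c8c838c84ec854c86ac87115c8c826c838c84ec854c86ac87124c8c864c826c838c84ec854c86ac87134c8c856c864c834c838c84ec854c86ac87139c8c856c864c834c838c848c854c86ac84ec87155c8c856c838c854c824c84ec855c86ac8c855c81ec81a2fc87149c8c856c864c858c85bc838c854c84ec8c84ec854c81a5fc8c82fc824c8396ac8c8397165c8c86ac864c815c838c855c865c8c86571c8c834c84954c8c855264f2913dec826c817c828c82fc81a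c81cc82bc815c824c839c855c819c820c8c8204fc8c819c81fc820c81a34c81e292d13dec826c817c828c82bc81ec820c82fc829c815c824c834c8c83f39c8c858c85b55c8c83f4fc8c808c83fc85b19c8c858c85b1cc81a2dc8c827c82ac82ec854c858c85bc8c8545fc8c85bc85f71c8c849c834c86538c8c839c85426c8c858c820c85f29c8c819c858c81cc85b2d6bc8c814c823c815c824c834c838c8c83454c8c824c83471c8c854c87139c8c85bc85fc8715572c8c856c864c854c86ac8c82bc81929c815c824c834c855c865c86b41c8c856c864c854c86ac8c82fc8192dc841c815c824c834c855c865c86b45c8c825c83ac848c838c84ec8c81cc82bc81929c815c824c834c839c849c84fc8455dc8c825c83ac848c838c84ec8c820c82fc8192dc85dc815c824c834c839c849c84fc84161),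
  (26, 0x1c8c8c8c8c83b40575ac8c8c8023bc8c826c83b575bc8c8c8013bc8c801c8025bc8c817c826c83b575cc8c8c8c83b4057c8c8c8c8c8263b4041c8c8c83b3fc8c801c83b40575ac8c8c80240c8c826c8023bc8c817c826c83b575bc8c8c8023fc8c826c8013bc8c8c8263bc801c8025bc8c80dc817c826c83b575c5dc8c8c83b5c0ac8c8c8263fc8c826c83b5b0bc8c8c83b5cc80ac80b18c8c8c8263fc8c826c83b5bc80ac80b19c8c819c80ac80b0ec8c80bc80ec818c81914c8c80bc818c819c81415c8c85dc80ec81dc818c81523c8c85dc81dc82cc8c80b40c8c84018c81538c8c85dc81dc819c814c823c83824c8c85dc81dc82cc819c814c838c82339c8c819c824c839c80ac8c8190bc8c80b18c80e0fc8c823c814c818c8c81838c8c82b0ac8c80a19c824c80f27c8c824c815c819c8c81939c8c82a0bc8c80b18c823c827c80e28c8c82cc8c82c41c809c8c80918c8c8180ac8c818c80a40c8c840c80a19c80fc828c8c828393cc8c82cc8c82c41c808c8c80819c8c8190bc8c819c80b3fc8c83fc80b18c83cc80ec8c82427c8c824c827383dc8c815c823c824c838c839c80ec80fc827c828c8c8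283cc8c83cc8273d0cc8c80ec80fc827c828c83cc83dc814c815c823c8c82324c8c83dc82438c8c838c83cc8233916c8c82cc8c82c3ec8c82cc8c82c3e41c8c84105c8c83ec8050ac8c805c80a18c8c80ec8180bc8c80bc8185cc80cc8c80c15c8c827c80c24c8c82cc83cc80c39c8c815c824c8391654c8c82cc8c82c3ec8c82cc8c82c3e41c8c84104c8c83ec8040bc8c804c80b19c8c80fc8190ac8c80bc8195bc80cc8c80c14c8c828c80c23c8c82cc83dc80c38c8c81dc82cc841c80c54c8c814c823c838c8541655c8c82cc8c82c3ec8c82cc8c82c3e41c8c82cc8c82c3ec8c82cc8c82c3e415dc8c841c8c8415d18c8c83ec81809c8c83ec818c8090ac8c814c80a19c8c818c80ac8195cc8c85c16c8c85c0cc8c816c80c0fc8c80fc80cc81655c8c823c855c816c80c28c8c829c838c855c816c80c3d58c8c82cc8c82c3ec8c82cc8c82c3e41c8c82cc8c82c3ec8c82cc8c82c3e415dc8c841c8c8415d19c8c83ec81908c8c83ec819c8080bc8c815c80b18c8c819c80bc8185bc8c85b16c8c818c81658c8c85bc8580cc8c80bc816c80c0ec8c818c80ec80cc81654c8c810c824c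854c816c80c27c8c810c829c839c854c816c80c3c59c8c810c81dc80bc819c8c81805c8c857c80a09c80cc8c80916c8c83bc85712c8c802c80dc817c8262bc8c818c802c80dc817c83b40c8c840c81dc857c826c83b1cc8c818c854c858c802c80dc817c8575cc8c816c827c83cc8580fc8c814c816c823c838c854151fc8c818c81dc8c826c83bc8015cc8c83fc85bc80419c80fc815c80cc8c81516c8c80cc81624c8c815c80cc81628c8c81dc83fc80cc81639c8c808c818c83fc80cc8163dc8c810c804c81dc85bc80cc81655c8c810c81dc808c818c85bc80cc81659c8c80cc816c828c83dc8590ec8c80cc815c816c824c839c8551420c8c811c812c81dc81fc820c818c819c827c828c8c8283cc8c83cc8273dc8c855c828c83d58c8c854c858c827c83c59c8c83cc83dc858c859161ec8c810c81bc81cc81fc820c80ac80bc8c8591ec823c8c82324c8c80bc82438c8c80ac838c82339c8c80bc859c824c83954c8c80ac858c854c823c83855c8c838c839c854c8550c21c8c85ac82cc82bc812c80fc820c821c828c824c83dc8592ec8c85ac82cc82ac811c80ec81fc821c827c82ec83cc858c8c821232fc8c85ac829c841c812c840c80fc820c821c83dc828c859c839c82f43c8c85ac829c841c811c83fc80ec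81fc821c83cc843c827c8c85558c82ec8c855c8153844c8c857c829c83ec812c85dc85cc80fc820c821c859c828c8c85c3dc82fc8c82944c8c854c814555fc8c857c829c83ec811c85dc85bc80ec81fc821c858c8c85d5fc8c85b27c8c829c85b3cc8c85b2ec8c829c83943c8c824c839c8155460c8c812c82ac82bc81fc820c82cc821c83cc83dc8c83d58c8c858c83c592dc8c811c812c83fc840c81fc820c841c821c858c8c85859c8c85927c8c827c85828421303ddc811c812c81fc820c85bc8c81f5cc821c85dc827c8c82728c8c85dc8283cc8c85dc83cc8273d5e),
  (20, 0x1c8c8c8c8072043c8c8c80543c8c81cc8051f57c8c8c8050bc8c857c80b1cc8c857c81cc8052058c8c8c80b26c8c819c80b3bc8c819c802c81720c8c820c826c83bc80d1c5bc8c8c80519c8c819c80526c8c857c819c8053bc8c807c819c802c8171cc8c819c81cc826c83bc807205fc8c8c8c8050b58c8c8c80b26c8c857c80b3b5bc8c8c80517c8c857c80526c8c807c857c8053b5f23c8c8c8c8054357c8c8c80543c8c83fc8050b58c8c8c80b17c8c857c80b26c8c80dc857c80b3b5bc8c8c80257c8c857c80517c8c807c857c80526c8c826c807c857c8053b5f3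8c8c8c8c8052643c8c8c8052ec8c83bc8054357c8c8c8052ec8c8c83b57c80543c8c82ac83fc8050b58c8c8c8020bc8c857c80b17c8c80dc857c80b26c8c826c80dc857c80b3b5bc8c8c8025bc8c807c80257c8c807c857c80517c8c817c807c857c80526c8c817c826c807c857c8053b5f54c8c8c8c8171c5fc823c838c8c8c8c805175f5416c8c8c8c8021c5fc8c8c8051f26c823c8c82638c8c8c8c8050b5fc8c8c8055f265425c8c8c8c802205bc8c8c80519c8c819c8021c5fc8c8c8051f3bc8c83b23c8c8c8c8050b5fc83b38c8c8c8c8020b5bc8c8c8055bc8c802c8050b5fc8c8c8055f3b543ac8c8c8c8052058c8c8c80b19c8c819c802205bc8c8c8050bc8c820c80519c8c820c819c8021c5fc8c8c8c8050b5f23c8c8c8c8020b5bc8c8c8055bc8c802c8050b5f38c8c8c8c8050b58c8c8c80543c8c805c8020b5bc8c8c805581302de1305de055b130bdec802c8050b5f54c8c8c80543c819c81cc8c85b205756c8c8c8c83b4357c8c8c8c8c8263b4354c8c8c83b3fc8c807c83b435758c8c8c80d26c8c826c80d3bc8c817c826c83b575bc8c8c80717c8c817c80726c8c817c826c8073bc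8c802c817c826c83b575fc8c8c83b5f05c8c8c8263fc8c826c83b5b0bc8c8181cc8c8c8575bc81820c81910c8c838c854c816c83ac8562cc8c838c854c816c83ac856c82c30c8c843c854c823c816c856c825c83041c8c83fc854c823c816c856c825c841c82c45c8c841c85fc8c8101cc8c85fc81019c816c825c83ac830c8455dc8c845c85bc8c81020c8c85bc81019c816c825c83ac8c83a5dc82cc8c8254161c8c830c841c845c85dc861c825c83ac85615c8c825c841c845c85dc861c83ac85624c8c816c825c83ac85dc861c82cc830c85639c8c85fc816c825c83ac856c82cc830c841c8c82c4555),
  (16, 0x1c8c8c8c82f3b3fc8c8c8012fc8c81fc82e3b40c8c8c8171cc8c80dc8262bc8c826c81cc82b3b43c8c8c80826c8c80dc8171bc8c802c80dc8262ac8c817c826c81bc82a3b44c8c8c80f2ac8c80bc80f3fc8c817c804c80820c8c807c826c804c8082fc8c801c807c83bc804c8084457c8c8c80f26c8c80bc80f3bc8c802c80dc81720c8c807c802c80dc8262fc8c801c807c802c80dc83b44c8c817c826c83bc820c82fc844575bc8c8c8171fc8c83bc80120c8c802c80dc8262ec8c826c83bc817c8012fc8c807c801c802c80dc83b43c8c8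07c80dc83bc817c826c80144c8c80dc817c826c83bc81fc82ec843575cc8c8c8025bc8c805c80917c8c807c805c80926c8c807c802c80dc8171cc8c826c802c807c805c8093bc8c85cc801c807c802c80dc8262bc8c843c85cc801c807c802c80dc83b40c8c802c807c817c826c83bc81cc82bc840575fc8c8c8075fc8c804c80817c8c802c80dc8171bc8c81bc801c817c8071fc8c817c801c807c804c80826c8c817c826c801c807c804c8083bc8c82fc85bc801c807c802c80dc8262ac8c82fc844c85bc801c807c802c80dc83b3fc8c808c801c807c817c826c83bc81bc82ac83f5760c8c8c8c81c575f18c8c8c8c81f575cc8181dc8c8c8c81b5760c81dc81819c8c8c8c81b5760c818c819c81d21c8c8c8c82b575fc818c81dc821c81927c8c8c8c82a5760c819c81dc821c818c82728c8c8c8c82e575cc81dc827c828c818c819c8212cc8c8c8c82a5760c821c827c828c818c819c81dc82c30c8c8c8c8093b5fc840c8c8c8575b44c81dc821c82cc8c82c30c819c8283cc8c8c8c8083b60c83fc8c8c8575c43c81dc821c82cc8c82c30c818c827c8c8443c3dc8c8c8c80e3b5cc843c8c8c8575b44c83cc83dc818c8c81819c8c83dc81927c8c83cc818c82728c8c8442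1c8c843c8443041c8c8c8c8083b60c83fc8c8c8575f40c83cc83dc818c8c81819c8c83dc81927c8c83cc818c82728c8c8401dc8c83fc8402cc8c840c843c8444145c8c8c8c83b575bc8c8c80926c8c857c8093b5fc81dc821c82cc8c82c30c8c821c83041c8c81dc82cc84145c8c81dc82cc8415cc8c8c8015cc821c830c84560c8c85cc86019c8c82ec85cc86028c8c83fc843c85cc8603d58c8c8c8c83b575cc8c8c80826c8c857c8083b60c81dc821c82cc8c82c30c8c821c83041c8c81dc82cc84145c8c81dc82cc8415bc8c8c8025bc821c830c8455fc8c85bc85f18c8c82fc85bc85f27c8c840c844c85bc85f3cc8c80cc85bc85cc85fc8605859c8c8c8c83b575bc8c8c80e26c8c857c80e3b5cc818c819c827c8c82728c8c819c8283cc8c818c827c83c3dc8c85cc819c828c83d58c8c85bc818c827c83cc85859c8c818c827c83cc858c8595fc8c8c8075fc858c859c819c828c83d60c8c811c812c85fc86021c8c812c82ac82bc85fc86030c8c811c812c83fc840c85fc860455dc8c8c8c83b575fc8c8c80826c8c857c8083b60c818c819c827c8c82728c8c819c8283cc8c818c827c83c3dc8c860c819c828c83d58c8c85fc818c827c83cc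85859c8c818c827c83cc858c8595bc8c8c80d5bc858c859c819c828c83d5cc8c811c812c85bc85c1dc8c812c82ec82fc85bc85c2cc8c811c812c843c844c85bc85c411000e0c811c812c85bc85cc85fc8c85b605d61),
  (23, 0x11100e01200e0c81112c805c80ac8c80ac8111bc8c811c80ac8121cc8c81bc81cc805c8111fc8c811c81bc81cc805c81220c8c81cc811c812c81fc82006c8c820c806c811c812c81bc81c0cc8c841c845c85dc86116c8c805c816c806c81cc820c80cc811c80ac81f2bc8c805c82bc816c806c81cc820c80cc811c80ac81f40c8c805c82bc840c816c806c81cc820c80cc811c80ac81f5cc8c811c820c80ac816c80cc81bc81fc806c812c805c81cc82b2ec8c811c820c80ac82ec816c80cc81bc81fc806c812c805c81cc84043c8c811c820c80ac82ec816c80cc81bc81fc8c816c81fc81bc84043c806c812c805c81cc85c5fc8c81cc816c806c80ac81bc81fc82ec80cc812c82bc843c85fc840c85cc8202ac8c81cc82ac816c806c80ac81bc81fc843c80cc812c840c82ec85fc82bc85cc8203fc8c81cc82ac83fc816c806c80ac81bc81fc85fc80cc812c85cc82ec8c85c43c82bc8c82e40c8205bc8c85bc812c81fc816c805c80cc81c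c820c82bc806c811c82ec840c8c83f5cc843c8c8075fc8c8262ac81b2fc8c8c81140c8c81cc8115cc8c840c85c2ac8c812c82bc85c3fc8c85cc812c82bc8405bc816c8c82bc840c85c0ac8c83bc857c82bc840c85c1fc8c81bc8c806c81c5cc81fc816c80a19c8c83fc85bc82bc840c85cc8070cc8c8c81c40c8c806c81c5cc8c85c2ac80cc816c81bc80ac81f28c8c8c81c2bc8c806c81c40c8c840c806c81c5cc8c85c3fc816c81bc8c82bc840c85c0cc80ac81f3dc8c8c8121cc8c806c81c2bc8c82bc806c81c40c8c82bc840c806c81c5cc816c81bc8c82bc840c85c0cc8c80cc812c82bc8405bc80ac81f59c8c80dc826c807c809c812c82bc805c81c2ec8c80dc826c807c83bc809c812c840c805c81c43c8c83bc859c85dc812c807c809c857c85cc805c81c5fc8c858c807c81dc80fc819c828c83dc859c826c83bc85720c82f04c8c8c80c11c8c818c80720c8c81fc82ec82026c8c8c80c2ec81fc843c8203bc8c8c80c2ec8c82ec80c43c81fc85fc82057c8c819c82004c8c80416c8c811c82ec843c85f06c8c811c816c82ec843c85f12c8c83cc858c816c82ec843c85f05c8c812c816c82ec843c85fc827c83c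c8581cc8c80fc80dc802c828c83dc859c826c83bc8571bc8c80cc816c81cc80ac811c81fc82e2bc8c80ec826c83bc845c80ac811c81fc84340c8c80ec826c83bc857c861c80ac811c81fc85f5cc8c816c81cc806c811c82bc82ec843c85fc840c85cc8042fc83fc85bc82a0bc8c85bc812c81fc80bc816c805c81cc820c8c82ac85b0cc8c816c820c805c81cc82a2fc806c811c8c827c811c82ac85b40c8c82ac85b43c8c843c85b2bc8c85b2ec8c82ac82b5fc8c85bc85fc82ac82ec8275cc8c845c83b3fc804c81b44c8c83fc812c81fc80bc816c805c81cc820c8c82ac83f0cc8c816c820c805c81cc82a2fc8c808c81cc805c826c827c83f44c806c8c83f11c8c827c83cc811c82ac83f5cc8c85cc82ac83f5fc8c83f2ec8c85cc82a43c8c85fc82ec83fc843c83c2bc8c83fc85fc843c82ac82ec82740c8c85dc861c8575bc804c81b60),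
  (7, 0x1c8c8c8c80d4058c8c8c80d2ac8c83dc80d3f59c8c8c80d1cc8c8c83f59c80d2bc8c8c83c58c8c83dc83f59c80d405bc8c8c80d1bc8c8c84058c80d2ac8c8c84058c8c82ac83d59c80d3fc8c8c83c40c8c83cc84058c8c82ac83dc83f59c80d5b5cc8c8c8c8c80d3f4041c8c8c80d2bc8c83cc80d4058c8c8c80d1bc8c828c80d2ac8c82ac83dc80d3f59c8c8c83f59c8c8c83f59c80d1cc8c8c83d3fc8c83dc83f59c80d2bc8c8c83d3fc8c82bc83c58c8c82ac83dc83f59c80d405bc8c8c84058c8c8c84058c80d1bc8c8c83c40c8c83cc84058c80d2ac8c8c83c40c8c83cc84058c8c82ac8c83cc84058c83d59c80d3fc8c8c83d3fc8c8c83d3fc83c40c8c82bc83cc84058c8c828c82ac83dc83f59c80d5b5c5dc8c8c83f58c8c83cc8585b0bc8c859c82bc840c85c1fc8c8c83d40c8c82bc84059c8c828c83dc8595cc81f0ac8c8c8c80b3f58c8c8c80a2bc8c80dc80a4059c8c8c80d1cc8c80bc80d2bc8c80ac80bc80d405bc8c8c80d1bc8c80bc80d2ac8c80ac80bc80d3f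c8c8c83f59c80ac80bc80d5b5cc81f0cc8c85d21c8c841c85d30c8c82cc841c85d45c8c85cc82cc841c85d61c8c830c845c861c827c83cc858c804c82ac83fc85bc81f20c8c802c821c845c861c83dc859c819c805c840c85cc81cc8202ec8c801c821c845c861c83cc858c818c804c83fc85bc81bc82ec81f2fc8c845c802c821c830c861c859c819c828c805c85cc81cc82bc820c82f43c8c845c801c821c830c861c858c818c827c804c85bc81bc82ac843c81fc82e44c8c830c845c861c802c85cc85dc819c828c8c83f3dc805c81cc82bc8c84540c820c82fc8445fc8c830c845c861c801c85bc85dc818c827c8c8403cc804c81bc82ac8c8453fc85fc81fc82ec84360),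
  (29, 0x1c8c8c8c8c81f3d4056c8c8c82040c8c8c81f40c8203f58c8c8c81f2bc8c81fc8203fc8c8c8203fc8c83cc82058c81f4059c8c8c83f59c8c820c81f3dc8c8c81f2bc8c859c81f3dc8203cc8c8c81f2bc8c859c81f3dc8c82bc83cc81f40c820585bc8c8c8272bc8c82bc84058c8c858c81fc8203cc8c8c82758c8c858c8203cc8c82ac83fc8205bc81f3dc8c8c82758c8c804c82a5bc8c840c858c8203cc8c82ac83dc85bc8203fc81f595cc8c8c8c83d3f59c8c8c83d3fc8c83dc83f595bc8c8c82b3cc8c8c8c83f595bc83c40c8c82bc83cc840585c2cc8c8c8c83d3f59c8c8c83d3fc8c83dc83f595bc8c8c82b3cc8c8c8272bc83c40c8c82bc83cc840585cc8c8c8c83d3f59c8c8c83d3fc8c83dc83f595bc8c8c82b3cc8c8c8272bc83c40c8c82bc83cc840585c2c41c8c8c8c83d3f59c8c8c83d3fc8c83dc83f595bc8c8c82b3cc8c8c8272bc83c40c8c82bc83cc840585cc8c8c8c83d3f59c8c8c83d3fc8c83dc83f595bc8c8c82b3cc8c8c8272bc83c40c8c82bc83cc840585c2cc8c8c8c83d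3f59c8c8c83d3fc8c83dc83f595bc8c8c8272bc8c8c8272bc83c40c8c82bc83cc840585cc8c8c8c83d3f59c8c8c83d3fc8c83dc83f595bc8c8c8272bc8c8c8272bc83c40c8c82bc83cc840585c2c415dc821c830c8c85d45c8c85bc85c61),
  (4, 0x1c8c8c8c8020b5bc8c8c80b3cc8c83cc8021f5cc8c8c8c840585cc802c80b0fc8c80fc80bc802c80a19c8c8c80558c8c82bc80240c8c809c82bc8025cc8c812c82bc809c8021cc8192ec8c8c8025bc8c809c80540c8c809c840c8025cc8c812c809c840c8021cc8c812c81cc809c840c8022bc81943c8c8c80558c8c80fc8025bc8c802c809c8055cc8c812c809c85cc8021cc8c812c81cc809c85cc8022bc8c812c81cc82bc809c85cc80240c8195fc8c80fc802c80bc801c827c83cc858c81920c8c80fc80bc819c802c80ac843c85fc81fc82028c8c80fc802c820c80bc801c83cc858c818c828c8192fc8c82ac843c80bc8c80b3fc80ac85fc81fc8c8192ec8c83fc80a02c820c82f3dc8c82fc83cc802c8c8023fc801c858c818c8c82027c8c83fc8010bc83dc819c82844c8c82ac8c82a3fc80bc8c80b5fc8c80b5bc80ac81fc8c8192ec8c8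19c82843c8c85fc85bc80a02c820c82fc8c82a4459c8c82fc8c82f44c802c8c80258c8c8025bc801c818c8c82027c8c820c82f3cc8c858c85bc8010bc819c828c8c82a3dc8c81bc82ac83fc85b5960),
  (1, 0x1c8c8c81c2ec8c8c8023dc81c43c8c8c8093dc8c83dc80259c81c5fc8c82ac83fc85bc81c20c8c81cc843c85fc81fc8202bc8c843c83cc85fc81fc82ec82040c8c840c85fc858c81fc82ec843c8205cc8c820c82bc81cc840c85cc83fc85bc81b2fc8c83fc83cc840c81cc82bc85cc85bc81bc82a44c8c844c85bc85cc81cc82bc840c858c81bc82ac83f60),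
  (24, 0x1c8c8c81f2bc8c8c81c28c82b43c8c8c81c28c8c859c81c3dc82b5fc8c81bc83fc85bc82b2fc8c82bc81fc85fc82ec82f40c8c82fc81bc85bc82ac840c82b44c8c83cc858c81fc82ec843c82fc8445cc8c83cc858c81bc82ac83fc85cc82bc84060)]

noncomputable def cert102 : List (ℕ × ℕ) := [
  (119, 0x1c8),
  (38, 0x1c8c86bc858c84fc83cc827c825c874c873c872),
  (79, 0x1c8c855c866c861c873c86c),
  (1, 0x1c8c856c855c83ac839c825c824c819c80f),
  (48, 0x1c8c86dc866c851c84ac833c832c874c873),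
  (81, 0x1c8c873c86c),
  (36, 0x1c8c855c83ac839c825),
  (33, 0x1c8),
  (49, 0x1c8),
  (7, 0x1c8),
  (15, 0x1c8),
  (13, 0x1c8),
  (41, 0x1c8)]

noncomputable def cert10T : List (ℕ × ℕ) := [
  (19, 0x1c8c835c856c855c854c83ac839c838c825c824c823c816c815c8c82314c872c871c870c86bc86ac869c865c864c863c84fc84ec84dc8c86c49c8c86dc86c48c8c86ec86dc86c47c8c841c875c874c87334c8c845c841c875c874c87333c8c845c841c870c875c874c87332c877c876c86fc853),
  (7, 0x1c9c85bc859c858c809c808c806c803c840c83fc83dc8c8403cc8c82d2bc8c858c83c2ac8c858c83cc82a28c8c859c83fc83dc82b27c8c832c82ac828c81e1cc8c803c858c83cc827c81e1bc8c806c858c83cc827c81bc81e19c8c83fc83dc832c82ac828c81cc81e18c8c819c80dc80ac85ec842c82dc81e12c8c842c83cc82bc82dc827c81cc81ec81811c8c842c83cc82bc82dc827c81cc81ec818c8110fc8c842c83fc83dc82dc82ac828c81ec81bc819c8120e)]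

noncomputable def cert111 : List (ℕ × ℕ) := [
  (53, 0x1cc2f00e02fc8c8c82f022e00e0c82f012e2d00e0c82fc82e2d2b00e0c82fc82ec82d2bc8c8c82b022a00e0c82b01c82fc82ec82d2a2900e0c82bc82ac82fc82ec82d292000e0c82fc82ec82bc82ac82dc82920c8c8c820021f00e0c82001c82fc82ec82bc82ac82dc8291f1e00e0c820c81fc82fc82ec82dc82bc82ac8291e1c00e0c82bc82ac820c8c8261fc82fc82ec829c8c8291ec82d1cc8c8c81c021b00e0c81c01c82bc82ac8c82620c8c807c82b1fc82fc8c8022ec8c81f29c8c82ac8291ec82d1b1a00e0c81cc81bc82bc82ac820c81fc829c81ec82fc82ec82d1ac8c82bc82ac820c81fc81cc8c82e1b7ac8c82bc829c820c81ec81cc8c82f1ac87a79c8c82ac829c81fc81ec81bc8c82e1ac87ac87978c8c82ec82bc82ac820c81fc8c82e1cc8c82fc82e1bc879c87856c8c82dc82bc829c820c81ec8c82d1cc8c82dc82f1ac856c87ac87855c8c82dc82ac829c81fc81ec8c82d1bc8c82dc82e1ac856c855c87ac87954c8c82fc82ec82bc82ac820c8c82a1fc8c82fc82e1cc8c81fc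82fc82e1bc879c878c855c8543ac8c82fc82dc82bc829c820c8c82b1ec8c82fc82d1cc8c81ec82dc82f1ac83ac87ac878c856c85439c8c82ec82dc82ac829c81fc8c82a1ec8c82ec82d1bc8c81ec82dc82e1ac83ac839c87ac879c856c85538ccc83ac839c8c839389fccc856c855c8c8555497ccc87ac879c8c8797873c8c87cc87bc859c858c857c83dc83cc83ba4c8c854c8389ec8c879c855c8399dc8c878c838c854c89d96c8c896c879c839c855c89e95c8c879c854c838c878c89dc89572c8c878c872c855c839c879c89ec89671),
  (83, 0x1c8c8c85904c8c85bc8c8825a02c8c85ec8c8845cc8c883c8825a01c885c881c861c8c8615dc87ac8c88156c83dc83cc828c8c82827c8c83cc82719c8c83dc828c81918c8c827c81844c8c83dc828c81943c8c83cc827c818c84340c8c843c83dc828c819c8443fc8c819c818c844c843c840c83f3bc8c819c840c83cc827c818c83fc83b2fc8c827c818c83fc83dc828c819c840c83b2ec8c819c844c82fc83cc827c818c843c83bc82e2bc8c827c818c843c82ec83dc828c819c844c83bc82f2ac8c827c819c818c844c843c840c83fc82fc82ec82bc82a26c8c82ec828c819c840c82bc83cc827c818c83fc83bc82ac82620c8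c82fc827c820c818c83fc82ac83dc828c819c840c83bc82bc8c82b261fc8c827c818c844c82fc820c80bc810c843c82ec81fc83bc826c87ec8c8265a1cc8c818c883c85fc843c82ec81fc810c80ac844c82fc8c81020c83bc8c82f26c8c8267ec8c826c8835a1bc8c82bc82ac820c81fc81cc81bc80bc80ac8c80a05c8c81fc80b04c87bc857c882c8c8827ec8c81fc87e5ec8c81bc85ec8825a17c8c85dc856c83dc828c819c844c840c82fc82bc820c8c85a1cc8c81c3bc8c820c81c26c8c82bc820c81c1779c8c85dc856c83cc827c818c843c83fc82ec82ac81fc8c85a1bc8c81b3bc8c81fc81b26c8c82ac81fc81b17c87978c8c856c844c840c83dc82fc82bc828c820c81cc8c85719c885c8c88581c8c820c81c3bc8c82bc820c81c26c8c82fc82bc820c81c17c87855c8c856c843c83fc83cc82ec82ac827c81fc81bc8c85718c885c8c88581c8c81fc81b3bc8c82ac81fc81b26c8c82ec82ac81fc81b17c8c87a55c87954c8c828c827c844c843c840c83fc83bc82fc82ec8c82e2bc8c83bc82f2ac8c82ec82bc82a26c8c83bc82655c8c83bc826c855549bc8c85dc83dc83cc83bc844c843c840c83fc819c818c8c83f1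7c8c83f20c8c817c8401fc8c817c843c81f1cc8c819c817c844c8201b9ac8c861c85dc828c827c826c819c818c817c82fc82ec82bc8c8172ac8c826c82a20c8c828c826c82b1fc8c827c826c81fc82e1cc8c817c828c826c820c82f1b93c8c828c827c844c843c840c83fc83bc82fc82ec8c82e2bc8c83bc82f2ac8c82ec82bc82a26c8c83bc82679c8c83bc826c87978c8c8019bc89ac89377c8c881c83dc83cc83bc844c843c840c83fc819c818c8c83f17c8c83f20c8c817c8401fc8c817c843c81f1cc8c819c817c844c8201bc8c801c8779ac89bc89376c8c885c881c828c827c826c819c818c817c82fc82ec82bc8c8172ac8c826c82a20c8c828c826c82b1fc8c827c826c81fc82e1cc8c817c828c826c820c82f1bc8c801c877c87693c89bc89a6fc8c840c83dc82fc82bc828c820c81cc819c878c8549ec8c83fc83cc82ec82ac827c81fc81bc818c89ec879c8559dc8a4c8a3c8c817a2),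
  (51, 0x1ca2f13de2f2d13dec82f2dc8c8c82f042b13dec82f01c82d2b2913dec82fc82dc82b29c8c8c8c82f0806c8c82bc82f042813dec82fc82b01c82dc829282613dec82fc82bc828c82dc8c82b29262013dec82fc82bc828c826c82dc829201e13dec82dc826c820c82fc82bc828c8291ec8c8c820041c13dec82001c82fc82bc8c80a28c826c81ec829c82d1c1a13dec829c826c820c81ec81cc82bc828c82fc82d1ac8c8c8c8200806c8c81cc820041913dec820c81c01c82fc8c80a2bc8c81fc81b28c826c81ec8c82f1ac82dc829191713dec826c820c81cc8c80419c8c8201ec8c820c81c1ac8c81a28c8c8432fc8c819c81c2dc8c87fc85bc83f2bc8c82bc81ec819c8202917ca9dca95ca71c8c81ec81cc81ac819c817c89dc895c87134c8c820c81ec81cc81ac819c817c89dc895c87124c8c826c820c81ec81cc81ac819c817c89dc895c87115c8c828c826c820c81ec819c8c82817c871c834c824c81585c8c828c826c81cc81ac819c8c82817c871c885c834c824c81581c8c82dc828c826c820c81ec8c82d19c8c82fc82817c895c834c824c815c88161c8c829c828c826c81cc81ac8c82919c8c82bc82817c895c861c834c824c815c8855dc8c82fc82dc828c826c820c8c8281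ec8c826c82d19c8c82dc82fc82817c89dc834c824c815c881c85d45c8c82bc829c828c826c81cc8c8281ac8c826c82919c8c829c82bc82817c89dc845c834c824c8c89d15c885c86141c8c828c826c820c81ec81cc81ac819c8c82b17c861c85dc845c8c86141c89dc895c87179c8c83ac838c834c86ac864c84ec848c88ec8c81788c845c841c885c8c84581c89dc871c89555c8c854c83ac838c834c88ec888c86ac864c8c8644ec8c819c81748c885c881c8c88161c8c861c8855dc895c8c85571c89d39c8c839c82fc82dc82bc829c828c826c820c81cc8c82919c861c85dc8c85d45c8c81cc86141c8c815718fc8c861c85dc845c841c855c839c828c819c817c82fc82bc8c81b20c8c85dc8411cc8c87fc82b1ec8c828c883c82f1ac8c815c8247189c8c855c815c879c839c82fc82bc828c820c81cc819c82dc8c82029c8c820c81c26c8c82645c8c81cc82941c8c84185c8c81cc845816bc8c88fc855c824c879c839c82fc82bc828c820c81cc8c85819c845c8c81c41c8c82fc82b17c8c85bc82b1ec8c828c85fc82f1ac8c817c84185c8c817c81ac8458165c8c82ec82ac827c843c83fc83cc82fc82bc828c820c8c83c1cc8c83fc83c19c8c8192dc8c843c82029c8c83fc820c81c26c8c82685c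8c81cc82981c8c826c885c88161c8c81cc881c829c8855d4fc8c839c81fc81bc818c843c83fc83cc82fc82bc828c8c83c20c8c83fc83c1cc8c843c83fc83c19c8c82817c8c81785c8c81cc81781c8c885c817c88161c8c81cc881c817c8855dc8c83cc828c83fc82b1ec8c82bc83cc828c843c82f1a49c8c87fc87cc85fc85bc858c855c82fc82bc828c8c81420c8c858c8141cc8c85bc858c81419c8c81445c8c82bc81c41c838c8399ec8c883c87fc87cc839c843c83fc83cc82fc82bc8c83c28c8c83fc83c20c8c843c83fc83c1cc8c814c843c83fc83c19c8c81461c8c82bc81c5dc854c85596c8c823c814c85fc85bc858c843c83fc83cc82fc8c83c2bc8c83fc83c28c8c843c83fc83c20c8c858c843c83fc83c1cc8c85bc858c843c83fc83c19c8c81485c8c82bc81c81c879c87872),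
  (26, 0x1c8c8c8c8c8575c7b7ec8c8c80257c8c83bc8577b7fc8c8c80157c8c801c8027fc8c826c83bc8577b80c8c8c8c8575c7bc8c8c8c8c83b575c5dc8c8c8575bc8c801c8575c7b7ec8c8c8025cc8c85cc80257c8c826c83bc8577b7fc8c8c8025bc8c85cc80157c8c8c8575cc801c8027fc8c817c826c83bc8577b8081c80ac8c8c8577f0bc8c80ac80b18c8c8c8577fc80ac80b19c8c818c81914c8c818c819c81415c8c80bc818c81523c8c80bc819c814c82324c8c80ac80bc818c815c82438c8c80ac80bc819c814c838c82339c8c85cc80ac80bc818c815c824c83954c8c85bc80ac80bc819c814c854c823c83855c8c809c812c818c80ac80bc8190ec8c808c811c819c80ac80bc818c80e0fc8c85dc809c818c82bc80ac819c824c80f27c8c85dc808c819c82ac80bc818c823c827c80e28c8c841c8c8415dc809c818c80ac8c80a40c819c839c80fc8283cc8c841c8c8415dc808c819c80bc8c80b3fc818c838c83cc80ec8273dc8c83ec8c83e41c8c83ec8c83e415dc809c8c80918c8c8180ac8c80a5cc8c80a19c80fc828c83dc8c83d5558c8c83ec8c83e41c8c83ec8c83e415dc808c8c80819c8c8190bc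8c80b5bc8c80b18c858c827c83cc8c83c54c8c854c80b0e59c8c824c838c839c854c855c80ec80fc827c828c83cc83dc8c83d58c8c827c83c590cc8c827c828c83cc83dc858c859c814c815c823c824c838c8c82339c8c824c83954c8c858c823c8385516c8c83ec8c83e41c8c83ec8c83e415ac8c83ec8c83e41c8c83ec8c83e415a5dc8c85d05c8c85ac8050ac8c805c80a18c8c8180bc8c81880c80cc815c8c80c24c8c83cc80c39c8c880c858c80c55c8c824c839c8551678c8c83ec8c83e41c8c83ec8c83e415ac8c83ec8c83e41c8c83ec8c83e415a5dc8c85d04c8c85ac8040bc8c804c80b19c8c8190ac8c8197fc80cc814c8c80c23c8c83dc80c38c8c87fc859c80c54c8c85dc87fc880c80c78c8c823c838c854c8781679c8c83ec8c83e41c8c83ec8c83e415ac8c83ec8c83e41c8c83ec8c83e415a5dc8c83ec8c83e41c8c83ec8c83e415ac8c83ec8c83e41c8c83ec8c83e415a5d81c8c85dc8c85d8118c8c85ac81809c8c85ac818c8090ac8c80a19c8c80ac81980c816c80cc8c80c0fc8c80cc81679c8c879c816c80c28c8c838c879c816c80c3dc8c880c854c879c816c80c597cc8c83ec8c83e41c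8c83ec8c83e415ac8c83ec8c83e41c8c83ec8c83e415a5dc8c83ec8c83e41c8c83ec8c83e415ac8c83ec8c83e41c8c83ec8c83e415a5d81c8c85dc8c85d8119c8c85ac81908c8c85ac819c8080bc8c80b18c8c80bc8187fc816c8c8167cc8c87c0cc8c816c80c0ec8c818c80cc81678c8c824c878c816c80c27c8c87fc839c878c816c80c3cc8c85cc87fc855c878c816c80c587dc8c81dc805c809c80bc819c80cc816c812c81cc8c817c8262bc8c80dc817c83b40c80fc8c80fc802c80dc817c8575cc8c854c87815c8c815c878c87cc802c80dc817c87b801fc8c81dc804c808c80ac818c80cc816c811c81bc8c87bc8071fc8c80dc817c8262ac8c801c80dc817c83b3fc8c859c801c80dc817c8575bc8c879c87dc801c80dc817c87b7fc8c83dc859c87d0ec8c824c839c855c8791420c8c811c812c818c819c827c828c83cc83dc858c8c83c59c8c83dc8597cc8c827c83cc8587dc8c81216c8c81cc8121fc8c81bc81fc811201ec8c81bc81cc81ec80ac80bc823c824c838c839c8c83954c8c823c83855c8c824c839c85578c8c878c823c838c85479c8c812c81c1fc8c811c81fc81b20c8c855c878c8790c21c8c82cc82bc812c80fc820c821c828c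824c83dc859c87d2ec8c82cc82ac811c80ec81fc821c827c82ec823c83cc858c87c2fc8c829c841c812c840c80fc820c821c83dc828c859c87dc839c82f43c8c829c841c811c83fc80ec81fc821c83cc843c827c858c87cc838c82e44c8c829c83ec85dc812c85cc80fc820c821c859c828c83dc87dc82fc844c8555fc8c829c83ec85dc811c85bc80ec81fc821c858c85fc827c83cc87cc82ec843c8c8155460c8c83ec85ac87bc881c812c80fc821c820c87dc880c828c83dc859c82fc844c8c88060c8c8147983c8c83ec85ac87bc881c811c80ec821c81fc87cc87fc883c827c83cc8c87f58c82ec8c87f43c8c87fc8555fc8c855c8157884c8c82ac82bc82cc83cc83dc858c859c87cc87dc821c81fc8202dc8c812c83fc841c858c87cc821c827c859c87dc840c8c87c28c81fc8c83f2042c8c811c812c85dc821c87cc87dc827c828c83cc85bc85cc8c87cc8273dc8c85c1fc8c811c85b205e1303ddc811c812c821c881c827c828c83cc83dc8c83d58c8c827c83c59c81fc8c81120c8c812c8207fc8c87fc811c81f8082),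
  (20, 0x1c8c8c8c8c8053b5f78c8c8c80543c8c857c8055f7bc8c8c80543c8c8c8577bc80b5bc8c8c83b57c8c807c8577bc8055f7cc8c8c80b17c8c87bc80b26c8c80dc87bc80b3bc8c85fc80dc87bc80b577fc8c8c8027bc8c87bc80517c8c807c87bc80526c8c80dc807c87bc8053bc8c85fc80dc807c87bc8055783c8c8c8055fc8c807c8058319c8c8c80b3cc8c87bc80b58c8c857c87bc80b7c1cc8c8c80527c8c81cc8053cc8c87bc81cc80558c8c857c87bc81cc8057c20c8c819c81cc82016c8c826c819c81cc82025c8c8c8c8027f83c83bc819c81cc8c83b203ac8c8c8c80b7c7fc8c8c8057cc8c8c80b7cc8027f83c857c819c8c8571cc8c8c8027fc8572056c8c8c8c8055f7cc8c8c8025fc8c8c8055fc80b7c7fc8c8c8025bc8c8c80b5bc8057cc8c8c80b581305de130bde0b7c1302de027f83c819c8c8c802831cc8c8c8025bc8c819c8027f20c8c819c81cc8207b7ac8c816c83ac856c87a2cc8c8c8c8575f7bc8c8c8c8c83b575f78c8c8c8575bc8c807c8575f7b7cc8c8c80d3bc8c85fc80d57c8c826c83bc8577b7fc8c8c80726c8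c80dc8073bc8c85fc80dc80757c8c817c826c83bc8577b83c805c8c8c8577f0bc81cc820c82cc81910c8c820c816c83ac856c87ac82c30c8c878c823c816c856c87ac825c83041c8c878c823c816c856c87ac825c841c82c45c8c878c823c838c816c87ac825c83ac830c8455dc8c878c823c838c816c87ac825c83ac85dc82cc84161c8c85dc81cc883c8c81019c816c825c83ac856c830c845c8c83a6181c8c861c820c87fc8c81019c816c825c83ac856c8c85681c82cc8c82541c8c825c83a5d85c8c885c816c81cc820c825c83ac856c87a15c8c816c81cc820c825c83ac856c87a24c8c885c816c82cc830c83ac825c856c87a39c8c816c82cc830c841c845c856c825c83ac87a55c8c861c816c81cc820c87ac87fc883c825c83ac8c8455679),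
  (16, 0x1c8c8c8c844575bc8c8c80144c8c82ec843575cc8c8c8262bc8c80dc83b40c8c81cc82bc840575fc8c8c8083bc8c80dc8262ac8c802c80dc83b3fc8c83bc81bc82ac83f5760c8c8c80820c8c80fc8575bc8c826c804c8082fc8c807c83bc804c80844c8c801c807c857c804c808607bc8c8c81720c8c80bc80f57c8c802c80dc8262fc8c807c802c80dc83b44c8c801c807c802c80dc85760c8c83bc857c820c82fc844c8607b7fc8c8c8262ec8c817c8012fc8c802c80dc83b43c8c857c817c826c80144c8c807c801c802c80dc8575fc8c80dc857c817c826c83bc80160c8c826c83bc857c81fc82ec843c85f7b80c8c8c80720c8c805c80926c8c807c805c8093bc8c807c802c80dc8262bc8c860c802c807c805c80957c8c880c801c807c802c80dc83b40c8c85fc880c801c807c802c80dc8575cc8c817c826c83bc857c81cc82bc840c85c7b83c8c8c80783c8c804c80826c8c802c80dc8262ac8c801c826c817c8072ec8c843c801c807c804c8083bc8c85cc85fc801c807c804c80857c8c844c87fc801c807c802c80dc83b3fc8c844c860c87fc801c807c802c80dc8575bc8c807c817c826c83bc857c81bc82ac83fc85b7b84c818c81dc8c81819c8c819c81d21c8c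81dc821c81927c8c81dc821c818c82728c8c827c828c818c819c8212cc8c827c828c818c819c81dc82c30c8c844c81dc821c82cc830c819c8283cc8c843c81dc821c82cc830c818c827c83c3dc8c844c83cc83dc818c819c827c828c821c83041c8c840c83cc83dc818c819c827c828c81dc82cc84145c8c85cc860c81dc821c82cc830c841c8c84145c819c828c83d58c8c85bc85fc81dc821c82cc830c841c8c84145c818c827c83cc8c8605859c8c85fc860c858c859c818c819c827c8c82728c8c819c8283cc8c818c827c83c3dc821c8c86030c8c85fc860455dc8c85bc85cc858c859c818c819c827c8c82728c8c819c8283cc8c818c827c83c3dc81dc8c85c2cc8c85bc85c41c8c85cc85fc8605d61c8c8c8c8577b83c81dc821c82cc830c841c8c84145c8c830c8455dc8c82cc841c85d61c8c841c85d80c8c830c845c86184c8c88419c8c880c88428c8c843c880c8843dc8c85bc85fc880c884597cc8c8c8c8577b84c81dc821c82cc830c841c8c84145c8c830c8455dc8c82cc841c85d61c8c841c85d7fc8c830c845c86183c8c88318c8c87fc88327c8c844c87fc8833cc8c85cc860c87fc88358c8c80cc87fc880c883c8847c7dc8c8c8c8577b80c818c819c827c828c83cc8c83c3dc8c828c83d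58c8c827c83cc85859c8c819c828c83dc8597cc8c818c827c83cc858c87c7dc8c83cc858c87cc87d83c8c87dc819c828c83dc85984c8c812c883c88421c8c82ac82bc883c88430c8c812c83fc840c883c88445c8c811c812c85bc85cc883c8846181c8c8c8c8577b84c818c819c827c828c83cc8c83c3dc8c828c83d58c8c827c83cc85859c8c819c828c83dc8597cc8c818c827c83cc858c87c7dc8c83cc858c87cc87d7fc8c87dc819c828c83dc85980c8c812c87fc8801dc8c82ec82fc87fc8802cc8c812c843c844c87fc88041c8c811c812c85fc860c87fc8805d1000e0c811c812c87fc880c883c8848185),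
  (23, 0x1c8c8c8122ac8c82ac8112bc8c8c81c2bc811c82a7dc8c806c81bc812c82b3fc8c806c81cc83fc811c82a40c816c8c804c816c806c81bc812c82bc8405bc8c805c816c806c81cc85bc811c82ac83f5cc8c8c8112bc8c811c82a7dc8c806c812c82b3fc8c806c83fc811c82a40c8c804c806c812c82bc8405bc8c805c806c85bc811c82ac83f5cc81bc81c7bc8c87bc87dc804c806c816c81bc812c82bc840c85c7fc8c87bc87cc805c806c816c81cc87fc811c82ac83fc85b80c8c840c85bc85cc87fc880c80dc8070cc8c80cc81630c8c830c80cc81645c8c85bc85cc80cc81661c8c8c8127dc87fc880c80cc81685c8c885c80cc816c806c811c82ac83fc85bc87fc82bc840c85cc8801fc8c861c885c80cc816c806c812c82bc840c85cc880c82ac83fc85bc87f20c8c820c816c804c80cc82ac81fc81bc83fc85bc87fc806c812c82bc805c81c2ec8c820c82ec816c804c80cc83fc81fc81bc82ac85bc87fc806c812c840c805c81c43c8c81fc816c805c80cc82bc820c81cc840c85cc880c806c811c82ec843c82ac804c81b2fc8c81fc82fc816c805c80cc840c820c81cc82bc85cc880c806c811c843c82ec83fc804c81b44c8c820c82ec8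43c816c804c80cc85bc81fc81bc82ac83fc87fc806c812c82fc844c85cc805c81c5fc8c81fc82fc844c816c805c80cc85cc820c81cc82bc840c880c806c811c8c8575fc82ec843c85bc804c81b60c8c820c82ec843c85fc816c804c80cc87fc81fc81bc82ac83fc806c812c8c85cc82bc8405bc82fc844c8c80760c8c87b80c805c81c83c8c81fc82fc844c860c816c805c80cc880c820c81cc82bc840c806c811c8c85bc82ac83f5cc8c807c87b83c82ec8c80743c8c80dc8075fc8c885c87b7fc804c81b84c8c8c82084c8c860c81f57c8c820c884c81f7bc805c8c88404c816c8c844c860c88406c8c828c83dc859c87d1bc8c844c860c884c81b11c8c812c82fc8202ac8c81bc812c844c8203fc8c812c83fc844c860c884c81bc8052ec8c844c812c82ac82fc860c884c81bc80543c8c860c82ac82fc83fc844c884c81bc857c8055fc8c812c884c82ac82fc83fc844c860c81bc87bc80583c8c807c859c861c812c80dc80fc857c860c8205bc8c857c807c812c87dc885c80dc80fc87bc884c8207fc8c80dc819c828c83dc859c87dc826c83bc857c87b1cc82bc840c85cc8800ac8c8c81f5fc8c81fc8207bc8c80ac80cc81f83c804c8c88305c816c8c843c85fc88306c8c82ec8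43c85fc88312c8c811c82ec81f2bc8c80ac811c843c81f40c8c85fc883c82ec843c827c83cc8581cc8c82ec811c843c85fc883c840c81cc8042fc8c840c843c811c82ec85fc883c82bc81cc80444c8c811c85fc82ec843c883c82bc840c81cc857c80460c8c811c883c82bc82ec840c843c85fc81cc87bc80484c8c807c858c861c811c80dc80ec857c85fc80ac81f5cc8c8c81f43c8c80cc81f5fc8c80ac80cc81f83c804c8c88306c816c8c85fc80484c820c805c81c7cc8c857c807c811c87cc885c80dc80ec87bc883c80ac81f80c8c859c87dc818c827c83cc858c87cc826c83bc857c87b1bc82ac83fc85bc87f0bc8c8c8127c1100e01200e0127dc81bc80ac80bc8c80bc8121cc8c81bc81cc8111fc8c811c81bc81cc81220c8c811c812c81bc81c0cc8c80ac80cc81fc81bc812c81c2ec8c82ec80ac80cc81fc81bc812c81c43c8c82ec843c80ac80cc81fc81bc812c81c5fc8c87bc87dc80ac881c80cc81fc81bc812c81c83c8c80bc80cc820c81cc82ec811c843c85fc883c81b2fc8c82fc80bc80cc820c81cc843c811c82ec85fc883c81b44c8c82fc844c80bc80cc820c81cc85fc811c82ec843c883c81b60c8c87bc87cc80bc881c8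0cc820c81cc883c811c82ec843c85fc81b8421),
  (7, 0x1c8c8c8c80d5c7cc8c8c80d3fc8c859c80d5b7dc8c8c80d2bc8c8c85b7dc80d40c8c8c8587cc8c859c85b7dc80d5c7fc8c8c80d2ac8c8c85c7cc80d3fc8c8c85c7cc8c83fc8597dc80d5bc8c8c8585cc8c858c85c7cc8c83fc859c85b7dc80d7f80c8c8c8c8c80d5b5c5dc8c8c80d40c8c858c80d5c7cc8c8c80d2ac8c83dc80d3fc8c83fc859c80d5b7dc8c8c80d1cc8c8c85b7dc80d2bc8c8c8595bc8c859c85b7dc80d40c8c8c8595bc8c840c8587cc8c83fc859c85b7dc80d5c7fc8c8c80d1bc8c8c85c7cc80d2ac8c8c8585cc8c858c85c7cc80d3fc8c8c8585cc8c858c85c7cc8c83fc8c858c85c7cc8597dc80d5bc8c8c8595bc8c8c8595bc8585cc8c840c858c85c7cc8c83dc83fc859c85b7dc80d7f8081c8c8c87c7f0bc8c840c85cc8801fc8c8c85c7dc8c859c87d80c81f0ac8c8c8c80a5c7dc8c8c80d40c8c80bc80d5c7fc8c8c80d3fc8c80bc80d5bc8c80ac80bc80d7f80c81f0cc821c830c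8c80c45c8c80bc80c61c8c83cc858c87cc880c804c82ac83fc85bc87fc81f20c8c861c83dc859c87dc819c805c840c85cc81cc880c8202ec8c861c83cc858c87cc818c804c83fc85bc81bc87fc82ec81f2fc8c830c861c859c87dc819c828c805c85cc81cc82bc880c820c82f43c8c830c861c858c87cc818c827c804c85bc81bc82ac87fc843c81fc82e44c8c8c84344c87fc880c81dc82cc841c85dc88185c8c80cc85cc81bc82ac83fc87fc804c85bc805c880c81cc82bc840c820c82fc8445fc8c80cc85bc81cc82bc840c880c805c85cc804c87fc81bc82ac83fc85fc81fc82ec84360c8c80cc881c81bc82ac83fc85bc880c804c87fc805c81cc82bc840c85cc820c82fc844c86083c8c80cc881c81cc82bc840c85cc87fc805c880c804c81bc82ac83fc85bc883c81fc82ec843c85f84),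
  (29, 0x1c8c8c8c8595b7dc8c8c8595bc8c859c85b7d7fc8c8c83c40c8c8c83c40c8585cc8c840c858c85c7c80c8c8c8c8595b7dc8c8c8595bc8c859c85b7d7fc8c8c83c40c8c8c83c40c8585cc8c840c858c85c7c802cc8c8c8c8595b7dc8c8c8595bc8c859c85b7d7fc8c8c83c40c8c8c83c40c8585cc8c840c858c85c7c80c8c8c8c8595b7dc8c8c8595bc8c859c85b7d7fc8c8c83c40c8c8c83c40c8585cc8c840c858c85c7c802c41c8c8c8c8595b7dc8c8c8595bc8c859c85b7d7fc8c8c83c40c8c8c83c40c8585cc8c840c858c85c7c80c8c8c8c8595b7dc8c8c8595bc8c859c85b7d7fc8c8c83c40c8c8c83c40c8585cc8c840c858c85c7c802cc8c8c8c8595b7dc8c8c8595bc8c859c85b7d7fc8c8c83c40c8c8c83c40c8585cc8c840c858c85c7c80c8c8c8c8595b7dc8c8c8595bc8c859c85b7d7fc8c8c83c40c8c8c83c40c8585cc8c840c858c85c7c802c415dc8c8c8c8595b7dc8c8c8595bc8c859c85b7d7fc8c8c83c40c8c8c83c40c8585cc8c840c858c85c7c80c8c8c8c8595b7dc8c8c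8595bc8c859c85b7d7fc8c8c83c40c8c8c83c40c8585cc8c840c858c85c7c802cc8c8c8c8595b7dc8c8c8595bc8c859c85b7d7fc8c8c83c40c8c8c83c40c8585cc8c840c858c85c7c80c8c8c8c8595b7dc8c8c8595bc8c859c85b7d7fc8c8c83c40c8c8c83c40c8585cc8c840c858c85c7c802c41c8c8c8c8595b7dc8c8c8595bc8c859c85b7d7fc8c8c83c40c8c8c83c40c8585cc8c840c858c85c7c80c8c8c8c8595b7dc8c8c8595bc8c859c85b7d7fc8c8c83c40c8c8c83c40c8585cc8c840c858c85c7c802cc8c8c8c8595b7dc8c8c8595bc8c859c85b7d7fc8c8c83c40c8c8c83c40c8585cc8c840c858c85c7c80c8c8c8c8595b7dc8c8c8595bc8c859c85b7d7fc8c8c83c40c8c8c83c40c8585cc8c840c858c85c7c802c415d81c8c8c84059c8c83dc8595cc8c82bc840c85c7dc8c828c83dc859c87d801fc8c8c83c3fc8c82ac83f58c8c827c83cc8585bc8c804c82ac83fc85b7cc8c801c827c83cc858c87c7f20c821c830c845c8c82061c8c87fc88085),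
  (1, 0x1c8c8c81258c8c8c80b7fc8127cc8c80bc805c80a1cc8c8c80559c8c828c8057dc8c828c809c80519c81c2ec8c8c80559c8c83dc8057dc8c809c83dc80519c8c80fc809c83dc80528c81c43c8c8c80259c8c859c8057dc8c809c859c80519c8c80fc809c859c80528c8c843c80fc809c859c8053dc81c5fc8c804c82ac83fc85bc87fc80bc81c20c8c8c80b12c8c812c80b20c8c820c809c8027dc8c820c809c87dc80519c8c820c80fc809c87dc80528c8c820c828c80fc809c87dc8053dc8c820c85bc85fc80fc809c87dc80559c81c83c8c81cc80bc805c80ac843c85fc883c81fc8202bc8c820c805c80bc804c83fc85bc87fc81bc82bc81c2fc8c843c83cc80bc805c80ac85fc883c81fc82ec820c82f40c8c83fc83cc805c80bc804c85bc87fc81bc82ac840c81cc82b44c8c840c85fc80bc858c80ac883c81fc82ec8c83d43c8c80a05c820c82fc8445cc8c844c85bc805c858c804c87fc81bc82ac8c83d3fc8c8040bc85cc81cc82bc84060c8c840c8c8405cc80bc883c87cc81fc82ec843c8c8405fc8c87c05c820c82fc844c8c88360c8c80bc87cc883c8050a80c8c844c8c84460c805c87fc87cc81bc82ac83fc8c8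445bc8c87c0bc81cc82bc840c8c87f5cc8c805c87cc87fc80b04c8c858c87fc883c87c8084),
  (24, 0x1c8c8c80b7fc8c8c81c7dc8052ec8c8c81c7dc8c83dc81c28c80543c8c8c81c7dc8c859c81c28c8c809c859c81c3dc8055fc8c8c8597fc8c83fc85b7dc805c812c80b20c8c8c8197dc8c809c8191cc8c809c87dc81c28c8c80fc809c87dc81c3dc8c83dc80fc809c87dc81c59c80583c8c81cc81fc843c85fc883c80ac80b2bc8c820c81bc83fc85bc87fc804c82bc8052fc8c83cc81cc81fc85fc883c82ec80ac80bc82f40c8c83cc820c81bc85bc87fc82ac804c840c805c82b44c8c85fc81cc858c81fc883c82ec843c80ac80bc82fc8445cc8c85bc820c858c81bc87fc82ac83fc804c85cc805c82bc84060c8c820c81cc883c87cc81fc82ec843c85fc80ac80bc82fc844c86080c8c81cc820c87fc87cc81bc82ac83fc85bc804c880c805c82bc840c85c84),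
  (4, 0x1c8c8c80b5bc8c80bc85b60c8c8c83f44c8c844c85b60c80b7fc8c844c8c84460c80bc87f84)]

noncomputable def cert112 : List (ℕ × ℕ) := [
  (119, 0x1c8c882c880c88ac885c87fc87ec889c884c87cc87b),
  (38, 0x1c8c88fc873c86bc84fc87cc858c83cc827c82bc834c82fc89ec896c872c8a0c898c874c833c82e),
  (1, 0x1c8c8a0c898c891c874c86dc851c87ac879c856c855c83ac839c825c824c819c80f),
  (79, 0x1c8c829c88bc886c867c862c88ac885c866c861c8a0c897c890c873c86cc89ec89f),
  (48, 0x1c8c88ac874c866c84ac891c86dc851c836c819c818c817c89fc897c873c833c832),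
  (33, 0x1c8c88bc886c867c862c84bc846c836c831c808c807),
  (81, 0x1c8c87ac879c856c855c897c890c873c86cc8a0c89f),
  (36, 0x1c8c886c867c862c84bc846c825c87ac856c83ac807),
  (49, 0x1c8c867c84bc836c80f),
  (7, 0x1c8c80d),
  (15, 0x1c8),
  (43, 0x1c8c82ac829),
  (80, 0x1c8c89f),
  (13, 0x1c8)]

noncomputable def cert11T : List (ℕ × ℕ) := [
  (7, 0x1c9c806c808c809c80ec80fc811c812c818c819c81bc81cc827c828c8c8282ac8c81bc8272bc8c870c8943cc8c812c81cc82b3dc8c812c81cc82bc83d3fc8c819c81bc828c82ac83c40c8c85ec863c869c870c89c58c8c870c812c81cc82bc840c89c59c8c870c812c81cc82bc840c859c89c5bc8c869c828c82ac870c83dc83fc858c89c5cc8c85bc879c87ec882c887c88dc894c89c7cc8c81cc82bc840c85cc882c887c88dc894c89c7dc8c81cc82bc840c85cc87dc882c887c88dc894c89c7fc8c82ac83dc83fc859c85bc87cc882c887c88dc894c89c80c8c894c89c37c8c88dc89cc8374cc8c81bc81cc863c88752c8c80fc811c812c85ec88253c8c84cc88dc894c84dc852c85368c8c819c81bc81c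c887c847c84cc8536ec8c80ec80fc811c812c882c842c84cc8526fc8c828c82ac82bc887c88dc832c837c853c86f75c8c86fc80ec80fc811c812c882c82dc837c852c86e76c8c812c818c819c81bc81cc882c887c81ec837c84cc86877c8c84cc868c84dc869c870c852c853c86ec86fc875c876c8778cc8c819c81bc81cc870c847c863c84cc853c868c86fc875c877c87692c8c86fc80ec80fc811c812c842c85ec84cc852c868c86ec876c877c87593c8c827c828c82ac82bc863c869c832c837c853c868c86ec876c877c893c86f99c8c893c80ec80fc811c812c869c85ec82dc837c852c868c86fc875c877c892c86e9ac8c811c812c818c819c81bc81cc85ec863c837c84cc86ec86fc875c876c88cc81ec8689bc8c892c83cc83dc83fc840c837c84cc852c86fc876c877c893c89ac89bc832c847c84dc853a1c8c893c89ac80ec80fc811c812c837c84cc853c86ec875c877c892c899c89bc84dc82dc842c852a2c8c80fc811c812c818c819c81bc81cc837c852c853c868c875c876c88cc899c89ac842c847c81ec84ca3c8c818c819c81bc81cc827c828c82ac82bc84cc852c853c868c86ec86fc88cc892c893c81ec82dc832c837a4),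
  (1, 0x1c8c8c8229bc8c84cc822a3c8c831c836c837a4c804c805c806c80ac80bc80cc814c815c816c823c824c825c8c82538c8c824c82539c8c823c824c8253ac8c825c838c839c83a54c8c824c825c838c839c83a55c8c823c824c825c838c839c83a56c8c825c838c839c83ac854c855c85678c8c824c825c838c839c83ac854c855c85679c8c823c824c825c838c839c83ac854c855c8567a),
  (19, 0x1c8c867c866c852c851c850c84cc84bc84ac837c8c84a36c8c84cc84b35c8a4c8a3c8a2c89bc89ac893c877c876c86fc853)]



theorem frc_eq {α : Type} (x : ℕ) (k : ℕ → α) : frc x k = k x := by cases x <;> rfl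

theorem ite'_eq {α : Type} (b : Bool) (x y : α) : ite' b x y = if b = true then x else y := by
  cases b <;> rfl

theorem dif_testBit (a b i : ℕ) : (dif a b).testBit i = (a.testBit i && !b.testBit i) := by
  show (a ^^^ (a &&& b)).testBit i = _
  simp only [Nat.testBit_xor, Nat.testBit_and]
  cases a.testBit i <;> cases b.testBit i <;> rfl

theorem tb_eq (a i : ℕ) : tb a i = a.testBit i := by
  have h : tb a i = @Nat.rec (fun _ => Bool) false (fun _ _ => true) ((a >>> i) &&& 1) := rfl
  rw [h, Nat.testBit, Nat.and_comm]
  cases (1 &&& (a >>> i)) <;> rfl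

theorem meets_eq (a b : ℕ) : meets a b = decide (a &&& b ≠ 0) := by
  have h : meets a b = @Nat.rec (fun _ => Bool) false (fun _ _ => true) (a &&& b) := rfl
  rw [h]
  cases (a &&& b) <;> rfl

theorem rm_testBit (A e i : ℕ) : (rm A e).testBit i = (A.testBit i && !decide (e = i)) := by
  unfold rm
  rw [dif_testBit]
  show (_ && !(2 ^ e).testBit i) = _
  rw [Nat.testBit_two_pow]

/-- the packed edge of index `t` -/
noncomputable def edOf (t : ℕ) : Ed := mkEd t id

theorem mkEd_eq {α : Type} (t : ℕ) (k : Ed → α) : mkEd t k = k (edOf t) := by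
  have key : ∀ (e m N M : ℕ),
      @Nat.rec (fun _ => ℕ → ℕ → α) (fun N M => k ⟨e, N, M⟩)
        (fun v ih N M => ite' (tb e v)
          (frc (Sm v) fun s => frc (Nat.lor M (Nat.land N s)) fun M' =>
            frc (Nat.lor N s) fun N' => ih N' M')
          (ih N M)) m N M =
      k (@Nat.rec (fun _ => ℕ → ℕ → Ed) (fun N M => id ⟨e, N, M⟩)
        (fun v ih N M => ite' (tb e v)
          (frc (Sm v) fun s => frc (Nat.lor M (Nat.land N s)) fun M' =>
            frc (Nat.lor N s) fun N' => ih N' M')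
          (ih N M)) m N M) := by
    intro e m
    induction m with
    | zero => intro N M; rfl
    | succ m ih =>
      intro N M
      simp only [frc_eq, ite'_eq] at ih ⊢
      split
      · exact ih _ _
      · exact ih _ _
  unfold edOf
  rw [mkEd, mkEd, frc_eq, frc_eq]
  exact key (tcode t) 11 0 0

theorem edOf_c (t : ℕ) : (edOf t).c = tcode t := by
  have key : ∀ (e m N M : ℕ),
      (@Nat.rec (fun _ => ℕ → ℕ → Ed) (fun N M => id ⟨e, N, M⟩)
        (fun v ih N M => ite' (tb e v)
          (frc (Sm v) fun s => frc (Nat.lor M (Nat.land N s)) fun M' =>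
            frc (Nat.lor N s) fun N' => ih N' M')
          (ih N M)) m N M).c = e := by
    intro e m
    induction m with
    | zero => intro N M; rfl
    | succ m ih =>
      intro N M
      simp only [frc_eq, ite'_eq] at ih ⊢
      split
      · exact ih _ _
      · exact ih _ _
  unfold edOf
  rw [mkEd, frc_eq]
  exact key (tcode t) 11 0 0

/-- bounded universal check -/
noncomputable def allLt (p : ℕ → Bool) (m : ℕ) : Bool :=
  @Nat.rec (fun _ => Bool) true (fun t ih => ite' (p t) ih false) m

theorem allLt_spec {p : ℕ → Bool} {m : ℕ} (h : allLt p m = true) : ∀ t < m, p t = true := by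
  induction m with
  | zero => intro t ht; omega
  | succ m ih =>
    have h' : ite' (p m) (allLt p m) false = true := h
    rw [ite'_eq] at h'
    intro t ht
    by_cases hp : p m = true
    · rw [if_pos hp] at h'
      rcases Nat.lt_succ_iff_lt_or_eq.mp ht with h1 | h1
      · exact ih h' t h1
      · exact h1 ▸ hp
    · rw [if_neg hp] at h'; cases h'

noncomputable def beqB (a b : Bool) : Bool := ite' a b (ite' b false true)

theorem beqB_spec {a b : Bool} (h : beqB a b = true) : a = b := by
  cases a <;> cases b <;> first | rfl | cases h

noncomputable def cnt (c : ℕ) : ℕ :=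
  @Nat.rec (fun _ => ℕ) 0 (fun v ih => Nat.add ih (Nat.land (Nat.shiftRight c v) 1)) 11

noncomputable def pairChk : Bool :=
  allLt (fun t => mkEd t fun E => allLt (fun s => frc (Nat.land E.c (tcode s)) fun c =>
    ite' (beqB (tb E.N s) (ite' (Nat.beq c 0) false true))
      (beqB (tb E.M s) (ite' (Nat.beq c 0) false (ite' (isPow c) false true))) false) 165) 165

theorem pairChk_ok : pairChk = true := by decide +kernel

noncomputable def powChk : Bool := allLt (fun c => beqB (isPow c) (Nat.beq (cnt c) 1)) 2048

theorem powChk_ok : powChk = true := by decide +kernel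

noncomputable def smChk : Bool :=
  allLt (fun v => frc (Sm v) fun S => frc (Sw v) fun W => allLt (fun s => frc (tcode s) fun c =>
    ite' (beqB (tb S s) (tb c v)) (beqB (tb W c) (tb c v)) false) 165) 11

theorem smChk_ok : smChk = true := by decide +kernel

noncomputable def tabChk : Bool :=
  allLt (fun t => frc (tcode t) fun c => ite' (Nat.beq (cnt c) 3)
   (allLt (fun s => ite' (Nat.beq (tcode s) c) false true) t) false) 165

theorem tabChk_ok : tabChk = true := by decide +kernel

/-- the vertex labels of the `t`-th triple -/
noncomputable def verts (t : ℕ) : Finset ℕ := (range 11).filter fun v => (tcode t).testBit v = true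


/-- the set of bits below eleven -/
def bits (c : ℕ) : Finset ℕ := (range 11).filter fun v => c.testBit v = true

theorem cnt_eq (c : ℕ) : cnt c = (bits c).card := by
  have key : ∀ m, @Nat.rec (fun _ => ℕ) 0
      (fun v ih => Nat.add ih (Nat.land (Nat.shiftRight c v) 1)) m =
      ((range m).filter fun v => c.testBit v = true).card := by
    intro m
    induction m with
    | zero => rfl
    | succ m ih =>
      have e : (@Nat.rec (fun _ => ℕ) 0
        (fun v ih => Nat.add ih (Nat.land (Nat.shiftRight c v) 1)) (m + 1) : ℕ) =
        (@Nat.rec (fun _ => ℕ) 0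
        (fun v ih => Nat.add ih (Nat.land (Nat.shiftRight c v) 1)) m : ℕ) + (c >>> m &&& 1) := rfl
      rw [e, ih, range_add_one, filter_insert]
      have hb : c.testBit m = (c >>> m &&& 1 != 0) := by rw [Nat.testBit, Nat.and_comm]
      rw [Nat.and_one_is_mod] at *
      rcases Nat.mod_two_eq_zero_or_one (c >>> m) with h | h <;> simp [hb, h]
  exact key 11

theorem bits_land (c d : ℕ) : bits (c &&& d) = bits c ∩ bits d := by
  ext v; simp [bits, Nat.testBit_and]; tauto

theorem bits_empty {c : ℕ} (hc : c < 2048) : bits c = ∅ ↔ c = 0 := by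
  constructor
  · intro h
    apply Nat.eq_of_testBit_eq
    intro i
    rw [Nat.zero_testBit]
    by_cases hi : i < 11
    · by_contra hb
      have : i ∈ bits c := by simp [bits, hi]; simpa using hb
      rw [h] at this; simp at this
    · exact Nat.testBit_lt_two_pow (lt_of_lt_of_le hc (by
        calc 2048 = 2 ^ 11 := by norm_num
          _ ≤ 2 ^ i := Nat.pow_le_pow_right (by norm_num) (by omega)))
  · rintro rfl; simp [bits]

theorem tcode_lt (t : ℕ) : tcode t < 2048 := by
  show (_ &&& 2047) < 2048
  exact Nat.lt_succ_of_le Nat.and_le_right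

theorem verts_eq (t : ℕ) : verts t = bits (tcode t) := rfl

theorem isPow_spec {c : ℕ} (hc : c < 2048) : isPow c = decide ((bits c).card = 1) := by
  have h := beqB_spec (allLt_spec powChk_ok c hc)
  rw [h, cnt_eq, ← Bool.coe_iff_coe]
  simp

/-- triples `a` and `b` intersect -/
def mtt (a b : ℕ) : Prop := (verts a ∩ verts b).Nonempty

theorem mtt_comm (a b : ℕ) : mtt a b ↔ mtt b a := by unfold mtt; rw [inter_comm]

theorem land_lt (a b : ℕ) : tcode a &&& tcode b < 2048 :=
  lt_of_le_of_lt Nat.and_le_left (tcode_lt a)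

theorem land_ne (a b : ℕ) : tcode a &&& tcode b ≠ 0 ↔ mtt a b := by
  rw [mtt, verts_eq, verts_eq, ← bits_land, nonempty_iff_ne_empty, Ne, Ne,
    bits_empty (land_lt a b)]

theorem meets_mtt (a b : ℕ) : meets (edOf a).c (edOf b).c = true ↔ mtt a b := by
  rw [edOf_c, edOf_c, meets_eq, decide_eq_true_iff, land_ne]

theorem pow_mtt (a b : ℕ) : isPow (Nat.land (edOf a).c (edOf b).c) = true ↔
    (verts a ∩ verts b).card = 1 := by
  rw [edOf_c, edOf_c]
  show isPow (tcode a &&& tcode b) = true ↔ _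
  rw [isPow_spec (land_lt a b), decide_eq_true_iff, bits_land]; rfl

theorem edOf_NM {t s : ℕ} (ht : t < 165) (hs : s < 165) :
    ((edOf t).N.testBit s = true ↔ mtt t s) ∧
    ((edOf t).M.testBit s = true ↔ 2 ≤ (verts t ∩ verts s).card) := by
  have h := allLt_spec pairChk_ok t ht
  rw [mkEd_eq] at h
  have h := allLt_spec h s hs
  rw [frc_eq, ite'_eq] at h
  split at h
  · rename_i h1
    have h1 := beqB_spec h1
    have h2 := beqB_spec h
    rw [tb_eq] at h1 h2
    have hl : Nat.land (edOf t).c (tcode s) = tcode t &&& tcode s := by rw [edOf_c]; rfl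
    rw [hl] at h1 h2
    simp only [ite'_eq, isPow_spec (land_lt t s)] at h1 h2
    rw [h1, h2]
    have hb : Nat.beq (tcode t &&& tcode s) 0 = true ↔ tcode t &&& tcode s = 0 := Nat.beq_eq ▸ Iff.rfl
    have hn := land_ne t s
    have he : verts t ∩ verts s = ∅ ↔ ¬ mtt t s := by rw [mtt, not_nonempty_iff_eq_empty]
    by_cases h0 : tcode t &&& tcode s = 0
    · have : ¬ mtt t s := by rw [← hn]; simpa using h0
      rw [if_pos (hb.2 h0), if_pos (hb.2 h0), he.2 this]
      simp [this]
    · have hm : mtt t s := hn.1 h0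
      have hpos : 0 < (verts t ∩ verts s).card := card_pos.2 hm
      rw [if_neg (fun h => h0 (hb.1 h)), if_neg (fun h => h0 (hb.1 h)), bits_land]
      rw [← verts_eq, ← verts_eq]
      simp only [hm, decide_eq_true_eq, true_and]
      split <;> simp <;> omega
  · cases h

theorem verts_card {t : ℕ} (ht : t < 165) : (verts t).card = 3 := by
  have h := allLt_spec tabChk_ok t ht
  rw [frc_eq, ite'_eq] at h
  split at h
  · rename_i h1
    rw [cnt_eq] at h1
    exact Nat.eq_of_beq_eq_true h1
  · cases h

theorem verts_sub (t : ℕ) : verts t ⊆ range 11 := filter_subset _ _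

theorem tcode_inj {s t : ℕ} (hs : s < 165) (ht : t < 165) (h : tcode s = tcode t) : s = t := by
  have key : ∀ s t, t < 165 → s < t → tcode s ≠ tcode t := by
    intro s t ht hst he
    have h := allLt_spec tabChk_ok t ht
    rw [frc_eq, ite'_eq] at h
    split at h
    · have h := allLt_spec h s hst
      rw [ite'_eq, he] at h
      simp at h
    · cases h
  rcases lt_trichotomy s t with h1 | h1 | h1
  · exact absurd h (key s t ht h1)
  · exact h1
  · exact absurd h.symm (key t s hs h1)

theorem verts_inj {s t : ℕ} (hs : s < 165) (ht : t < 165) (h : verts s = verts t) : s = t := by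
  apply tcode_inj hs ht
  apply Nat.eq_of_testBit_eq
  intro i
  by_cases hi : i < 11
  · have := Finset.ext_iff.1 h i
    simp only [verts, mem_filter, mem_range, hi, true_and] at this
    exact Bool.eq_iff_iff.2 this
  · have hp : (2048:ℕ) ≤ 2 ^ i := by
      calc 2048 = 2 ^ 11 := by norm_num
          _ ≤ 2 ^ i := Nat.pow_le_pow_right (by norm_num) (by omega)
    rw [Nat.testBit_lt_two_pow (lt_of_lt_of_le (tcode_lt s) hp),
      Nat.testBit_lt_two_pow (lt_of_lt_of_le (tcode_lt t) hp)]

theorem verts_surj {s : Finset ℕ} (hs : s ⊆ range 11) (hc : s.card = 3) :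
    ∃ t < 165, verts t = s := by
  have h : (range 165).image verts = (range 11).powersetCard 3 := by
    apply eq_of_subset_of_card_le
    · intro x hx
      obtain ⟨t, ht, rfl⟩ := mem_image.1 hx
      exact mem_powersetCard.2 ⟨verts_sub t, verts_card (mem_range.1 ht)⟩
    · rw [card_powersetCard, card_image_of_injOn]
      · simp; decide
      · intro a ha b hb h
        exact verts_inj (by simpa using ha) (by simpa using hb) h
  have : s ∈ (range 165).image verts := by rw [h]; exact mem_powersetCard.2 ⟨hs, hc⟩
  obtain ⟨t, ht, rfl⟩ := mem_image.1 this
  exact ⟨t, mem_range.1 ht, rfl⟩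

theorem Sm_spec {v s : ℕ} (hv : v < 11) (hs : s < 165) :
    ((Sm v).testBit s = true ↔ v ∈ verts s) ∧ ((Sw v).testBit (tcode s) = true ↔ v ∈ verts s) := by
  have h := allLt_spec smChk_ok v hv
  rw [frc_eq, frc_eq] at h
  have h := allLt_spec h s hs
  rw [frc_eq, ite'_eq] at h
  have hm : v ∈ verts s ↔ (tcode s).testBit v = true := by simp [verts, hv]
  split at h
  · rename_i h1
    have h1 := beqB_spec h1
    have h2 := beqB_spec h
    simp only [tb_eq] at h1 h2
    rw [h1, h2, hm]; exact ⟨Iff.rfl, Iff.rfl⟩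
  · cases h

noncomputable def rangeChk (n m : ℕ) : Bool :=
  allLt (fun t => beqB (Nat.ble m t) (Nat.ble (Nat.pow 2 n) (tcode t))) 165

theorem range_spec {n m : ℕ} (h : rangeChk n m = true) {t : ℕ} (ht : t < 165) :
    t < m ↔ verts t ⊆ range n := by
  have h := beqB_spec (allLt_spec h t ht)
  have h1 : m ≤ t ↔ 2 ^ n ≤ tcode t := by
    rw [← Nat.ble_eq, ← Nat.ble_eq, h]; rfl
  rw [← not_le, h1, not_le]
  constructor
  · intro hlt v hv
    rw [mem_range]
    by_contra hvn
    have := Nat.testBit_lt_two_pow (lt_of_lt_of_le hlt (Nat.pow_le_pow_right (by norm_num) (not_lt.1 hvn)))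
    simp [verts, this] at hv
  · intro hsub
    apply Nat.lt_pow_two_of_testBit
    intro i hi
    by_contra hb
    have hb : (tcode t).testBit i = true := by simpa using hb
    have hi11 : i < 11 := by
      by_contra hi11
      have := Nat.testBit_lt_two_pow (lt_of_lt_of_le (tcode_lt t) (by
        calc 2048 = 2 ^ 11 := by norm_num
          _ ≤ 2 ^ i := Nat.pow_le_pow_right (by norm_num) (by omega)))
      rw [this] at hb; cases hb
    have : i ∈ verts t := by simp [verts, hi11, hb]
    have := mem_range.1 (hsub this)
    omega
theorem rangeChk9 : rangeChk 9 84 = true := by decide +kernel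
theorem rangeChk10 : rangeChk 10 120 = true := by decide +kernel
theorem rangeChk11 : rangeChk 11 165 = true := by decide +kernel


/-- `1 + 256 + ... ` with `r` terms -/
def mk8 (r : ℕ) : ℕ := r.rec 0 fun _ ih => 1 + 256 * ih

theorem mk8_succ (r : ℕ) : mk8 (r + 1) = 1 + 256 * mk8 r := rfl

theorem land_mk8 (r : ℕ) : ∀ x : ℕ, (x &&& mk8 r) % 255 =
    (((range r).filter fun i => x.testBit (8 * i) = true).card) % 255 := by
  induction r with
  | zero => intro x; simp [mk8]
  | succ r ih =>
    intro x
    have h1 : x &&& mk8 (r + 1) = 256 * ((x >>> 8) &&& mk8 r) + (x &&& 1) := by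
      have e1 : x = 256 * (x >>> 8) + x % 256 := by
        rw [Nat.shiftRight_eq_div_pow]; omega
      have e2 : mk8 (r + 1) = 2 ^ 8 * mk8 r + 1 := by rw [mk8_succ]; ring
      apply Nat.eq_of_testBit_eq
      intro i
      have hx1 : x &&& 1 < 2 ^ 8 := lt_of_le_of_lt Nat.and_le_right (by norm_num)
      rw [show (256:ℕ) = 2 ^ 8 from rfl, Nat.testBit_two_pow_mul_add _ hx1, Nat.testBit_and, e2,
        Nat.testBit_two_pow_mul_add _ (by norm_num : 1 < 2 ^ 8)]
      split
      · rw [Nat.testBit_and]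
      · rename_i hi
        rw [Nat.testBit_and, Nat.testBit_shiftRight, show 8 + (i - 8) = i by omega]
    have h2 : ((range (r + 1)).filter fun i => x.testBit (8 * i) = true).card =
        ((range r).filter fun i => (x >>> 8).testBit (8 * i) = true).card + (x &&& 1) := by
      rw [card_filter, card_filter, sum_range_succ']
      congr 1
      · apply sum_congr rfl
        intro i _
        rw [Nat.testBit_shiftRight, show 8 * (i + 1) = 8 + 8 * i by ring]
      · rw [Nat.and_one_is_mod]
        rcases Nat.mod_two_eq_zero_or_one x with h | h <;> simp [Nat.testBit_zero, h]
    rw [h1, h2]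
    have := ih (x >>> 8)
    omega

theorem pc_eq (A : ℕ) : pc A = ((range 168).filter fun t => A.testBit t = true).card := by
  have e : pc A = ((0 + (A >>> 0 &&& mk8 21) + (A >>> 1 &&& mk8 21) + (A >>> 2 &&& mk8 21) +
    (A >>> 3 &&& mk8 21) + (A >>> 4 &&& mk8 21) + (A >>> 5 &&& mk8 21) + (A >>> 6 &&& mk8 21) +
    (A >>> 7 &&& mk8 21))) % 255 := rfl
  have hsum : ((range 168).filter fun t => A.testBit t = true).card =
      ∑ j ∈ range 8, ((range 21).filter fun i => (A >>> j).testBit (8 * i) = true).card := by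
    simp only [card_filter, Nat.testBit_shiftRight]
    rw [← sum_product', eq_comm]
    apply sum_nbij' (fun p => p.1 + 8 * p.2) (fun t => (t % 8, t / 8))
    · intro p hp; simp only [mem_product, mem_range] at hp ⊢; omega
    · intro p hp; simp only [mem_product, mem_range] at hp ⊢; omega
    · intro p hp; simp only [mem_product, mem_range] at hp ⊢
      ext <;> simp <;> omega
    · intro p hp; simp only [mem_range] at hp ⊢; omega
    · intro p hp; rfl
  have hle : ((range 168).filter fun t => A.testBit t = true).card ≤ 168 :=
    (card_filter_le _ _).trans (by simp)
  rw [hsum] at hle ⊢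
  simp only [sum_range_succ, range_zero, sum_empty] at hle ⊢
  rw [e]
  have h := fun j => land_mk8 21 (A >>> j)
  have h0 := h 0; have h1 := h 1; have h2 := h 2; have h3 := h 3
  have h4 := h 4; have h5 := h 5; have h6 := h 6; have h7 := h 7
  clear h hsum e
  omega

theorem card_le_pc {T : Finset ℕ} {A : ℕ} (h : ∀ t ∈ T, t < 165 ∧ A.testBit t = true) :
    T.card ≤ pc A := by
  rw [pc_eq]
  apply card_le_card
  intro t ht
  have := h t ht
  simp only [mem_filter, mem_range]
  exact ⟨by omega, this.2⟩

theorem popLt_spec {T : Finset ℕ} {A k : ℕ} (h : ∀ t ∈ T, t < 165 ∧ A.testBit t = true)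
    (hp : popLt k A = true) : T.card < k :=
  lt_of_le_of_lt (card_le_pc h) (Nat.le_of_ble_eq_true hp)

/-- soundness of a propagation rule -/
def FbOK (fb : Ed → List Ed → ℕ) (T : Finset ℕ) : Prop :=
  ∀ (e : ℕ) (L : List ℕ) (s : ℕ), e ∈ T → (∀ f ∈ L, f ∈ T) → s ∈ T →
    (fb (edOf e) (L.map edOf)).testBit s = false

/-- no minimal 4-path -/
def NoP (T : Finset ℕ) : Prop := ∀ a ∈ T, ∀ b ∈ T, ∀ c ∈ T, ∀ d ∈ T,
  mtt a b → mtt b c → mtt c d → ¬ mtt a c → ¬ mtt a d → ¬ mtt b d → False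

/-- no path whose first two edges share two vertices -/
def NoI (T : Finset ℕ) : Prop := ∀ a ∈ T, ∀ b ∈ T, ∀ c ∈ T,
  2 ≤ (verts a ∩ verts b).card → mtt b c → mtt a c

/-- intersecting is transitive -/
def NoT (T : Finset ℕ) : Prop := ∀ a ∈ T, ∀ b ∈ T, ∀ c ∈ T, mtt a b → mtt b c → mtt a c

theorem lor_tb (a b i : ℕ) : (Nat.lor a b).testBit i = (a.testBit i || b.testBit i) :=
  Nat.testBit_or a b i
theorem land_tb (a b i : ℕ) : (Nat.land a b).testBit i = (a.testBit i && b.testBit i) :=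
  Nat.testBit_and a b i
theorem xor_tb (a b i : ℕ) : (Nat.xor a b).testBit i = (a.testBit i ^^ b.testBit i) :=
  Nat.testBit_xor a b i

theorem edN {t s : ℕ} (ht : t < 165) (hs : s < 165) :
    (edOf t).N.testBit s = true ↔ mtt t s := (edOf_NM ht hs).1

theorem edM {t s : ℕ} (ht : t < 165) (hs : s < 165) :
    (edOf t).M.testBit s = true ↔ 2 ≤ (verts t ∩ verts s).card := (edOf_NM ht hs).2

theorem trip_ok {T : Finset ℕ} (hlt : ∀ t ∈ T, t < 165) (hP : NoP T) {e f g s : ℕ}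
    (he : e ∈ T) (hf : f ∈ T) (hg : g ∈ T) (hs : s ∈ T) :
    (trip (edOf e) (edOf f) (edOf g)).testBit s = false := by
  classical
  rw [← Bool.not_eq_true]
  intro h
  have le := edN (hlt e he) (hlt s hs)
  have lf := edN (hlt f hf) (hlt s hs)
  have lg := edN (hlt g hg) (hlt s hs)
  have cef := mtt_comm e f
  have ceg := mtt_comm e g
  have cfg := mtt_comm f g
  have ces := mtt_comm e s
  have cfs := mtt_comm f s
  have cgs := mtt_comm g s
  unfold trip at h
  simp only [ite'_eq, meets_mtt] at h
  have p1 := hP f hf e he g hg s hs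
  have p2 := hP g hg e he f hf s hs
  have p3 := hP e he f hf g hg s hs
  have p4 := hP g hg f hf e he s hs
  have p5 := hP e he g hg f hf s hs
  have p6 := hP f hf g hg e he s hs
  have q1 := hP e he f hf s hs g hg
  have q2 := hP f hf e he s hs g hg
  have q3 := hP e he g hg s hs f hf
  have q4 := hP g hg e he s hs f hf
  have q5 := hP f hf g hg s hs e he
  have q6 := hP g hg f hf s hs e he
  by_cases a1 : mtt e f <;> by_cases a2 : mtt e g <;> by_cases a3 : mtt f g <;>
    simp only [a1, a2, a3, if_true, if_false] at h <;>
    simp only [dif_testBit, land_tb, xor_tb, Nat.zero_testBit] at h <;>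
    cases b1 : (edOf e).N.testBit s <;> cases b2 : (edOf f).N.testBit s <;>
    cases b3 : (edOf g).N.testBit s <;> simp only [b1, b2, b3] at h le lf lg <;>
    simp at h <;> grind only

theorem fbP_cons (E f : Ed) (L : List Ed) : fbP E (f :: L) =
    Nat.lor (fbP E L) (@List.rec Ed (fun _ => ℕ) 0 (fun g _ ih2 => Nat.lor ih2 (trip E f g)) L) :=
  rfl

theorem fbP_ok {T : Finset ℕ} (hlt : ∀ t ∈ T, t < 165) (hP : NoP T) : FbOK fbP T := by
  intro e L s he hL hs
  induction L with
  | nil => exact Nat.zero_testBit s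
  | cons f L ih =>
    have hf := hL f (by simp)
    have hL' : ∀ g ∈ L, g ∈ T := fun g hg => hL g (by simp [hg])
    rw [List.map_cons, fbP_cons, lor_tb, ih hL', Bool.false_or]
    clear ih hL
    induction L with
    | nil => exact Nat.zero_testBit s
    | cons g L ih =>
      have : ∀ L : List Ed, (@List.rec Ed (fun _ => ℕ) 0
        (fun g _ ih2 => Nat.lor ih2 (trip (edOf e) (edOf f) g)) (edOf g :: L) : ℕ) =
        Nat.lor (@List.rec Ed (fun _ => ℕ) 0
        (fun g _ ih2 => Nat.lor ih2 (trip (edOf e) (edOf f) g)) L) (trip (edOf e) (edOf f) (edOf g)) :=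
        fun _ => rfl
      rw [List.map_cons, this, lor_tb, ih (fun g hg => hL' g (by simp [hg])), Bool.false_or]
      exact trip_ok hlt hP he hf (hL' g (by simp)) hs

theorem pairfb_ok {T : Finset ℕ} (p : Ed → Ed → ℕ)
    (hp : ∀ e ∈ T, ∀ f ∈ T, ∀ s ∈ T, (p (edOf e) (edOf f)).testBit s = false) :
    FbOK (fun e L => @List.rec Ed (fun _ => ℕ) 0 (fun f _ ih => Nat.lor ih (p e f)) L) T := by
  intro e L s he hL hs
  induction L with
  | nil => exact Nat.zero_testBit s
  | cons f L ih =>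
    have := ih (fun g hg => hL g (by simp [hg]))
    show (Nat.lor _ (p (edOf e) (edOf f))).testBit s = false
    rw [lor_tb, hp e he f (hL f (by simp)) s hs, Bool.or_false]
    exact this

theorem fbT_ok {T : Finset ℕ} (hlt : ∀ t ∈ T, t < 165) (hT : NoT T) : FbOK fbT T := by
  refine pairfb_ok pairT ?_
  intro e he f hf s hs
  classical
  rw [← Bool.not_eq_true]
  intro h
  have le := edN (hlt e he) (hlt s hs)
  have lf := edN (hlt f hf) (hlt s hs)
  have cef := mtt_comm e f
  have ces := mtt_comm e s
  have cfs := mtt_comm f s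
  have p1 := hT e he f hf s hs
  have p2 := hT f hf e he s hs
  have p3 := hT e he s hs f hf
  unfold pairT at h
  simp only [ite'_eq, meets_mtt] at h
  by_cases a1 : mtt e f <;> 
    simp only [a1, if_true, if_false] at h <;>
    simp only [land_tb, xor_tb] at h <;>
    cases b1 : (edOf e).N.testBit s <;> cases b2 : (edOf f).N.testBit s <;>
    simp only [b1, b2] at h le lf <;>
    simp at h <;> grind only

theorem pairI_ok {T : Finset ℕ} (hlt : ∀ t ∈ T, t < 165) (hI : NoI T) :
    ∀ e ∈ T, ∀ f ∈ T, ∀ s ∈ T, (pairI (edOf e) (edOf f)).testBit s = false := by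
  intro e he f hf s hs
  classical
  rw [← Bool.not_eq_true]
  intro h
  have le := edN (hlt e he) (hlt s hs)
  have lf := edN (hlt f hf) (hlt s hs)
  have me := edM (hlt e he) (hlt s hs)
  have mf := edM (hlt f hf) (hlt s hs)
  have cef := mtt_comm e f
  have ces := mtt_comm e s
  have cfs := mtt_comm f s
  have p1 := hI e he f hf s hs
  have p2 := hI f hf e he s hs
  have p3 := hI e he s hs f hf
  have p4 := hI s hs e he f hf
  have p5 := hI f hf s hs e he
  have p6 := hI s hs f hf e he
  rw [inter_comm (verts s)] at p4 p6
  rw [inter_comm (verts f) (verts e)] at p2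
  unfold pairI at h
  simp only [ite'_eq, meets_mtt, pow_mtt] at h
  by_cases a1 : mtt e f
  · have hpos : 0 < (verts e ∩ verts f).card := card_pos.2 a1
    simp only [a1, if_true] at h
    split at h
    · simp only [lor_tb, dif_testBit, Bool.or_eq_true, Bool.and_eq_true, Bool.not_eq_true',
        ← Bool.not_eq_true, le, lf, me, mf] at h
      grind only
    · have h2 : 2 ≤ (verts e ∩ verts f).card := by omega
      simp only [xor_tb] at h
      cases b1 : (edOf e).N.testBit s <;> cases b2 : (edOf f).N.testBit s <;>
      simp only [b1, b2] at h le lf <;>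
      simp at h <;> grind only
  · simp only [a1, if_false] at h
    simp only [lor_tb, land_tb, Bool.or_eq_true, Bool.and_eq_true, le, lf, me, mf] at h
    grind only

theorem fbI_ok {T : Finset ℕ} (hlt : ∀ t ∈ T, t < 165) (hP : NoP T) (hI : NoI T) : FbOK fbI T := by
  intro e L s he hL hs
  have h1 := fbP_ok hlt hP e L s he hL hs
  have h2 := pairfb_ok pairI (pairI_ok hlt hI) e L s he hL hs
  unfold fbI
  rw [lor_tb, h1, Bool.false_or]
  exact h2


/-- what the search refutes -/
structure Good (n K : ℕ) (T : Finset ℕ) : Prop where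
  lt : ∀ t ∈ T, t < 165
  card : K ≤ T.card
  star : ∀ v < n, 2 ≤ (T.filter fun t => v ∉ verts t).card
  nonSP : ∀ v < n, ∀ f ∈ T, ∀ g ∈ T, v ∉ verts f → v ∉ verts g → (verts f ∩ verts g).card = 1 →
    ∃ e ∈ T, e ≠ f ∧ e ≠ g ∧ ¬ (v ∈ verts e ∧ (mtt f e ∨ mtt g e))

theorem beq_zero_tb {x : ℕ} (h : Nat.beq x 0 = true) (i : ℕ) : x.testBit i = false := by
  rw [Nat.eq_of_beq_eq_true h, Nat.zero_testBit]

theorem spLeaf_ok {n K : ℕ} (hn : n ≤ 11) {T : Finset ℕ} (hT : Good n K T) {A v f g : ℕ} (hv : v < n)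
    (hA : ∀ t ∈ T, A.testBit t = true) (h : spLeaf A v f g = true) : False := by
  unfold spLeaf at h
  rw [frc_eq, ite'_eq] at h
  split at h
  · rename_i h1
    rw [mkEd_eq, mkEd_eq, ite'_eq] at h
    split at h
    · rename_i h2
      rw [pow_mtt] at h2
      have hout : ∀ t ∈ T, v ∉ verts t → t = f ∨ t = g := by
        intro t ht hvt
        have := beq_zero_tb h1 t
        have hS := (Sm_spec (by omega : v < 11) (hT.lt t ht)).1
        rw [← hS] at hvt
        rw [dif_testBit, dif_testBit, hA t ht, lor_tb] at this
        have e1 : (Nat.pow 2 f).testBit t = decide (f = t) := Nat.testBit_two_pow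
        have e2 : (Nat.pow 2 g).testBit t = decide (g = t) := Nat.testBit_two_pow
        rw [e1, e2] at this
        simp only [Bool.not_eq_true] at hvt
        simp [hvt] at this
        omega
      have hsub : (T.filter fun t => v ∉ verts t) ⊆ {f, g} := by
        intro t ht
        rw [mem_filter] at ht
        simpa using hout t ht.1 ht.2
      have h2c := hT.star v hv
      have heq : (T.filter fun t => v ∉ verts t) = {f, g} :=
        eq_of_subset_of_card_le hsub (card_le_two.trans h2c)
      have hf : f ∈ T.filter fun t => v ∉ verts t := by rw [heq]; simp
      have hg : g ∈ T.filter fun t => v ∉ verts t := by rw [heq]; simp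
      rw [mem_filter] at hf hg
      obtain ⟨e, he, hef, heg, hne⟩ := hT.nonSP v hv f hf.1 g hg.1 hf.2 hg.2 h2
      apply hne
      have hve : v ∈ verts e := by
        by_contra hve
        rcases hout e he hve with h | h
        · exact hef h
        · exact heg h
      refine ⟨hve, ?_⟩
      have hS := (Sm_spec (by omega : v < 11) (hT.lt e he)).1.2 hve
      have := beq_zero_tb h e
      rw [dif_testBit, dif_testBit, land_tb, hA e he, hS] at this
      rw [← edN (hT.lt f hf.1) (hT.lt e he), ← edN (hT.lt g hg.1) (hT.lt e he)]
      cases h3 : (edOf f).N.testBit e <;> cases h4 : (edOf g).N.testBit e <;> simp [h3, h4] at this ⊢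
    · cases h
  · cases h

theorem run_ok {n K : ℕ} (hn : n ≤ 11) {fb : Ed → List Ed → ℕ} {T : Finset ℕ} (hT : Good n K T)
    (hfb : FbOK fb T) (fuel : ℕ) : ∀ (L : List ℕ) (A h : ℕ), (∀ t ∈ L, t ∈ T) →
    (∀ t ∈ T, A.testBit t = true) → run n K fb fuel (L.map edOf) A h = 0 := by
  induction fuel with
  | zero => intro L A h _ _; rfl
  | succ fuel ih =>
    intro L A h hL hA
    have e : run n K fb (fuel + 1) (L.map edOf) A h =
      frc (Nat.mod h 256) fun t => frc (Nat.div h 256) fun h' =>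
      ite' (Nat.ble t 199)
        (mkEd t fun E =>
          frc (dif A (fb E (L.map edOf))) fun A' =>
          frc (run n K fb fuel (E :: L.map edOf) A' h') fun h'' =>
          ite' (Nat.beq h'' 0) 0 (frc (rm A t) fun A'' => run n K fb fuel (L.map edOf) A'' h''))
        (ite' (Nat.beq t 200) (ite' (popLt K A) h' 0)
          (ite' (Nat.ble t 220)
            (ite' (Nat.ble n (Nat.sub t 201)) 0
              (ite' (popLt 2 (dif A (Sm (Nat.sub t 201)))) h' 0))
            (ite' (Nat.ble n (Nat.sub t 221)) 0
              (ite' (spLeaf A (Nat.sub t 221) (Nat.mod h' 256) (Nat.mod (Nat.div h' 256) 256))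
                (Nat.div h' 65536) 0)))) := rfl
    rw [e]
    simp only [frc_eq, ite'_eq, mkEd_eq]
    generalize Nat.mod h 256 = t
    generalize Nat.div h 256 = h'
    have hlt : ∀ v, ¬ Nat.ble n v = true → v < n := by
      intro v hv
      by_contra hc
      exact hv (Nat.ble_eq_true_of_le (not_lt.1 hc))
    split
    · split
      · rfl
      · rename_i h0
        by_cases ht : t ∈ T
        · exfalso
          apply h0
          have := ih (t :: L) (dif A (fb (edOf t) (L.map edOf))) h' ?_ ?_
          · rw [List.map_cons] at this
            rw [this]; rfl
          · intro s hs
            rcases List.mem_cons.1 hs with rfl | hs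
            · exact ht
            · exact hL s hs
          · intro s hs
            rw [dif_testBit, hA s hs, hfb t L s ht hL hs]; rfl
        · apply ih _ _ _ hL
          intro s hs
          rw [rm_testBit, hA s hs]
          simp only [Bool.true_and, Bool.not_eq_true', decide_eq_false_iff_not]
          rintro rfl; exact ht hs
    · split
      · split
        · rename_i hp
          have := popLt_spec (fun t ht => ⟨hT.lt t ht, hA t ht⟩) hp
          have := hT.card
          omega
        · rfl
      · split
        · split
          · rfl
          · rename_i hv
            have hv := hlt _ hv
            split
            · rename_i hp
              have := hT.star _ hv
              have h2 : (T.filter fun s => Nat.sub t 201 ∉ verts s).card < 2 := by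
                refine popLt_spec ?_ hp
                intro s hs
                rw [mem_filter] at hs
                refine ⟨hT.lt s hs.1, ?_⟩
                have hS := (Sm_spec (by omega : Nat.sub t 201 < 11) (hT.lt s hs.1)).1
                rw [dif_testBit, hA s hs.1]
                have := hs.2
                rw [← hS, Bool.not_eq_true] at this
                rw [this]; rfl
              omega
            · rfl
        · split
          · rfl
          · rename_i hv
            have hv := hlt _ hv
            split
            · rename_i hp
              exact (spLeaf_ok hn hT hv hA hp).elim
            · rfl

theorem sum_bits (c m : ℕ) :
    c % 2 ^ m = ∑ v ∈ (range m).filter (fun v => c.testBit v = true), 2 ^ v := by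
  induction m with
  | zero => simp [Nat.mod_one]
  | succ m ih =>
    rw [Nat.mod_pow_succ, ih, range_add_one, filter_insert]
    rw [Nat.testBit_eq_decide_div_mod_eq]
    rcases Nat.mod_two_eq_zero_or_one (c / 2 ^ m) with h | h
    · simp [h]
    · simp only [h, decide_true, if_true]
      rw [sum_insert (by simp)]
      simp [add_comm]

theorem tcode_sum (t : ℕ) : tcode t = ∑ v ∈ verts t, 2 ^ v := by
  have h := sum_bits (tcode t) 11
  rw [Nat.mod_eq_of_lt (show tcode t < 2 ^ 11 from tcode_lt t)] at h
  exact h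

/-- transport of the vertex set of a triple -/
def Swp (x y t t' : ℕ) : Prop := verts t' = (verts t).image (Equiv.swap x y)

theorem swp_exists {x y t : ℕ} (hx : x < 11) (hy : y < 11) (ht : t < 165) :
    ∃ t' < 165, Swp x y t t' := by
  apply verts_surj
  · intro v hv
    obtain ⟨w, hw, rfl⟩ := mem_image.1 hv
    have := mem_range.1 (verts_sub t hw)
    rw [mem_range, Equiv.swap_apply_def]
    split_ifs <;> omega
  · rw [card_image_of_injective _ (Equiv.injective _), verts_card ht]

theorem swp_code {x y t t' : ℕ} (hx : x ∈ verts t) (hy : y ∉ verts t) (h : Swp x y t t') :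
    tcode t' + 2 ^ x = tcode t + 2 ^ y := by
  have hi : (verts t).image (Equiv.swap x y) = insert y ((verts t).erase x) := by
    ext v
    simp only [mem_image, mem_insert, mem_erase]
    constructor
    · rintro ⟨w, hw, rfl⟩
      rw [Equiv.swap_apply_def]
      split_ifs with h1 h2
      · left; rfl
      · subst h2; exact absurd hw hy
      · right; exact ⟨h1, hw⟩
    · rintro (rfl | ⟨h1, h2⟩)
      · exact ⟨x, hx, Equiv.swap_apply_left x v⟩
      · refine ⟨v, h2, Equiv.swap_apply_of_ne_of_ne h1 ?_⟩
        rintro rfl; exact hy h2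
  rw [tcode_sum t', h, hi, sum_insert (by simp [hy]), tcode_sum t, ← add_sum_erase _ _ hx]
  ring

/-- every bit of `O` is the code of a dead triple -/
def DeadC (dead : ℕ → Prop) (O : ℕ) : Prop :=
  ∀ c, O.testBit c = true → ∃ t < 165, tcode t = c ∧ dead t

/-- `dead` is closed under a transposition -/
def ClosedU (dead : ℕ → Prop) (g : ℕ × ℕ) : Prop :=
  g.1 < g.2 ∧ g.2 < 11 ∧ ∀ t < 165, ∀ t' < 165, Swp g.1 g.2 t t' → dead t → dead t'

theorem swM_ok {dead : ℕ → Prop} {g : ℕ × ℕ} (hg : ClosedU dead g) {M : ℕ} (hM : DeadC dead M) :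
    DeadC dead (swM g.1 g.2 M) := by
  obtain ⟨x, y⟩ := g
  obtain ⟨hxy, hy, hcl⟩ := hg
  simp only at hxy hy hcl
  have hx : x < 11 := by omega
  have hpow : 2 ^ x < 2 ^ y := Nat.pow_lt_pow_right (by norm_num) hxy
  intro c hc
  unfold swM at hc
  rw [frc_eq, frc_eq, lor_tb, lor_tb, Bool.or_eq_true, Bool.or_eq_true] at hc
  rcases hc with hc | hc | hc
  · exact hM c hc
  · have hc : ((dif (Nat.land M (Sw x)) (Sw y)) <<< (2 ^ y - 2 ^ x)).testBit c = true := hc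
    rw [Nat.testBit_shiftLeft, Bool.and_eq_true, decide_eq_true_iff, dif_testBit, land_tb,
      Bool.and_eq_true, Bool.and_eq_true] at hc
    obtain ⟨hge, ⟨h1, h2⟩, h3⟩ := hc
    obtain ⟨t, ht, htc, htd⟩ := hM _ h1
    rw [← htc] at h2 h3
    have hxt := (Sm_spec hx ht).2.1 h2
    have hyt : y ∉ verts t := by
      rw [← (Sm_spec hy ht).2]; simpa using h3
    obtain ⟨t', ht', hsw⟩ := swp_exists hx hy ht
    have := swp_code hxt hyt hsw
    exact ⟨t', ht', by omega, hcl t ht t' ht' hsw htd⟩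
  · have hc : ((dif (Nat.land M (Sw y)) (Sw x)) >>> (2 ^ y - 2 ^ x)).testBit c = true := hc
    rw [Nat.testBit_shiftRight, dif_testBit, land_tb,
      Bool.and_eq_true, Bool.and_eq_true] at hc
    obtain ⟨⟨h1, h2⟩, h3⟩ := hc
    obtain ⟨t, ht, htc, htd⟩ := hM _ h1
    rw [← htc] at h2 h3
    have hyt := (Sm_spec hy ht).2.1 h2
    have hxt : x ∉ verts t := by
      rw [← (Sm_spec hx ht).2]; simpa using h3
    obtain ⟨t', ht', hsw⟩ := swp_exists hx hy ht
    have hsw' : Swp y x t t' := by unfold Swp; rw [Equiv.swap_comm]; exact hsw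
    have := swp_code hyt hxt hsw'
    exact ⟨t', ht', by omega, hcl t ht t' ht' hsw htd⟩

theorem sweep_ok {dead : ℕ → Prop} (gens : List (ℕ × ℕ)) (hg : ∀ g ∈ gens, ClosedU dead g) :
    ∀ M, DeadC dead M → DeadC dead (sweep gens M) := by
  induction gens with
  | nil => intro M hM; exact hM
  | cons g gens ih =>
    intro M hM
    have e : sweep (g :: gens) M = frc (swM g.1 g.2 M) (sweep gens) := rfl
    rw [e, frc_eq]
    exact ih (fun g' h => hg g' (by simp [h])) _ (swM_ok (hg g (by simp)) hM)

theorem orbit_ok {dead : ℕ → Prop} (gens : List (ℕ × ℕ)) (hg : ∀ g ∈ gens, ClosedU dead g) (r : ℕ) :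
    ∀ M, DeadC dead M → DeadC dead (orbit gens r M) := by
  induction r with
  | zero => intro M hM; exact hM
  | succ r ih =>
    intro M hM
    have e : orbit gens (r + 1) M = frc (sweep gens M) (orbit gens r) := rfl
    rw [e, frc_eq]
    exact ih _ (sweep_ok gens hg M hM)

theorem rmO_ok {O : ℕ} {T : Finset ℕ} (hO : ∀ t < 165, O.testBit (tcode t) = true → t ∉ T) {A : ℕ}
    (hA : ∀ t ∈ T, A.testBit t = true) : ∀ t ∈ T, (rmO O A).testBit t = true := by
  have key : ∀ m ≤ 165, ∀ A : ℕ, (∀ t ∈ T, A.testBit t = true) → ∀ t ∈ T,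
      (@Nat.rec (fun _ => ℕ → ℕ) (fun A => A)
    (fun t ih A => frc (ite' (tb O (tcode t)) (rm A t) A) ih) m A : ℕ).testBit t = true := by
    intro m
    induction m with
    | zero => intro _ A hA; exact hA
    | succ m ih =>
      intro hm A hA
      simp only [frc_eq] at ih ⊢
      apply ih (by omega)
      intro s hs
      rw [ite'_eq, tb_eq]
      split
      · rename_i h
        have := hO m (by omega) h
        rw [rm_testBit, hA s hs]
        simp only [Bool.true_and, Bool.not_eq_true', decide_eq_false_iff_not]
        rintro rfl; exact this hs
      · exact hA s hs
  exact key 165 le_rfl A hA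

/-- the hypotheses on a family of index sets -/
structure Fam (n K : ℕ) (fb : Ed → List Ed → ℕ) (gens : List (ℕ × ℕ)) (L : List ℕ)
    (F : Set (Finset ℕ)) : Prop where
  good : ∀ T ∈ F, Good n K T
  fbok : ∀ T ∈ F, FbOK fb T
  sub : ∀ T ∈ F, ∀ t ∈ L, t ∈ T
  closed : ∀ g ∈ gens, ClosedU (fun t => ∀ T ∈ F, t ∉ T) g

theorem steps_ok {n K : ℕ} (hn : n ≤ 11) {fb : Ed → List Ed → ℕ} {gens : List (ℕ × ℕ)} {L : List ℕ}
    {F : Set (Finset ℕ)} (hF : Fam n K fb gens L F) (S : List (ℕ × ℕ)) (hS : ∀ s ∈ S, s.1 < 165) :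
    ∀ A : ℕ, (∀ T ∈ F, ∀ t ∈ T, A.testBit t = true) →
    steps n K fb gens (L.map edOf) S A = true → ∀ T, T ∉ F := by
  induction S with
  | nil =>
    intro A hA h T hT
    have h : popLt K A = true := h
    have := popLt_spec (fun t ht => ⟨(hF.good T hT).lt t ht, hA T hT t ht⟩) h
    have := (hF.good T hT).card
    omega
  | cons s S ih =>
    intro A hA h
    have e : steps n K fb gens (L.map edOf) (s :: S) A = mkEd s.1 fun E =>
      frc (dif A (fb E (L.map edOf))) fun A' =>
      ite' (Nat.beq (run n K fb 200 (E :: L.map edOf) A' s.2) 1)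
        (frc (orbit gens 10 (Nat.pow 2 E.c)) fun O =>
          frc (rmO O A) (steps n K fb gens (L.map edOf) S)) false := rfl
    rw [e, mkEd_eq, frc_eq, ite'_eq] at h
    split at h
    · rename_i h1
      rw [frc_eq, frc_eq] at h
      refine ih (fun s' hs' => hS s' (by simp [hs'])) _ ?_ h
      have hdead : ∀ T ∈ F, s.1 ∉ T := by
        intro T hT hs
        have := run_ok hn (hF.good T hT) (hF.fbok T hT) 200 (s.1 :: L)
          (dif A (fb (edOf s.1) (L.map edOf))) s.2 ?_ ?_
        · rw [List.map_cons] at this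
          rw [this] at h1
          cases h1
        · intro t ht
          rcases List.mem_cons.1 ht with rfl | ht
          · exact hs
          · exact hF.sub T hT t ht
        · intro t ht
          rw [dif_testBit, hA T hT t ht, hF.fbok T hT s.1 L t hs (hF.sub T hT) ht]; rfl
      have hO : DeadC (fun t => ∀ T ∈ F, t ∉ T) (orbit gens 10 (Nat.pow 2 (edOf s.1).c)) := by
        apply orbit_ok gens hF.closed
        intro c hc
        have hc : (2 ^ (edOf s.1).c).testBit c = true := hc
        rw [Nat.testBit_two_pow, decide_eq_true_iff, edOf_c] at hc
        exact ⟨s.1, hS s (by simp), hc, hdead⟩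
      intro T hT
      apply rmO_ok _ (hA T hT)
      intro t ht hb
      obtain ⟨t', ht', he, hd⟩ := hO _ hb
      rw [← tcode_inj ht' ht he]
      exact hd T hT
    · cases h

theorem root_ok {n K : ℕ} (hn : n ≤ 11) {fb : Ed → List Ed → ℕ} {gens : List (ℕ × ℕ)}
    {F : Set (Finset ℕ)} (S : List (ℕ × ℕ)) (hS : ∀ s ∈ S, s.1 < 165) (R : List ℕ) :
    ∀ (L : List ℕ) (A : ℕ), Fam n K fb gens (R.reverse ++ L) F →
    (∀ T ∈ F, ∀ t ∈ T, A.testBit t = true) →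
    root n K fb gens S R (L.map edOf) A = true → ∀ T, T ∉ F := by
  induction R with
  | nil =>
    intro L A hF hA h
    exact steps_ok hn hF S hS A hA h
  | cons r R ih =>
    intro L A hF hA h
    have e : root n K fb gens S (r :: R) (L.map edOf) A =
      mkEd r fun E => frc (dif A (fb E (L.map edOf))) fun A' =>
        root n K fb gens S R (E :: L.map edOf) A' := rfl
    rw [e, mkEd_eq, frc_eq, ← List.map_cons] at h
    refine ih (r :: L) _ ?_ ?_ h
    · simpa using hF
    · intro T hT t ht
      rw [dif_testBit, hA T hT t ht, hF.fbok T hT r L t (hF.sub T hT r (by simp))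
        (fun f hf => hF.sub T hT f (by simp [hf])) ht]; rfl


/-- a labelling of `V` by `0, …, n-1` -/
structure Lab (n : ℕ) (V : Finset ℕ) (ψ : ℕ → ℕ) : Prop where
  inj : Set.InjOn ψ (range n)
  img : (range n).image ψ = V

/-- the triples (as indices) that become edges -/
noncomputable def TT (m : ℕ) (H : Finset (Finset ℕ)) (ψ : ℕ → ℕ) : Finset ℕ :=
  (range m).filter fun t => (verts t).image ψ ∈ H

theorem Lab.inter {n : ℕ} {V : Finset ℕ} {ψ : ℕ → ℕ} (h : Lab n V ψ) {A B : Finset ℕ}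
    (hA : A ⊆ range n) (hB : B ⊆ range n) : A.image ψ ∩ B.image ψ = (A ∩ B).image ψ := by
  ext w
  simp only [mem_inter, mem_image]
  constructor
  · rintro ⟨⟨a, ha, rfl⟩, b, hb, hab⟩
    have := h.inj (by exact_mod_cast hB hb) (by exact_mod_cast hA ha) hab
    subst this
    exact ⟨b, ⟨ha, hb⟩, rfl⟩
  · rintro ⟨a, ⟨ha, hb⟩, rfl⟩
    exact ⟨⟨a, ha, rfl⟩, a, hb, rfl⟩

theorem Lab.inter_card {n : ℕ} {V : Finset ℕ} {ψ : ℕ → ℕ} (h : Lab n V ψ) {A B : Finset ℕ}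
    (hA : A ⊆ range n) (hB : B ⊆ range n) :
    (A.image ψ ∩ B.image ψ).card = (A ∩ B).card := by
  rw [h.inter hA hB]
  apply card_image_of_injOn
  intro a ha b hb hab
  have ha : a ∈ A ∩ B := ha
  have hb : b ∈ A ∩ B := hb
  exact h.inj (by exact_mod_cast hA (mem_inter.1 ha).1) (by exact_mod_cast hA (mem_inter.1 hb).1) hab

theorem Lab.inter_ne {n : ℕ} {V : Finset ℕ} {ψ : ℕ → ℕ} (h : Lab n V ψ) {A B : Finset ℕ}
    (hA : A ⊆ range n) (hB : B ⊆ range n) :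
    (A.image ψ ∩ B.image ψ).Nonempty ↔ (A ∩ B).Nonempty := by
  rw [h.inter hA hB, image_nonempty]

theorem Lab.mem {n : ℕ} {V : Finset ℕ} {ψ : ℕ → ℕ} (h : Lab n V ψ) {A : Finset ℕ}
    (hA : A ⊆ range n) {v : ℕ} (hv : v < n) : ψ v ∈ A.image ψ ↔ v ∈ A := by
  constructor
  · intro hm
    obtain ⟨a, ha, hav⟩ := mem_image.1 hm
    rw [← h.inj (by exact_mod_cast hA ha) (by simpa using hv) hav]
    exact ha
  · exact fun hm => mem_image_of_mem _ hm

theorem Lab.surj {n m : ℕ} (hn : n ≤ 11) (hc : rangeChk n m = true) {V : Finset ℕ}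
    {H : Finset (Finset ℕ)} (hH : ThreeGraphOn V H) {ψ : ℕ → ℕ} (h : Lab n V ψ) {e : Finset ℕ}
    (he : e ∈ H) : ∃ t ∈ TT m H ψ, t < 165 ∧ (verts t).image ψ = e := by
  obtain ⟨heV, he3⟩ := hH e he
  have himg : ((range n).filter fun i => ψ i ∈ e).image ψ = e := by
    ext w
    simp only [mem_image, mem_filter]
    constructor
    · rintro ⟨i, ⟨_, hi⟩, rfl⟩; exact hi
    · intro hw
      have := heV hw
      rw [← h.img] at this
      obtain ⟨i, hi, rfl⟩ := mem_image.1 this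
      exact ⟨i, ⟨hi, hw⟩, rfl⟩
  have hsub : ((range n).filter fun i => ψ i ∈ e) ⊆ range n := filter_subset _ _
  have hcard : ((range n).filter fun i => ψ i ∈ e).card = 3 := by
    have := h.inter_card hsub hsub
    rw [himg, inter_self, inter_self] at this
    omega
  obtain ⟨t, ht, hvt⟩ := verts_surj (hsub.trans (range_subset_range.2 hn)) hcard
  refine ⟨t, ?_, ht, ?_⟩
  · refine mem_filter.2 ⟨mem_range.2 ((range_spec hc ht).2 ?_), ?_⟩
    · rw [hvt]; exact hsub
    · rw [hvt, himg]; exact he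
  · rw [hvt, himg]

theorem TT_spec {n m : ℕ} (hm : m ≤ 165) (hc : rangeChk n m = true)
    {H : Finset (Finset ℕ)} {ψ : ℕ → ℕ} {t : ℕ} (ht : t ∈ TT m H ψ) :
    t < 165 ∧ verts t ⊆ range n ∧ (verts t).image ψ ∈ H := by
  obtain ⟨h1, h2⟩ := mem_filter.1 ht
  have h1 := mem_range.1 h1
  exact ⟨by omega, (range_spec hc (by omega)).1 h1, h2⟩

theorem star_of {V : Finset ℕ} {H : Finset (Finset ℕ)} (hV : 4 ≤ V.card) (hH : ThreeGraphOn V H)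
    (hns : ¬ SubStarPlus V H) {w : ℕ} (hw : w ∈ V) : 2 ≤ (H.filter fun e => w ∉ e).card := by
  by_contra hlt
  apply hns
  have h1 : (H.filter fun e => w ∉ e).card ≤ 1 := by omega
  have hex : ∃ e : Finset ℕ, e ⊆ V ∧ e.card = 3 ∧ w ∉ e ∧ ∀ f ∈ H, w ∉ f → f = e := by
    rcases (H.filter fun e => w ∉ e).eq_empty_or_nonempty with h0 | ⟨e, he⟩
    · obtain ⟨e, he, hc⟩ := exists_subset_card_eq (s := V.erase w) (n := 3)
        (by rw [card_erase_of_mem hw]; omega)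
      refine ⟨e, he.trans (erase_subset _ _), hc, fun h => ?_, fun f hf hwf => ?_⟩
      · simpa using he h
      · have : f ∈ H.filter fun e => w ∉ e := mem_filter.2 ⟨hf, hwf⟩
        rw [h0] at this
        simp at this
    · have he' := mem_filter.1 he
      refine ⟨e, (hH e he'.1).1, (hH e he'.1).2, he'.2, fun f hf hwf => ?_⟩
      exact card_le_one.1 h1 f (mem_filter.2 ⟨hf, hwf⟩) e he
  obtain ⟨e, heV, he3, hwe, hall⟩ := hex
  refine ⟨_, ⟨w, hw, e, heV, he3, hwe, rfl⟩, fun f hf => ?_⟩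
  by_cases hwf : w ∈ f
  · exact mem_union_left _ (mem_filter.2 ⟨mem_powersetCard.2 (hH f hf), hwf⟩)
  · exact mem_union_right _ (mem_singleton.2 (hall f hf hwf))

theorem nonSP_of {V : Finset ℕ} {H : Finset (Finset ℕ)} (hH : ThreeGraphOn V H)
    (hns : ¬ SubSP V H) {w : ℕ} (hw : w ∈ V) {f g : Finset ℕ} (hf : f ∈ H) (hg : g ∈ H)
    (hwf : w ∉ f) (hwg : w ∉ g) (h1 : (f ∩ g).card = 1) :
    ∃ e ∈ H, e ≠ f ∧ e ≠ g ∧ ¬ (w ∈ e ∧ ((f ∩ e).Nonempty ∨ (g ∩ e).Nonempty)) := by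
  by_contra hno
  push Not at hno
  apply hns
  refine ⟨_, ⟨w, hw, f, g, (hH f hf).1, (hH g hg).1, (hH f hf).2, (hH g hg).2, h1, by simp [hwf, hwg], rfl⟩,
    fun e he => ?_⟩
  by_cases hef : e = f
  · simp [hef]
  by_cases heg : e = g
  · simp [heg]
  obtain ⟨hwe, hor⟩ := hno e he hef heg
  refine mem_union_right _ (mem_filter.2 ⟨mem_powersetCard.2 (hH e he), hwe, ?_⟩)
  rw [inter_union_distrib_left, union_nonempty, inter_comm e f, inter_comm e g]
  exact hor

theorem good_of {n m K : ℕ} (hn : n ≤ 11) (hn4 : 4 ≤ n) (hm : m ≤ 165) (hc : rangeChk n m = true)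
    {V : Finset ℕ} {H : Finset (Finset ℕ)} (hV : V.card = n) (hH : ThreeGraphOn V H)
    (hK : K ≤ H.card) (hst : ¬ SubStarPlus V H) (hsp : ¬ SubSP V H) {ψ : ℕ → ℕ} (h : Lab n V ψ) :
    Good n K (TT m H ψ) where
  lt t ht := (TT_spec hm hc ht).1
  card := by
    refine hK.trans (le_trans (card_le_card ?_) (card_image_le (f := fun t => (verts t).image ψ)))
    intro e he
    obtain ⟨t, ht, _, rfl⟩ := h.surj hn hc hH he
    exact mem_image_of_mem (fun t => (verts t).image ψ) ht
  star v hv := by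
    have hw : ψ v ∈ V := by rw [← h.img]; exact mem_image_of_mem _ (mem_range.2 hv)
    refine (star_of (by omega) hH hst hw).trans
      (le_trans (card_le_card ?_) (card_image_le (f := fun t => (verts t).image ψ)))
    intro e he
    obtain ⟨he, hwe⟩ := mem_filter.1 he
    obtain ⟨t, ht, _, rfl⟩ := h.surj hn hc hH he
    refine mem_image_of_mem (fun t => (verts t).image ψ) (mem_filter.2 ⟨ht, ?_⟩)
    rwa [h.mem (TT_spec hm hc ht).2.1 hv] at hwe
  nonSP v hv f hf g hg hvf hvg h1 := by
    have hw : ψ v ∈ V := by rw [← h.img]; exact mem_image_of_mem _ (mem_range.2 hv)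
    obtain ⟨_, hfs, hfH⟩ := TT_spec hm hc hf
    obtain ⟨_, hgs, hgH⟩ := TT_spec hm hc hg
    obtain ⟨e, he, hef, heg, hne⟩ := nonSP_of hH hsp hw hfH hgH
      (by rwa [h.mem hfs hv]) (by rwa [h.mem hgs hv]) (by rwa [h.inter_card hfs hgs])
    obtain ⟨t, ht, _, rfl⟩ := h.surj hn hc hH he
    have hts := (TT_spec hm hc ht).2.1
    refine ⟨t, ht, fun hh => hef (by rw [hh]), fun hh => heg (by rw [hh]), ?_⟩
    rwa [h.mem hts hv, h.inter_ne hfs hts, h.inter_ne hgs hts] at hne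

theorem noP_of {n m : ℕ} (hm : m ≤ 165) (hc : rangeChk n m = true) {V : Finset ℕ}
    {H : Finset (Finset ℕ)} (hP : P4Free H) {ψ : ℕ → ℕ} (h : Lab n V ψ) : NoP (TT m H ψ) := by
  intro a ha b hb c hcc d hd h1 h2 h3 h4 h5 h6
  obtain ⟨_, has, haH⟩ := TT_spec hm hc ha
  obtain ⟨_, hbs, hbH⟩ := TT_spec hm hc hb
  obtain ⟨_, hcs, hcH⟩ := TT_spec hm hc hcc
  obtain ⟨_, hds, hdH⟩ := TT_spec hm hc hd
  refine hP ⟨_, haH, _, hbH, _, hcH, _, hdH, (h.inter_ne has hbs).2 h1, (h.inter_ne hbs hcs).2 h2,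
    (h.inter_ne hcs hds).2 h3, ?_, ?_, ?_⟩ <;> rw [← not_nonempty_iff_eq_empty]
  · rwa [h.inter_ne has hcs]
  · rwa [h.inter_ne has hds]
  · rwa [h.inter_ne hbs hds]

theorem noI_of {n m : ℕ} (hm : m ≤ 165) (hc : rangeChk n m = true) {V : Finset ℕ}
    {H : Finset (Finset ℕ)} (hI : ∀ a ∈ H, ∀ b ∈ H, ∀ c ∈ H, 2 ≤ (a ∩ b).card → (b ∩ c).Nonempty →
      (a ∩ c).Nonempty) {ψ : ℕ → ℕ} (h : Lab n V ψ) : NoI (TT m H ψ) := by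
  intro a ha b hb c hcc h1 h2
  obtain ⟨_, has, haH⟩ := TT_spec hm hc ha
  obtain ⟨_, hbs, hbH⟩ := TT_spec hm hc hb
  obtain ⟨_, hcs, hcH⟩ := TT_spec hm hc hcc
  have := hI _ haH _ hbH _ hcH
  rw [h.inter_card has hbs, h.inter_ne hbs hcs, h.inter_ne has hcs] at this
  exact this h1 h2

theorem noT_of {n m : ℕ} (hm : m ≤ 165) (hc : rangeChk n m = true) {V : Finset ℕ}
    {H : Finset (Finset ℕ)} (hI : ∀ a ∈ H, ∀ b ∈ H, ∀ c ∈ H, (a ∩ b).Nonempty → (b ∩ c).Nonempty →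
      (a ∩ c).Nonempty) {ψ : ℕ → ℕ} (h : Lab n V ψ) : NoT (TT m H ψ) := by
  intro a ha b hb c hcc h1 h2
  obtain ⟨_, has, haH⟩ := TT_spec hm hc ha
  obtain ⟨_, hbs, hbH⟩ := TT_spec hm hc hb
  obtain ⟨_, hcs, hcH⟩ := TT_spec hm hc hcc
  have := hI _ haH _ hbH _ hcH
  rw [h.inter_ne has hbs, h.inter_ne hbs hcs, h.inter_ne has hcs] at this
  exact this h1 h2

theorem Lab.swap {n : ℕ} {V : Finset ℕ} {ψ : ℕ → ℕ} (h : Lab n V ψ) {x y : ℕ} (hx : x < n)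
    (hy : y < n) : Lab n V (ψ ∘ Equiv.swap x y) := by
  have hr : ∀ i < n, Equiv.swap x y i < n := by
    intro i hi
    rw [Equiv.swap_apply_def]
    split_ifs <;> omega
  constructor
  · intro a ha b hb hab
    have ha : a < n := by simpa using ha
    have hb : b < n := by simpa using hb
    exact (Equiv.swap x y).injective (h.inj (by simpa using hr a ha) (by simpa using hr b hb) hab)
  · rw [← h.img]
    ext w
    simp only [mem_image, mem_range, Function.comp]
    constructor
    · rintro ⟨i, hi, rfl⟩; exact ⟨_, hr i hi, rfl⟩
    · rintro ⟨i, hi, rfl⟩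
      exact ⟨Equiv.swap x y i, hr i hi, by rw [Equiv.swap_apply_self]⟩

theorem refute {n m K : ℕ} (hn : n ≤ 11) (hn4 : 4 ≤ n) (hm : m ≤ 165) (hc : rangeChk n m = true)
    {V : Finset ℕ} {H : Finset (Finset ℕ)} (hV : V.card = n) (hH : ThreeGraphOn V H)
    (hK : K ≤ H.card) (hst : ¬ SubStarPlus V H) (hsp : ¬ SubSP V H)
    {fb : Ed → List Ed → ℕ} {gens S : List (ℕ × ℕ)} {R : List ℕ} {A : ℕ}
    (hfb : ∀ ψ, Lab n V ψ → FbOK fb (TT m H ψ))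
    (hS : S.all (fun s => decide (s.1 < 165)) = true) (hA : A = 2 ^ m - 1)
    (hg : ∀ g ∈ gens, g.1 < g.2 ∧ g.2 < n ∧ ∀ r ∈ R, (verts r).image (Equiv.swap g.1 g.2) = verts r)
    (hR : ∀ r ∈ R, r < m) (hroot : root n K fb gens S R [] A = true)
    {ψ : ℕ → ℕ} (h : Lab n V ψ) (hψ : ∀ r ∈ R, (verts r).image ψ ∈ H) : False := by
  let F : Set (Finset ℕ) := {T | ∃ ψ, Lab n V ψ ∧ (∀ r ∈ R, (verts r).image ψ ∈ H) ∧ T = TT m H ψ}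
  have hF : Fam n K fb gens (R.reverse ++ []) F := by
    constructor
    · rintro T ⟨ψ, h, -, rfl⟩
      exact good_of hn hn4 hm hc hV hH hK hst hsp h
    · rintro T ⟨ψ, h, -, rfl⟩
      exact hfb ψ h
    · rintro T ⟨ψ, h, h', rfl⟩ t ht
      have ht : t ∈ R := by simpa using ht
      exact mem_filter.2 ⟨mem_range.2 (hR t ht), h' t ht⟩
    · intro g hgm
      obtain ⟨h1, h2, h3⟩ := hg g hgm
      refine ⟨h1, by omega, ?_⟩
      rintro t ht t' ht' hsw hd T ⟨ψ, h, h', rfl⟩ hT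
      have hsw : verts t' = (verts t).image (Equiv.swap g.1 g.2) := hsw
      refine hd (TT m H (ψ ∘ Equiv.swap g.1 g.2)) ⟨_, h.swap (h1.trans h2) h2, ?_, rfl⟩ ?_
      · intro r hr
        rw [← image_image, h3 r hr]
        exact h' r hr
      · obtain ⟨_, hs, hH'⟩ := TT_spec hm hc hT
        refine mem_filter.2 ⟨mem_range.2 ((range_spec hc ht).2 ?_), ?_⟩
        · intro v hv
          have : Equiv.swap g.1 g.2 v ∈ range n := hs (by rw [hsw]; exact mem_image_of_mem _ hv)
          rw [mem_range, Equiv.swap_apply_def] at this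
          rw [mem_range]
          split_ifs at this <;> omega
        · rw [← image_image, ← hsw]; exact hH'
  refine root_ok hn S ?_ R [] A hF ?_ hroot (TT m H ψ) ⟨ψ, h, hψ, rfl⟩
  · intro s hs
    simpa using List.all_eq_true.1 hS s hs
  · rintro T ⟨ψ, h, -, rfl⟩ t ht
    rw [hA, Nat.testBit_two_pow_sub_one]
    simpa using (mem_filter.1 ht).1

theorem lab_exists {n : ℕ} {V : Finset ℕ} (hV : V.card = n) {l : List ℕ} (hl : l.Nodup)
    (hs : ∀ x ∈ l, x ∈ V) : ∃ ψ, Lab n V ψ ∧ ∀ i (h : i < l.length), ψ i = l[i] := by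
  let l' := l ++ (V \ l.toFinset).toList
  have hnd : l'.Nodup := by
    refine hl.append (nodup_toList _) ?_
    intro x hx hx'
    simp at hx'
    exact hx'.2 hx
  have hmem : l'.toFinset = V := by
    ext x
    simp only [l', List.mem_toFinset, List.mem_append, mem_toList, mem_sdiff]
    constructor
    · rintro (h | h)
      · exact hs x h
      · exact h.1
    · intro h
      by_cases hx : x ∈ l
      · exact Or.inl hx
      · exact Or.inr ⟨h, hx⟩
  have hlen : l'.length = n := by
    rw [← List.toFinset_card_of_nodup hnd, hmem, hV]
  refine ⟨fun i => l'.getD i 0, ⟨?_, ?_⟩, ?_⟩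
  · intro a ha b hb hab
    have ha : a < l'.length := by rw [hlen]; simpa using ha
    have hb : b < l'.length := by rw [hlen]; simpa using hb
    simp only [List.getD_eq_getElem _ _ ha, List.getD_eq_getElem _ _ hb] at hab
    exact (hnd.getElem_inj_iff).1 hab
  · ext w
    rw [← hmem, List.mem_toFinset, List.mem_iff_getElem]
    simp only [mem_image, mem_range]
    constructor
    · rintro ⟨i, hi, rfl⟩
      rw [← hlen] at hi
      exact ⟨i, hi, by rw [List.getD_eq_getElem _ _ hi]⟩
    · rintro ⟨i, hi, rfl⟩
      exact ⟨i, by omega, by rw [List.getD_eq_getElem _ _ hi]⟩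
  · intro i hi
    have : i < l'.length := by simp [l']; omega
    simp only [List.getD_eq_getElem _ _ this, l']
    exact List.getElem_append_left hi


theorem v0 : verts 0 = {0, 1, 2} := by decide +kernel
theorem v3 : verts 3 = {1, 2, 3} := by decide +kernel
theorem v9 : verts 9 = {2, 3, 4} := by decide +kernel
theorem v19 : verts 19 = {3, 4, 5} := by decide +kernel
theorem v34 : verts 34 = {4, 5, 6} := by decide +kernel

theorem labT {n : ℕ} {V : Finset ℕ} {H : Finset (Finset ℕ)} (hV : V.card = n) (hH : ThreeGraphOn V H)
    {a : Finset ℕ} (ha : a ∈ H) : ∃ ψ, Lab n V ψ ∧ ∀ r ∈ [0], (verts r).image ψ ∈ H := by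
  obtain ⟨haV, ha3⟩ := hH a ha
  obtain ⟨x, y, z, hxy, hxz, hyz, rfl⟩ := card_eq_three.1 ha3
  obtain ⟨ψ, h, hψ⟩ := lab_exists hV (l := [x, y, z]) (by simp [hxy, hxz, hyz])
    (by intro w hw; apply haV; simpa using hw)
  have h0 : ψ 0 = x := hψ 0 (by simp)
  have h1 : ψ 1 = y := hψ 1 (by simp)
  have h2 : ψ 2 = z := hψ 2 (by simp)
  refine ⟨ψ, h, ?_⟩
  simpa [v0, image_insert, h0, h1, h2] using ha

theorem lab1 {n : ℕ} {V : Finset ℕ} {H : Finset (Finset ℕ)} (hV : V.card = n) (hH : ThreeGraphOn V H)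
    {a b c : Finset ℕ} (ha : a ∈ H) (hb : b ∈ H) (hc : c ∈ H) (hab : 2 ≤ (a ∩ b).card)
    (hbc : (b ∩ c).Nonempty) (hac : a ∩ c = ∅) :
    ∃ ψ, Lab n V ψ ∧ ∀ r ∈ [0, 3, 19], (verts r).image ψ ∈ H := by
  obtain ⟨haV, ha3⟩ := hH a ha
  obtain ⟨hbV, hb3⟩ := hH b hb
  obtain ⟨hcV, hc3⟩ := hH c hc
  have hac' : ∀ x ∈ a, x ∉ c := fun x h1 h2 => by
    have : x ∈ a ∩ c := mem_inter.2 ⟨h1, h2⟩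
    rw [hac] at this; simp at this
  obtain ⟨x3, hx3⟩ := hbc
  obtain ⟨hx3b, hx3c⟩ := mem_inter.1 hx3
  have hx3a : x3 ∉ a := fun h => hac' _ h hx3c
  have hlt : (a ∩ b).card = 2 := by
    have h1 : a ∩ b ⊆ b.erase x3 := by
      intro x hx
      obtain ⟨h1, h2⟩ := mem_inter.1 hx
      exact mem_erase.2 ⟨fun h => hx3a (h ▸ h1), h2⟩
    have := card_le_card h1
    rw [card_erase_of_mem hx3b] at this
    omega
  obtain ⟨x1, x2, h12, hi⟩ := card_eq_two.1 hlt
  have m1 : x1 ∈ a ∩ b := by rw [hi]; simp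
  have m2 : x2 ∈ a ∩ b := by rw [hi]; simp
  obtain ⟨m1a, m1b⟩ := mem_inter.1 m1
  obtain ⟨m2a, m2b⟩ := mem_inter.1 m2
  have h31 : x3 ≠ x1 := by rintro rfl; exact hx3a m1a
  have h32 : x3 ≠ x2 := by rintro rfl; exact hx3a m2a
  have eb : ({x1, x2, x3} : Finset ℕ) = b := by
    apply eq_of_subset_of_card_le
    · intro x hx; simp at hx; rcases hx with rfl | rfl | rfl <;> assumption
    · rw [hb3, card_eq_three.2 ⟨x1, x2, x3, h12, h31.symm, h32.symm, rfl⟩]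
  have hda : (a \ b).card = 1 := by
    have := card_sdiff_add_card_inter a b
    omega
  obtain ⟨x0, hd⟩ := card_eq_one.1 hda
  have m0 : x0 ∈ a \ b := by rw [hd]; simp
  obtain ⟨m0a, m0b⟩ := mem_sdiff.1 m0
  have h01 : x0 ≠ x1 := by rintro rfl; exact m0b m1b
  have h02 : x0 ≠ x2 := by rintro rfl; exact m0b m2b
  have ea : ({x0, x1, x2} : Finset ℕ) = a := by
    apply eq_of_subset_of_card_le
    · intro x hx; simp at hx; rcases hx with rfl | rfl | rfl <;> assumption
    · rw [ha3, card_eq_three.2 ⟨x0, x1, x2, h01, h02, h12, rfl⟩]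
  obtain ⟨x4, x5, h45, he⟩ := card_eq_two.1
    (show (c.erase x3).card = 2 by rw [card_erase_of_mem hx3c, hc3])
  have m4 : x4 ∈ c.erase x3 := by rw [he]; simp
  have m5 : x5 ∈ c.erase x3 := by rw [he]; simp
  obtain ⟨h43, m4c⟩ := mem_erase.1 m4
  obtain ⟨h53, m5c⟩ := mem_erase.1 m5
  have ec : ({x3, x4, x5} : Finset ℕ) = c := by rw [← he, insert_erase hx3c]
  have hnd : [x0, x1, x2, x3, x4, x5].Nodup := by
    have := hac' _ m0a
    have := hac' _ m1a
    have := hac' _ m2a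
    simp only [List.nodup_cons, List.mem_cons, List.not_mem_nil, or_false]
    grind
  obtain ⟨ψ, h, hψ⟩ := lab_exists hV hnd (by
    intro w hw; simp at hw
    rcases hw with rfl | rfl | rfl | rfl | rfl | rfl
    exacts [haV m0a, haV m1a, haV m2a, hbV hx3b, hcV m4c, hcV m5c])
  have p0 : ψ 0 = x0 := hψ 0 (by simp)
  have p1 : ψ 1 = x1 := hψ 1 (by simp)
  have p2 : ψ 2 = x2 := hψ 2 (by simp)
  have p3 : ψ 3 = x3 := hψ 3 (by simp)
  have p4 : ψ 4 = x4 := hψ 4 (by simp)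
  have p5 : ψ 5 = x5 := hψ 5 (by simp)
  refine ⟨ψ, h, ?_⟩
  simp [v0, v3, v19, image_insert, p0, p1, p2, p3, p4, p5, ea, eb, ec, ha, hb, hc]

theorem lab2 {n : ℕ} {V : Finset ℕ} {H : Finset (Finset ℕ)} (hV : V.card = n) (hH : ThreeGraphOn V H)
    {a b c : Finset ℕ} (ha : a ∈ H) (hb : b ∈ H) (hc : c ∈ H) (hab : (a ∩ b).card = 1)
    (hbc : (b ∩ c).card = 1) (hac : a ∩ c = ∅) :
    ∃ ψ, Lab n V ψ ∧ ∀ r ∈ [0, 9, 34], (verts r).image ψ ∈ H := by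
  obtain ⟨haV, ha3⟩ := hH a ha
  obtain ⟨hbV, hb3⟩ := hH b hb
  obtain ⟨hcV, hc3⟩ := hH c hc
  have hac' : ∀ x ∈ a, x ∉ c := fun x h1 h2 => by
    have : x ∈ a ∩ c := mem_inter.2 ⟨h1, h2⟩
    rw [hac] at this; simp at this
  obtain ⟨x2, hi⟩ := card_eq_one.1 hab
  obtain ⟨x4, hj⟩ := card_eq_one.1 hbc
  have m2 : x2 ∈ a ∩ b := by rw [hi]; simp
  have m4 : x4 ∈ b ∩ c := by rw [hj]; simp
  obtain ⟨m2a, m2b⟩ := mem_inter.1 m2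
  obtain ⟨m4b, m4c⟩ := mem_inter.1 m4
  have h24 : x2 ≠ x4 := by rintro rfl; exact hac' _ m2a m4c
  have hb1 : ((b.erase x2).erase x4).card = 1 := by
    rw [card_erase_of_mem (mem_erase.2 ⟨h24.symm, m4b⟩), card_erase_of_mem m2b, hb3]
  obtain ⟨x3, hk⟩ := card_eq_one.1 hb1
  have m3 : x3 ∈ (b.erase x2).erase x4 := by rw [hk]; simp
  obtain ⟨h34, m3'⟩ := mem_erase.1 m3
  obtain ⟨h32, m3b⟩ := mem_erase.1 m3'
  have m3a : x3 ∉ a := fun h => h32 (by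
    have : x3 ∈ a ∩ b := mem_inter.2 ⟨h, m3b⟩
    rw [hi] at this; simpa using this)
  have m3c : x3 ∉ c := fun h => h34 (by
    have : x3 ∈ b ∩ c := mem_inter.2 ⟨m3b, h⟩
    rw [hj] at this; simpa using this)
  have eb : ({x2, x3, x4} : Finset ℕ) = b := by
    apply eq_of_subset_of_card_le
    · intro x hx; simp at hx; rcases hx with rfl | rfl | rfl <;> assumption
    · rw [hb3, card_eq_three.2 ⟨x2, x3, x4, h32.symm, h24, h34, rfl⟩]
  obtain ⟨x0, x1, h01, he⟩ := card_eq_two.1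
    (show (a.erase x2).card = 2 by rw [card_erase_of_mem m2a, ha3])
  have m0 : x0 ∈ a.erase x2 := by rw [he]; simp
  have m1 : x1 ∈ a.erase x2 := by rw [he]; simp
  obtain ⟨h02, m0a⟩ := mem_erase.1 m0
  obtain ⟨h12, m1a⟩ := mem_erase.1 m1
  have ea : ({x0, x1, x2} : Finset ℕ) = a := by
    apply eq_of_subset_of_card_le
    · intro x hx; simp at hx; rcases hx with rfl | rfl | rfl <;> assumption
    · rw [ha3, card_eq_three.2 ⟨x0, x1, x2, h01, h02, h12, rfl⟩]
  obtain ⟨x5, x6, h56, hf⟩ := card_eq_two.1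
    (show (c.erase x4).card = 2 by rw [card_erase_of_mem m4c, hc3])
  have m5 : x5 ∈ c.erase x4 := by rw [hf]; simp
  have m6 : x6 ∈ c.erase x4 := by rw [hf]; simp
  obtain ⟨h54, m5c⟩ := mem_erase.1 m5
  obtain ⟨h64, m6c⟩ := mem_erase.1 m6
  have ec : ({x4, x5, x6} : Finset ℕ) = c := by rw [← hf, insert_erase m4c]
  have hnd : [x0, x1, x2, x3, x4, x5, x6].Nodup := by
    have := hac' _ m0a
    have := hac' _ m1a
    have := hac' _ m2a
    simp only [List.nodup_cons, List.mem_cons, List.not_mem_nil, or_false]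
    grind
  obtain ⟨ψ, h, hψ⟩ := lab_exists hV hnd (by
    intro w hw; simp at hw
    rcases hw with rfl | rfl | rfl | rfl | rfl | rfl | rfl
    exacts [haV m0a, haV m1a, haV m2a, hbV m3b, hcV m4c, hcV m5c, hcV m6c])
  have p0 : ψ 0 = x0 := hψ 0 (by simp)
  have p1 : ψ 1 = x1 := hψ 1 (by simp)
  have p2 : ψ 2 = x2 := hψ 2 (by simp)
  have p3 : ψ 3 = x3 := hψ 3 (by simp)
  have p4 : ψ 4 = x4 := hψ 4 (by simp)
  have p5 : ψ 5 = x5 := hψ 5 (by simp)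
  have p6 : ψ 6 = x6 := hψ 6 (by simp)
  refine ⟨ψ, h, ?_⟩
  simp [v0, v9, v34, image_insert, p0, p1, p2, p3, p4, p5, p6, ea, eb, ec, ha, hb, hc]

theorem all_modes {n m K : ℕ} (hn : n ≤ 11) (hn9 : 9 ≤ n) (hm : m ≤ 165) (hm4 : 84 ≤ m)
    (hc : rangeChk n m = true)
    {V : Finset ℕ} {H : Finset (Finset ℕ)} (hV : V.card = n) (hH : ThreeGraphOn V H)
    (hP : P4Free H) (hK0 : 0 < K)
    (hK : K ≤ H.card) (hst : ¬ SubStarPlus V H) (hsp : ¬ SubSP V H)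
    {g1 g2 g3 S1 S2 S3 : List (ℕ × ℕ)} {A : ℕ} (hA : A = 2 ^ m - 1)
    (hS1 : S1.all (fun s => decide (s.1 < 165)) = true)
    (hS2 : S2.all (fun s => decide (s.1 < 165)) = true)
    (hS3 : S3.all (fun s => decide (s.1 < 165)) = true)
    (hg1 : ∀ g ∈ g1, g.1 < g.2 ∧ g.2 < n ∧ ∀ s ∈ [({0, 1, 2} : Finset ℕ), {1, 2, 3}, {3, 4, 5}],
      s.image (Equiv.swap g.1 g.2) = s)
    (hg2 : ∀ g ∈ g2, g.1 < g.2 ∧ g.2 < n ∧ ∀ s ∈ [({0, 1, 2} : Finset ℕ), {2, 3, 4}, {4, 5, 6}],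
      s.image (Equiv.swap g.1 g.2) = s)
    (hg3 : ∀ g ∈ g3, g.1 < g.2 ∧ g.2 < n ∧ ∀ s ∈ [({0, 1, 2} : Finset ℕ)],
      s.image (Equiv.swap g.1 g.2) = s)
    (h1 : root n K fbP g1 S1 [0, 3, 19] [] A = true)
    (h2 : root n K fbI g2 S2 [0, 9, 34] [] A = true)
    (h3 : root n K fbT g3 S3 [0] [] A = true) : False := by
  have hn4 : 4 ≤ n := by omega
  by_cases hI : ∀ a ∈ H, ∀ b ∈ H, ∀ c ∈ H, 2 ≤ (a ∩ b).card → (b ∩ c).Nonempty → (a ∩ c).Nonempty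
  · by_cases hT : ∀ a ∈ H, ∀ b ∈ H, ∀ c ∈ H, (a ∩ b).Nonempty → (b ∩ c).Nonempty → (a ∩ c).Nonempty
    · obtain ⟨a, ha⟩ := card_pos.1 (hK0.trans_le hK)
      obtain ⟨ψ, h, hψ⟩ := labT hV hH ha
      refine refute hn hn4 hm hc hV hH hK hst hsp
        (fun ψ h => fbT_ok (fun t ht => (TT_spec hm hc ht).1) (noT_of hm hc hT h)) hS3 hA ?_ ?_ h3 h hψ
      · intro g hg
        obtain ⟨q1, q2, q3⟩ := hg3 g hg
        refine ⟨q1, q2, ?_⟩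
        simpa [v0] using q3
      · simp; omega
    · push Not at hT
      obtain ⟨a, ha, b, hb, c, hcc, hab, hbc, hac⟩ := hT
      have e1 : (a ∩ b).card = 1 := by
        have hp := card_pos.2 hab
        by_contra hne
        have := hI a ha b hb c hcc (by omega) hbc
        rw [hac] at this
        exact not_nonempty_empty this
      have e2 : (b ∩ c).card = 1 := by
        have hp := card_pos.2 hbc
        by_contra hne
        have := hI c hcc b hb a ha (by rw [inter_comm]; omega) (by rwa [inter_comm])
        rw [inter_comm c a, hac] at this
        exact not_nonempty_empty this
      obtain ⟨ψ, h, hψ⟩ := lab2 hV hH ha hb hcc e1 e2 hac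
      refine refute hn hn4 hm hc hV hH hK hst hsp
        (fun ψ h => fbI_ok (fun t ht => (TT_spec hm hc ht).1) (noP_of hm hc hP h) (noI_of hm hc hI h))
        hS2 hA ?_ ?_ h2 h hψ
      · intro g hg
        obtain ⟨q1, q2, q3⟩ := hg2 g hg
        refine ⟨q1, q2, ?_⟩
        simpa [v0, v9, v34] using q3
      · simp; omega
  · push Not at hI
    obtain ⟨a, ha, b, hb, c, hcc, hab, hbc, hac⟩ := hI
    obtain ⟨ψ, h, hψ⟩ := lab1 hV hH ha hb hcc hab hbc hac
    refine refute hn hn4 hm hc hV hH hK hst hsp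
      (fun ψ h => fbP_ok (fun t ht => (TT_spec hm hc ht).1) (noP_of hm hc hP h)) hS1 hA ?_ ?_ h1 h hψ
    · intro g hg
      obtain ⟨q1, q2, q3⟩ := hg1 g hg
      refine ⟨q1, q2, ?_⟩
      simpa [v0, v3, v19] using q3
    · simp; omega

theorem sp_card {n : ℕ} (h9 : 9 ≤ n) (h11 : n ≤ 11) {V : Finset ℕ} {H : Finset (Finset ℕ)}
    (hV : V.card = n) (h : IsSPOn V H) : H.card = 5 * n - 18 := by
  obtain ⟨v, hv, f, g, hf, hg, hf3, hg3, h1, hvn, rfl⟩ := h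
  have hu : (f ∪ g).card = 5 := by
    have := card_union_add_card_inter f g
    omega
  have huV : f ∪ g ⊆ V := union_subset hf hg
  have hfg : f ≠ g := by
    rintro rfl
    rw [inter_self] at h1; omega
  generalize hU : f ∪ g = U at *
  have hdisj : Disjoint ({f, g} : Finset (Finset ℕ))
      ((V.powersetCard 3).filter (fun t => v ∈ t ∧ (t ∩ U).Nonempty)) := by
    rw [disjoint_left]
    intro t ht ht'
    have hvt := (mem_filter.1 ht').2.1
    apply hvn
    rw [← hU, mem_union]
    simp at ht
    rcases ht with rfl | rfl
    · exact Or.inl hvt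
    · exact Or.inr hvt
  rw [card_union_of_disjoint hdisj, card_pair hfg]
  let P := (V.erase v).powersetCard 2
  let Q := ((V.erase v) \ U).powersetCard 2
  have hQP : Q ⊆ P := powersetCard_mono sdiff_subset
  have himg : (V.powersetCard 3).filter (fun t => v ∈ t ∧ (t ∩ U).Nonempty) =
      (P \ Q).image (insert v) := by
    ext t
    simp only [mem_filter, mem_powersetCard, mem_image, mem_sdiff, P, Q]
    constructor
    · rintro ⟨⟨htV, ht3⟩, hvt, w, hw⟩
      obtain ⟨hwt, hwU⟩ := mem_inter.1 hw
      have hwv : w ≠ v := by rintro rfl; exact hvn hwU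
      refine ⟨t.erase v, ⟨⟨erase_subset_erase _ htV, by rw [card_erase_of_mem hvt, ht3]⟩, ?_⟩,
        insert_erase hvt⟩
      rintro ⟨hs, -⟩
      have := hs (mem_erase.2 ⟨hwv, hwt⟩)
      exact (mem_sdiff.1 this).2 hwU
    · rintro ⟨s, ⟨⟨hs, hs2⟩, hn⟩, rfl⟩
      have hvs : v ∉ s := fun h => by simpa using hs h
      refine ⟨⟨insert_subset hv (hs.trans (erase_subset _ _)), by rw [card_insert_of_notMem hvs, hs2]⟩,
        mem_insert_self _ _, ?_⟩
      by_contra hne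
      apply hn
      refine ⟨fun x hx => mem_sdiff.2 ⟨hs hx, fun hxU => hne ⟨x, mem_inter.2 ⟨mem_insert_of_mem hx, hxU⟩⟩⟩, hs2⟩
  have hinj : Set.InjOn (insert v) ((P \ Q : Finset (Finset ℕ)) : Set (Finset ℕ)) := by
    intro s hs t ht hst
    have hs : s ∈ P \ Q := hs
    have ht : t ∈ P \ Q := ht
    have hvs : v ∉ s := fun h => by simpa using (mem_powersetCard.1 (mem_sdiff.1 hs).1).1 h
    have hvt : v ∉ t := fun h => by simpa using (mem_powersetCard.1 (mem_sdiff.1 ht).1).1 h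
    have hst : insert v s = insert v t := hst
    rw [← erase_insert hvs, hst, erase_insert hvt]
  have hUe : U ⊆ V.erase v := fun x hx => mem_erase.2 ⟨by rintro rfl; exact hvn hx, huV hx⟩
  rw [himg, card_image_of_injOn hinj, card_sdiff_of_subset hQP]
  simp only [P, Q, card_powersetCard, card_sdiff_of_subset hUe, card_erase_of_mem hv, hV, hu]
  interval_cases n <;> decide

theorem ok91 : root 9 27 fbP [(1, 2), (4, 5), (6, 7), (7, 8)] cert91 [0, 3, 19] [] 19342813113834066795298815 = true := by
  decide +kernel

theorem ok92 : root 9 27 fbI [(0, 1), (5, 6), (7, 8)] cert92 [0, 9, 34] [] 19342813113834066795298815 = true := by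
  decide +kernel

theorem ok9T : root 9 27 fbT [(0, 1), (1, 2), (3, 4), (4, 5), (5, 6), (6, 7), (7, 8)] cert9T [0] [] 19342813113834066795298815 = true := by
  decide +kernel

theorem ok101 : root 10 32 fbP [(1, 2), (4, 5), (6, 7), (7, 8), (8, 9)] cert101 [0, 3, 19] [] 1329227995784915872903807060280344575 = true := by
  decide +kernel

theorem ok102 : root 10 32 fbI [(0, 1), (5, 6), (7, 8), (8, 9)] cert102 [0, 9, 34] [] 1329227995784915872903807060280344575 = true := by
  decide +kernel

theorem ok10T : root 10 32 fbT [(0, 1), (1, 2), (3, 4), (4, 5), (5, 6), (6, 7), (7, 8), (8, 9)] cert10T [0] [] 1329227995784915872903807060280344575 = true := by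
  decide +kernel

theorem ok111 : root 11 37 fbP [(1, 2), (4, 5), (6, 7), (7, 8), (8, 9), (9, 10)] cert111 [0, 3, 19] [] 46768052394588893382517914646921056628989841375231 = true := by
  decide +kernel

theorem ok112 : root 11 37 fbI [(0, 1), (5, 6), (7, 8), (8, 9), (9, 10)] cert112 [0, 9, 34] [] 46768052394588893382517914646921056628989841375231 = true := by
  decide +kernel

theorem ok11T : root 11 37 fbT [(0, 1), (1, 2), (3, 4), (4, 5), (5, 6), (6, 7), (7, 8), (8, 9), (9, 10)] cert11T [0] [] 46768052394588893382517914646921056628989841375231 = true := by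
  decide +kernel


theorem fin9 {V : Finset ℕ} {H : Finset (Finset ℕ)} (hV : V.card = 9) (hH : ThreeGraphOn V H)
    (hP : P4Free H) (hst : ¬ SubStarPlus V H) (hK : 27 ≤ H.card) : SubSP V H := by
  by_contra hsp
  exact all_modes (by norm_num) (by norm_num) (by norm_num) (by norm_num) rangeChk9 hV hH hP
    (by norm_num) hK hst hsp (by norm_num) (by decide +kernel) (by decide +kernel) (by decide +kernel)
    (by decide) (by decide) (by decide) ok91 ok92 ok9T

theorem fin10 {V : Finset ℕ} {H : Finset (Finset ℕ)} (hV : V.card = 10) (hH : ThreeGraphOn V H)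
    (hP : P4Free H) (hst : ¬ SubStarPlus V H) (hK : 32 ≤ H.card) : SubSP V H := by
  by_contra hsp
  exact all_modes (by norm_num) (by norm_num) (by norm_num) (by norm_num) rangeChk10 hV hH hP
    (by norm_num) hK hst hsp (by norm_num) (by decide +kernel) (by decide +kernel) (by decide +kernel)
    (by decide) (by decide) (by decide) ok101 ok102 ok10T

theorem fin11 {V : Finset ℕ} {H : Finset (Finset ℕ)} (hV : V.card = 11) (hH : ThreeGraphOn V H)
    (hP : P4Free H) (hst : ¬ SubStarPlus V H) (hK : 37 ≤ H.card) : SubSP V H := by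
  by_contra hsp
  exact all_modes (by norm_num) (by norm_num) (by norm_num) (by norm_num) rangeChk11 hV hH hP
    (by norm_num) hK hst hsp (by norm_num) (by decide +kernel) (by decide +kernel) (by decide +kernel)
    (by decide) (by decide) (by decide) ok111 ok112 ok11T

/-- For `9 ≤ n ≤ 11`: every `𝒫₄`-free 3-graph `H` on `n` vertices that is not
a sub-3-graph of the starplus `Sₙ⁺¹` satisfies `|H| ≤ 5n - 18`, with equality
iff `H` is isomorphic to `SPₙ`. -/
theorem second_order_turan_small (n : ℕ) (h9 : 9 ≤ n) (h11 : n ≤ 11)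
    (V : Finset ℕ) (H : Finset (Finset ℕ)) (hV : V.card = n)
    (hH : ThreeGraphOn V H) (hfree : P4Free H) (hns : ¬SubStarPlus V H) :
    H.card ≤ 5 * n - 18 ∧ (H.card = 5 * n - 18 ↔ IsSPOn V H) := by
  have key : 5 * n - 18 ≤ H.card → IsSPOn V H := by
    intro hK
    have hsub : SubSP V H := by
      interval_cases n
      · exact fin9 hV hH hfree hns hK
      · exact fin10 hV hH hfree hns hK
      · exact fin11 hV hH hfree hns hK
    obtain ⟨H', hH', hs⟩ := hsub
    have hc := sp_card h9 h11 hV hH'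
    rw [eq_of_subset_of_card_le hs (by omega)]
    exact hH'
  refine ⟨?_, fun h => key h.ge, fun h => sp_card h9 h11 hV h⟩
  by_contra hlt
  have := sp_card h9 h11 hV (key (by omega))
  omega
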